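/- arXiv:1302.4116 — 2 statements merged into one kernel-verified Lean document; each statement's English description precedes it below -/
import Mathlib

section
/- Let 0 < α < 1 and let U ∈ 𝒰 be differentiable on (0,π/2] with t·U'(t) ≤ α·U(t) for all 0 < t ≤ π/2. Let ω_U be an increasing function with ω_U(x) → ∞ satisfying η_U(x/ω_U(x)) = ω_U(x) for all sufficiently large x. Let T = C_{φ_U}. Then: (i) there exist constants κ > 0 and C > 0 such that a_n(T) ≤ C·exp(−κ·n/ω_U(n)) for all sufficiently large n; and (ii) for every ε > 0 there is c_ε > 0 such that a_n(T) ≥ c_ε·exp(−((π² + 1)/2 + ε)·n/ω_U(n)) for all sufficiently large n. -/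
open Complex MeasureTheory Filter Set

noncomputable section

abbrev H2 : Type := lp (fun _ : ℕ => ℂ) 2

noncomputable def fa (a : H2) (z : ℂ) : ℂ := ∑' k : ℕ, a k * z ^ k

noncomputable def approxNum (T : H2 →L[ℂ] H2) (n : ℕ) : ℝ :=
  sInf {c : ℝ | ∃ R : H2 →L[ℂ] H2,
    FiniteDimensional ℂ (LinearMap.range R.toLinearMap) ∧
    Module.finrank ℂ (LinearMap.range R.toLinearMap) ≤ n - 1 ∧ c = ‖T - R‖}

noncomputable def hU (U : ℝ → ℝ) (t : ℝ) : ℝ := ∫ x in t..Real.pi, U x / x ^ 2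

def ClassU (U : ℝ → ℝ) : Prop :=
  Continuous U ∧ (∀ t, U (-t) = U t) ∧ Function.Periodic U (2 * Real.pi) ∧
  U 0 = 0 ∧ MonotoneOn U (Set.Icc 0 Real.pi) ∧
  (∀ t, 0 < t → t ≤ Real.pi → 0 < U t) ∧
  Tendsto (fun t => hU U t) (nhdsWithin 0 (Set.Ioi 0)) atTop

noncomputable def etaU (U : ℝ → ℝ) (x : ℝ) : ℝ := -Real.log (U (Real.exp (-x)))

noncomputable def poisson (U : ℝ → ℝ) (r θ : ℝ) : ℝ :=
  ((1 - r ^ 2) / (2 * Real.pi)) *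
    ∫ x in (-Real.pi)..Real.pi, U x / (1 - 2 * r * Real.cos (θ - x) + r ^ 2)

lemma two_toReal_pos : 0 < (2 : ENNReal).toReal := by simp

lemma memlp_two_iff (f : ℕ → ℂ) :
    Memℓp (E := fun _ : ℕ => ℂ) f 2 ↔ Summable (fun k => ‖f k‖ ^ 2) := by
  rw [memℓp_gen_iff two_toReal_pos]; simp

lemma H2_summable_sq (a : H2) : Summable (fun k => ‖a k‖ ^ 2) :=
  (memlp_two_iff _).1 a.2

lemma H2_norm_sq (a : H2) : ‖a‖ ^ 2 = ∑' k, ‖a k‖ ^ 2 := by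
  have := lp.norm_rpow_eq_tsum two_toReal_pos a
  simpa using this

/-- the reproducing kernel -/
def kerH (z : ℂ) (hz : ‖z‖ < 1) : H2 :=
  ⟨fun k => (starRingEnd ℂ z) ^ k, (memlp_two_iff _).2 (by
    have : (fun k : ℕ => ‖(starRingEnd ℂ z) ^ k‖ ^ 2) = fun k => (‖z‖ ^ 2) ^ k := by
      funext k; simp [← pow_mul, mul_comm]
    rw [this]
    exact summable_geometric_of_lt_one (by positivity) (by nlinarith [norm_nonneg z]))⟩

lemma kerH_apply (z : ℂ) (hz : ‖z‖ < 1) (k : ℕ) : kerH z hz k = (starRingEnd ℂ z) ^ k := rfl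

lemma kerH_norm_sq (z : ℂ) (hz : ‖z‖ < 1) : ‖kerH z hz‖ ^ 2 = (1 - ‖z‖ ^ 2)⁻¹ := by
  rw [H2_norm_sq]
  have : (fun k : ℕ => ‖kerH z hz k‖ ^ 2) = fun k => (‖z‖ ^ 2) ^ k := by
    funext k; simp [kerH_apply, ← pow_mul, mul_comm]
  rw [this]
  exact tsum_geometric_of_lt_one (by positivity) (by nlinarith [norm_nonneg z])

lemma inner_kerH (z : ℂ) (hz : ‖z‖ < 1) (a : H2) : inner ℂ (kerH z hz) a = fa a z := by
  rw [lp.inner_eq_tsum, fa]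
  congr 1; funext k
  simp [kerH_apply]

lemma fa_summable (z : ℂ) (hz : ‖z‖ < 1) (a : H2) : Summable (fun k => a k * z ^ k) := by
  have := lp.summable_inner (𝕜 := ℂ) (kerH z hz) a
  simpa [kerH_apply] using this

lemma fa_bound (z : ℂ) (hz : ‖z‖ < 1) (a : H2) :
    ‖fa a z‖ ^ 2 ≤ ‖a‖ ^ 2 / (1 - ‖z‖ ^ 2) := by
  rw [← inner_kerH z hz]
  have h := norm_inner_le_norm (𝕜 := ℂ) (kerH z hz) a
  calc _ ≤ (‖kerH z hz‖ * ‖a‖) ^ 2 := by gcongr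
    _ = _ := by rw [mul_pow, kerH_norm_sq]; ring

lemma fa_add (a b : H2) (z : ℂ) (hz : ‖z‖ < 1) : fa (a + b) z = fa a z + fa b z := by
  simp [← inner_kerH z hz]
lemma fa_sub (a b : H2) (z : ℂ) (hz : ‖z‖ < 1) : fa (a - b) z = fa a z - fa b z := by
  simp [← inner_kerH z hz]
lemma fa_smul (c : ℂ) (b : H2) (z : ℂ) (hz : ‖z‖ < 1) : fa (c • b) z = c * fa b z := by
  simp [← inner_kerH z hz]

/-- shift -/
def shFun (a : ℕ → ℂ) : ℕ → ℂ
  | 0 => 0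
  | k + 1 => a k

lemma shFun_mem (a : H2) : Memℓp (E := fun _ : ℕ => ℂ) (shFun a) 2 := by
  rw [memlp_two_iff, ← summable_nat_add_iff 1]
  exact H2_summable_sq a

def shLin : H2 →ₗᵢ[ℂ] H2 where
  toFun a := ⟨shFun a, shFun_mem a⟩
  map_add' a b := by
    ext k
    cases k with
    | zero => exact (add_zero (0 : ℂ)).symm
    | succ k => rfl
  map_smul' c b := by
    ext k; cases k <;> simp [shFun]
  norm_map' a := by
    rw [← sq_eq_sq₀ (norm_nonneg _) (norm_nonneg _), H2_norm_sq, H2_norm_sq]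
    have h : Summable (fun k => ‖shFun a k‖ ^ 2) := (memlp_two_iff _).1 (shFun_mem a)
    have := h.tsum_eq_zero_add
    simpa [shFun] using this

def sh : H2 →L[ℂ] H2 := shLin.toContinuousLinearMap

lemma sh_succ (a : H2) (k : ℕ) : sh a (k + 1) = a k := rfl
lemma sh_zero (a : H2) : sh a 0 = 0 := rfl
lemma sh_norm (a : H2) : ‖sh a‖ = ‖a‖ := shLin.norm_map a

lemma fa_sh (a : H2) (z : ℂ) (hz : ‖z‖ < 1) : fa (sh a) z = z * fa a z := by
  have h := (fa_summable z hz (sh a)).tsum_eq_zero_add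
  rw [fa, h]
  simp only [sh_zero, sh_succ, fa, ← tsum_mul_left]
  simp only [zero_mul, zero_add]
  congr 1; funext k; ring

lemma sh_adjoint_apply (x : H2) (k : ℕ) :
    (ContinuousLinearMap.adjoint sh x : H2) k = x (k + 1) := by
  have h1 := lp.inner_single_left (𝕜 := ℂ) (G := fun _ : ℕ => ℂ) k 1
    (ContinuousLinearMap.adjoint sh x)
  rw [ContinuousLinearMap.adjoint_inner_right] at h1
  have h2 : sh (lp.single (E := fun _ : ℕ => ℂ) 2 k (1 : ℂ)) = lp.single (E := fun _ : ℕ => ℂ) 2 (k + 1) (1 : ℂ) := by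
    ext j
    cases j with
    | zero => simp [sh_zero]
    | succ j => simp [sh_succ, Pi.single_apply]
  rw [h2, lp.inner_single_left] at h1
  simpa using h1.symm

lemma sh_sub_norm (w : ℝ) (x : H2) :
    ‖sh x - (w : ℂ) • x‖ = ‖x - (w : ℂ) • sh x‖ := by
  rw [← sq_eq_sq₀ (norm_nonneg _) (norm_nonneg _), @norm_sub_sq ℂ, @norm_sub_sq ℂ]
  have h : (inner ℂ (sh x) x).re = (inner ℂ x (sh x)).re := by
    rw [← inner_conj_symm x (sh x), conj_re]
  simp only [norm_smul, sh_norm, inner_smul_right]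
  simp [h]

/-- Blaschke factor operator -/
lemma exists_blaschke_one (w : ℝ) (hw0 : 0 ≤ w) (hw1 : w < 1) :
    ∃ b : H2 →L[ℂ] H2, (∀ y, ‖b y‖ = ‖y‖) ∧
      (∀ y z, ‖z‖ < 1 → fa (b y) z = (z - w) / (1 - w * z) * fa y z) ∧
      LinearMap.rank (1 - b * ContinuousLinearMap.adjoint b : H2 →L[ℂ] H2).toLinearMap ≤ 1 := by
  have hn : ‖(w : ℂ) • sh‖ < 1 := by
    rw [norm_smul]
    have : ‖sh‖ ≤ 1 := ContinuousLinearMap.opNorm_le_bound _ zero_le_one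
      (fun x => by rw [sh_norm, one_mul])
    have h2 : ‖(w : ℂ)‖ = w := by simp [abs_of_nonneg hw0]
    rw [h2]; nlinarith
  obtain ⟨u, hu⟩ := isUnit_one_sub_of_norm_lt_one hn
  set V : H2 →L[ℂ] H2 := ↑u⁻¹ with hV
  have hV1 : ∀ y, V y - (w : ℂ) • sh (V y) = y := by
    intro y
    have h : (↑u * V : H2 →L[ℂ] H2) = 1 := u.mul_inv
    rw [hu] at h
    exact congrArg (fun f : H2 →L[ℂ] H2 => f y) h
  have hV2 : ∀ y, V (y - (w : ℂ) • sh y) = y := by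
    intro y
    have h : (V * ↑u : H2 →L[ℂ] H2) = 1 := u.inv_mul
    rw [hu] at h
    exact congrArg (fun f : H2 →L[ℂ] H2 => f y) h
  set b : H2 →L[ℂ] H2 := (sh - (w : ℂ) • 1) * V with hb
  have hbn : ∀ y, ‖b y‖ = ‖y‖ := by
    intro y
    have : b y = sh (V y) - (w : ℂ) • V y := rfl
    rw [this, sh_sub_norm, hV1]
  refine ⟨b, hbn, ?_, ?_⟩
  · intro y z hz
    have h1 : b y = sh (V y) - (w : ℂ) • V y := rfl
    have h2 := congrArg (fun a => fa a z) (hV1 y)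
    simp only [fa_sub _ _ z hz, fa_smul _ _ z hz, fa_sh _ z hz] at h2
    rw [h1, fa_sub _ _ z hz, fa_smul _ _ z hz, fa_sh _ z hz, ← h2]
    have h3 : (1 : ℂ) - w * z ≠ 0 := by
      intro h
      have h4 : (w : ℂ) * z = 1 := by linear_combination -h
      have h5 : w * ‖z‖ = 1 := by
        have := congrArg norm h4
        simpa [abs_of_nonneg hw0] using this
      nlinarith [norm_nonneg z]
    rw [div_mul_eq_mul_div, eq_div_iff h3]
    ring
  · have hbb : ∀ x, ContinuousLinearMap.adjoint b (b x) = x := by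
      intro x
      have := (ContinuousLinearMap.norm_map_iff_adjoint_comp_self b).1 hbn
      exact congrArg (fun f : H2 →L[ℂ] H2 => f x) this
    have hwn : ‖(w : ℂ)‖ < 1 := by simp [abs_of_nonneg hw0, hw1]
    have hr : LinearMap.range (1 - b * ContinuousLinearMap.adjoint b : H2 →L[ℂ] H2).toLinearMap
        ≤ Submodule.span ℂ {kerH (w : ℂ) hwn} := by
      rintro _ ⟨a, rfl⟩
      set x : H2 := a - b (ContinuousLinearMap.adjoint b a) with hx
      have hx' : (1 - b * ContinuousLinearMap.adjoint b : H2 →L[ℂ] H2).toLinearMap a = x := by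
        simp [hx]
      rw [hx']
      have hbx : ContinuousLinearMap.adjoint b x = 0 := by
        rw [hx, map_sub, hbb, sub_self]
      have hS : ContinuousLinearMap.adjoint sh x = (w : ℂ) • x := by
        have h0 : ∀ y, inner ℂ (sh y - (w : ℂ) • y) x = 0 := by
          intro y
          have h1 : b (y - (w : ℂ) • sh y) = sh y - (w : ℂ) • y := by
            simp only [hb, mul_apply_eq_comp, hV2]; rfl
          rw [← h1, ← ContinuousLinearMap.adjoint_inner_right, hbx, inner_zero_right]
        refine ext_inner_left ℂ (fun y => ?_)
        have := h0 y
        rw [inner_sub_left, inner_smul_left] at this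
        rw [ContinuousLinearMap.adjoint_inner_right, inner_smul_right]
        simp at this
        linear_combination this
      have hk : ∀ k, x k = x 0 * (w : ℂ) ^ k := by
        intro k
        induction k with
        | zero => simp
        | succ k ih =>
          rw [← sh_adjoint_apply, hS, lp.coeFn_smul, Pi.smul_apply, ih, smul_eq_mul]; ring
      refine Submodule.mem_span_singleton.2 ⟨x 0, ?_⟩
      ext k
      rw [hk k, lp.coeFn_smul, Pi.smul_apply, kerH_apply]; simp
    calc _ ≤ Module.rank ℂ (Submodule.span ℂ {kerH (w : ℂ) hwn}) := Submodule.rank_mono hr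
      _ ≤ 1 := by simpa using rank_span_le (R := ℂ) ({kerH (w : ℂ) hwn} : Set H2)

/-- Finite Blaschke product operator -/
lemma exists_blaschke (l : List ℝ) (hl : ∀ w ∈ l, 0 ≤ w ∧ w < 1) :
    ∃ b : H2 →L[ℂ] H2, (∀ y, ‖b y‖ = ‖y‖) ∧
      (∀ y z, ‖z‖ < 1 →
        fa (b y) z = (l.map (fun w : ℝ => (z - w) / (1 - w * z))).prod * fa y z) ∧
      LinearMap.rank (1 - b * ContinuousLinearMap.adjoint b : H2 →L[ℂ] H2).toLinearMap
        ≤ (l.length : Cardinal) := by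
  induction l with
  | nil =>
    refine ⟨1, by simp, by simp, ?_⟩
    have : (1 - 1 * ContinuousLinearMap.adjoint 1 : H2 →L[ℂ] H2) = 0 := by
      rw [one_mul, sub_eq_zero, ← ContinuousLinearMap.star_eq_adjoint, star_one]
    rw [this]
    simp
  | cons w l ih =>
    obtain ⟨B, hB1, hB2, hB3⟩ := ih (fun v hv => hl v (List.mem_cons_of_mem _ hv))
    obtain ⟨b, hb1, hb2, hb3⟩ := exists_blaschke_one w (hl w (by simp)).1 (hl w (by simp)).2
    refine ⟨b * B, ?_, ?_, ?_⟩
    · intro y; simp [hb1, hB1]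
    · intro y z hz
      rw [mul_apply_eq_comp, hb2 _ _ hz, hB2 _ _ hz]
      simp [mul_assoc]
    · have e : (1 - b * B * ContinuousLinearMap.adjoint (b * B) : H2 →L[ℂ] H2)
          = (1 - b * ContinuousLinearMap.adjoint b) +
            b * ((1 - B * ContinuousLinearMap.adjoint B) * ContinuousLinearMap.adjoint b) := by
        have : ContinuousLinearMap.adjoint (b * B)
            = ContinuousLinearMap.adjoint B * ContinuousLinearMap.adjoint b :=
          ContinuousLinearMap.adjoint_comp b B
        rw [this]; noncomm_ring
      rw [e]
      refine (LinearMap.rank_add_le _ _).trans ?_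
      have h2 : LinearMap.rank (b * ((1 - B * ContinuousLinearMap.adjoint B) *
          ContinuousLinearMap.adjoint b) : H2 →L[ℂ] H2).toLinearMap ≤ (l.length : Cardinal) := by
        refine (LinearMap.rank_comp_le_right
          ((1 - B * ContinuousLinearMap.adjoint B) * ContinuousLinearMap.adjoint b
            : H2 →L[ℂ] H2).toLinearMap b.toLinearMap).trans ?_
        exact (LinearMap.rank_comp_le_left (ContinuousLinearMap.adjoint b : H2 →L[ℂ] H2).toLinearMap
          (1 - B * ContinuousLinearMap.adjoint B : H2 →L[ℂ] H2).toLinearMap).trans hB3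
      calc _ ≤ (1 : Cardinal) + (l.length : Cardinal) := add_le_add hb3 h2
        _ = _ := by simp [add_comm]

lemma exp_orth (k m : ℕ) :
    ∫ θ in (-Real.pi)..Real.pi,
      (starRingEnd ℂ) (Complex.exp (θ * I) ^ m) * Complex.exp (θ * I) ^ k
      = if k = m then (2 * Real.pi : ℂ) else 0 := by
  have e : ∀ θ : ℝ, (starRingEnd ℂ) (Complex.exp (θ * I) ^ m) * Complex.exp (θ * I) ^ k
      = Complex.exp ((((k : ℂ) - m) * I) * θ) := by
    intro θ
    rw [map_pow, ← Complex.exp_conj, ← Complex.exp_nat_mul, ← Complex.exp_nat_mul, ← Complex.exp_add]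
    congr 1
    simp
    ring
  simp only [e]
  split_ifs with h
  · subst h; simp; ring
  · have hc : ((k : ℂ) - m) * I ≠ 0 := by
      refine mul_ne_zero ?_ I_ne_zero
      rw [sub_ne_zero]; exact_mod_cast h
    rw [integral_exp_mul_complex hc]
    rw [div_eq_zero_iff]; left
    rw [sub_eq_zero]
    have h1 : ((k : ℂ) - m) * I * ((Real.pi : ℝ) : ℂ)
        = ((k : ℂ) - m) * I * ((-Real.pi : ℝ) : ℂ) + ((k : ℤ) - (m : ℤ) : ℤ) * (2 * Real.pi * I) := by
      push_cast; ring
    rw [h1, Complex.exp_add, Complex.exp_int_mul_two_pi_mul_I, mul_one]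

lemma integral_series (c : ℕ → ℂ) (hc : Summable (fun k => ‖c k‖)) (g : ℝ → ℂ)
    (hg : Continuous g) (M : ℝ) (hM : ∀ θ, ‖g θ‖ ≤ M) :
    HasSum (fun k => c k * ∫ θ in (-Real.pi)..Real.pi, g θ * Complex.exp (θ * I) ^ k)
      (∫ θ in (-Real.pi)..Real.pi, g θ * ∑' k, c k * Complex.exp (θ * I) ^ k) := by
  have hb : ∀ (k : ℕ) (t : ℝ), ‖g t * (c k * Complex.exp (t * I) ^ k)‖ ≤ M * ‖c k‖ := by
    intro k t
    rw [norm_mul, norm_mul, norm_pow, Complex.norm_exp_ofReal_mul_I, one_pow, mul_one]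
    exact mul_le_mul_of_nonneg_right (hM t) (norm_nonneg _)
  have h := intervalIntegral.hasSum_integral_of_dominated_convergence
    (μ := volume) (a := -Real.pi) (b := Real.pi)
    (F := fun k (θ : ℝ) => g θ * (c k * Complex.exp (θ * I) ^ k))
    (f := fun θ => g θ * ∑' k, c k * Complex.exp (θ * I) ^ k)
    (fun k _ => M * ‖c k‖)
    (fun n => by
      apply Continuous.aestronglyMeasurable; fun_prop)
    (fun n => by
      filter_upwards with t _
      exact hb n t)
    (by filter_upwards with t _; exact hc.mul_left M)
    (by simp)
    (by
      filter_upwards with t _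
      refine HasSum.mul_left _ (Summable.hasSum ?_)
      refine Summable.of_norm ?_
      simpa using hc)
  have e : (fun k => c k * ∫ θ in (-Real.pi)..Real.pi, g θ * Complex.exp (θ * I) ^ k)
      = fun k => ∫ θ in (-Real.pi)..Real.pi, g θ * (c k * Complex.exp (θ * I) ^ k) := by
    funext k
    rw [← intervalIntegral.integral_const_mul]
    congr 1; funext θ; ring
  rw [e]; exact h

lemma fa_circle (a : H2) (r : ℝ) (θ : ℝ) :
    fa a (r * Complex.exp (θ * I)) = ∑' k, (a k * (r : ℂ) ^ k) * Complex.exp (θ * I) ^ k := by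
  rw [fa]; congr 1; funext k; ring

lemma coeff_summable (a : H2) (r : ℝ) (hr0 : 0 ≤ r) (hr : r < 1) :
    Summable (fun k => ‖a k * (r : ℂ) ^ k‖) :=
  (fa_summable (r : ℂ) (by simpa [abs_of_nonneg hr0] using hr) a).norm

lemma fa_circle_continuous (a : H2) (r : ℝ) (hr0 : 0 ≤ r) (hr : r < 1) :
    Continuous (fun θ : ℝ => fa a (r * Complex.exp (θ * I))) := by
  simp only [fa_circle]
  refine continuous_tsum (fun k => by fun_prop) (coeff_summable a r hr0 hr) ?_
  intro k θ; simp

lemma parseval (a : H2) (r : ℝ) (hr0 : 0 ≤ r) (hr : r < 1) :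
    HasSum (fun k => 2 * Real.pi * (‖a k‖ ^ 2 * (r ^ 2) ^ k))
      (∫ θ in (-Real.pi)..Real.pi, ‖fa a (r * Complex.exp (θ * I))‖ ^ 2) := by
  set f : ℝ → ℂ := fun θ => fa a (r * Complex.exp (θ * I)) with hf
  set c : ℕ → ℂ := fun k => a k * (r : ℂ) ^ k with hc
  have hcs := coeff_summable a r hr0 hr
  have hfc : Continuous f := fa_circle_continuous a r hr0 hr
  have hfe : ∀ θ : ℝ, f θ = ∑' k, c k * Complex.exp (θ * I) ^ k := fun θ => fa_circle a r θ
  have hfb : ∀ θ, ‖f θ‖ ≤ ∑' k, ‖c k‖ := by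
    intro θ
    rw [hfe]
    refine tsum_of_norm_bounded hcs.hasSum (fun k => by
      change ‖c k * _‖ ≤ ‖c k‖
      simp)
  have hA : ∀ m : ℕ, ∫ θ in (-Real.pi)..Real.pi, (starRingEnd ℂ) (Complex.exp (θ * I) ^ m) * f θ
      = 2 * Real.pi * c m := by
    intro m
    have h := integral_series c hcs (fun θ => (starRingEnd ℂ) (Complex.exp (θ * I) ^ m))
      (by fun_prop) 1 (fun θ => by simp)
    simp only [exp_orth] at h
    have h2 := hasSum_ite_eq m (2 * Real.pi * c m)
    simp only [hfe]
    refine h.unique ?_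
    convert h2 using 2 with k
    split_ifs with h3
    · subst h3; ring
    · simp
  have hB : ∀ m : ℕ, ∫ θ in (-Real.pi)..Real.pi, (starRingEnd ℂ) (f θ) * Complex.exp (θ * I) ^ m
      = 2 * Real.pi * (starRingEnd ℂ) (c m) := by
    intro m
    have h1 := congrArg (starRingEnd ℂ) (hA m)
    have h2 : (starRingEnd ℂ) (∫ θ in (-Real.pi)..Real.pi,
        (starRingEnd ℂ) (Complex.exp (θ * I) ^ m) * f θ)
        = ∫ θ in (-Real.pi)..Real.pi, (starRingEnd ℂ) (f θ) * Complex.exp (θ * I) ^ m := by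
      have hpi : -Real.pi ≤ Real.pi := by linarith [Real.pi_pos]
      rw [intervalIntegral.integral_of_le hpi, intervalIntegral.integral_of_le hpi, ← integral_conj]
      congr 1; funext θ
      rw [map_mul, Complex.conj_conj, mul_comm]
    rw [← h2, h1, map_mul, map_mul, Complex.conj_ofReal, Complex.conj_ofNat]
  have h := integral_series c hcs (fun θ => (starRingEnd ℂ) (f θ))
    (by fun_prop) _ (fun θ => by simpa using hfb θ)
  simp only [hB, ← hfe] at h
  have e1 : ∀ θ, (starRingEnd ℂ) (f θ) * f θ = ((‖f θ‖ ^ 2 : ℝ) : ℂ) := by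
    intro θ; rw [Complex.conj_mul']; push_cast; rfl
  have e2 : ∀ k, c k * (2 * Real.pi * (starRingEnd ℂ) (c k))
      = ((2 * Real.pi * (‖a k‖ ^ 2 * (r ^ 2) ^ k) : ℝ) : ℂ) := by
    intro k
    have : c k * (2 * Real.pi * (starRingEnd ℂ) (c k)) = 2 * Real.pi * (c k * (starRingEnd ℂ) (c k)) := by
      ring
    rw [this, Complex.mul_conj']
    simp only [hc, norm_mul, norm_pow, Complex.norm_real, Real.norm_eq_abs, abs_of_nonneg hr0]
    push_cast; ring
  simp only [e1, e2, intervalIntegral.integral_ofReal] at h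
  exact_mod_cast h

lemma circle_le_norm (a : H2) (r : ℝ) (hr0 : 0 ≤ r) (hr : r < 1) :
    (∫ θ in (-Real.pi)..Real.pi, ‖fa a (r * Complex.exp (θ * I))‖ ^ 2) ≤ 2 * Real.pi * ‖a‖ ^ 2 := by
  have h := parseval a r hr0 hr
  have h2 : HasSum (fun k => 2 * Real.pi * ‖a k‖ ^ 2) (2 * Real.pi * ‖a‖ ^ 2) := by
    rw [H2_norm_sq]; exact (H2_summable_sq a).hasSum.mul_left _
  refine hasSum_le (fun k => ?_) h h2
  have : (r ^ 2) ^ k ≤ 1 := pow_le_one₀ (by positivity) (by nlinarith)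
  have h3 : 0 ≤ ‖a k‖ ^ 2 := by positivity
  have := Real.pi_pos
  gcongr
  nlinarith

lemma norm_le_of_circle (a : H2) (M : ℝ)
    (h : ∀ r : ℝ, 0 ≤ r → r < 1 →
      (∫ θ in (-Real.pi)..Real.pi, ‖fa a (r * Complex.exp (θ * I))‖ ^ 2) ≤ 2 * Real.pi * M) :
    ‖a‖ ^ 2 ≤ M := by
  rw [H2_norm_sq]
  have hM : ∀ s : Finset ℕ, ∑ k ∈ s, ‖a k‖ ^ 2 ≤ M := by
    intro s
    have hr : ∀ r : ℝ, 0 ≤ r → r < 1 → ∑ k ∈ s, ‖a k‖ ^ 2 * (r ^ 2) ^ k ≤ M := by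
      intro r hr0 hr1
      have h1 := parseval a r hr0 hr1
      have h2 := sum_le_hasSum s (fun k _ => by have := Real.pi_pos; positivity) h1
      rw [← Finset.mul_sum] at h2
      have := Real.pi_pos
      exact le_of_mul_le_mul_left (h2.trans (h r hr0 hr1)) (by positivity)
    have hcont : Tendsto (fun r : ℝ => ∑ k ∈ s, ‖a k‖ ^ 2 * (r ^ 2) ^ k) (nhdsWithin 1 (Set.Iio 1))
        (nhds (∑ k ∈ s, ‖a k‖ ^ 2)) := by
      have : Continuous (fun r : ℝ => ∑ k ∈ s, ‖a k‖ ^ 2 * (r ^ 2) ^ k) := by fun_prop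
      have h3 := (this.tendsto 1).mono_left (nhdsWithin_le_nhds (s := Set.Iio 1))
      simpa using h3
    refine le_of_tendsto hcont ?_
    have : Set.Ioo (0 : ℝ) 1 ∈ nhdsWithin (1 : ℝ) (Set.Iio 1) := Ioo_mem_nhdsLT one_pos
    filter_upwards [this] with r hr'
    exact hr r hr'.1.le hr'.2
  exact (H2_summable_sq a).tsum_le_of_sum_le hM

lemma approxNum_le (T R : H2 →L[ℂ] H2) (n : ℕ)
    (hR : LinearMap.rank R.toLinearMap ≤ ((n - 1 : ℕ) : Cardinal)) :
    approxNum T n ≤ ‖T - R‖ := by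
  refine csInf_le ⟨0, ?_⟩ ⟨R, ?_, ?_, rfl⟩
  · rintro c ⟨R, _, _, rfl⟩; exact norm_nonneg _
  · exact Module.rank_lt_aleph0_iff.1 (lt_of_le_of_lt hR Cardinal.natCast_lt_aleph0)
  · exact Module.finrank_le_of_rank_le hR

lemma approxNum_le_blaschke (T b : H2 →L[ℂ] H2) (n N : ℕ) (hN : N ≤ n - 1)
    (hb : ∀ y, ‖b y‖ = ‖y‖)
    (hr : LinearMap.rank (1 - b * ContinuousLinearMap.adjoint b : H2 →L[ℂ] H2).toLinearMap
        ≤ (N : Cardinal)) (M : ℝ) (hM0 : 0 ≤ M) (hM : ∀ g, ‖T (b g)‖ ≤ M * ‖g‖) :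
    approxNum T n ≤ M := by
  refine (approxNum_le T (T * (1 - b * ContinuousLinearMap.adjoint b)) n ?_).trans ?_
  · refine (LinearMap.rank_comp_le_right
      (1 - b * ContinuousLinearMap.adjoint b : H2 →L[ℂ] H2).toLinearMap T.toLinearMap).trans ?_
    exact hr.trans (by exact_mod_cast hN)
  · have e : T - T * (1 - b * ContinuousLinearMap.adjoint b)
        = T * b * ContinuousLinearMap.adjoint b := by noncomm_ring
    rw [e]
    have h1 : ‖b‖ ≤ 1 := ContinuousLinearMap.opNorm_le_bound _ zero_le_one
      (fun x => by rw [hb, one_mul])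
    have h2 : ‖ContinuousLinearMap.adjoint b‖ ≤ 1 := by simpa using h1
    have h3 : ‖T * b‖ ≤ M := ContinuousLinearMap.opNorm_le_bound _ hM0 hM
    calc _ ≤ ‖T * b‖ * ‖ContinuousLinearMap.adjoint b‖ := norm_mul_le _ _
      _ ≤ M * 1 := by gcongr
      _ = M := mul_one M

lemma le_approxNum (T : H2 →L[ℂ] H2) (n : ℕ) (hn : 1 ≤ n) (φ : ℂ → ℂ)
    (hT : ∀ (a : H2) (z : ℂ), ‖z‖ < 1 → fa (T a) z = fa a (φ z))
    (z : Fin n → ℂ) (w : Fin n → ℝ) (hz : ∀ i, ‖z i‖ < 1) (t : ℝ) (ht : 0 < t)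
    (hzt : ∀ i, t ≤ 1 - ‖z i‖ ^ 2) (hw0 : ∀ i, 0 ≤ w i) (hw1 : ∀ i, w i < 1)
    (hφ : ∀ i, φ (z i) = w i) (β : ℝ)
    (hβ : ∀ j, β ≤ ∏ i ∈ Finset.univ.erase j, |(w j - w i) / (1 - w i * w j)|) :
    β * Real.sqrt t / n ≤ approxNum T n := by
  have hz0 : LinearMap.range (0 : H2 →L[ℂ] H2).toLinearMap = ⊥ := LinearMap.range_zero
  refine le_csInf ⟨_, 0, ?_, ?_, rfl⟩ ?_
  · rw [hz0]; infer_instance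
  · rw [hz0]; simp
  rintro _ ⟨R, hfin, hrk, rfl⟩
  -- find the combination
  set W := LinearMap.range R.toLinearMap with hW
  have : FiniteDimensional ℂ W := hfin
  let L : (Fin n → ℂ) →ₗ[ℂ] H2 :=
    ∑ i, (LinearMap.proj i : (Fin n → ℂ) →ₗ[ℂ] ℂ).smulRight (kerH (z i) (hz i))
  have hL : ∀ c, L c = ∑ i, c i • kerH (z i) (hz i) := by
    intro c; simp [L]
  let Q : (Fin n → ℂ) →ₗ[ℂ] W := W.orthogonalProjectionOnto.toLinearMap.comp L
  obtain ⟨c, hc, hc0⟩ : ∃ c ∈ LinearMap.ker Q, c ≠ 0 := by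
    have : LinearMap.ker Q ≠ ⊥ := by
      apply LinearMap.ker_ne_bot_of_finrank_lt
      simp only [Module.finrank_fintype_fun_eq_card, Fintype.card_fin]
      omega
    exact (Submodule.ne_bot_iff _).1 this
  have horth : ∀ y, inner ℂ (L c) (R y) = 0 := by
    intro y
    have h1 : W.orthogonalProjectionOnto (L c) = 0 := hc
    rw [Submodule.orthogonalProjectionOnto_eq_zero_iff] at h1
    exact Submodule.inner_left_of_mem_orthogonal (K := W) ⟨y, rfl⟩ h1
  have : Nonempty (Fin n) := ⟨⟨0, hn⟩⟩
  obtain ⟨j, hj⟩ := Finite.exists_max (fun i => ‖c i‖)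
  have hcj : 0 < ‖c j‖ := by
    rcases (norm_nonneg (c j)).lt_or_eq with h | h
    · exact h
    · exfalso; apply hc0; funext i
      have := hj i
      rw [← h] at this
      simpa using this
  -- the dual function
  obtain ⟨b, hb1, hb2, -⟩ := exists_blaschke (((Finset.univ.erase j).toList).map w) (by
    intro v hv
    obtain ⟨i, -, rfl⟩ := List.mem_map.1 hv
    exact ⟨hw0 i, hw1 i⟩)
  have h0 : ‖(0 : ℂ)‖ < 1 := by simp
  set g : H2 := b (kerH 0 h0) with hg
  have hone : ∀ ζ : ℂ, ‖ζ‖ < 1 → fa (kerH 0 h0) ζ = 1 := by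
    intro ζ hζ
    rw [fa, tsum_eq_single 0]
    · simp [kerH_apply]
    · intro k hk; simp [kerH_apply, hk]
  have hgn : ‖g‖ = 1 := by
    rw [hg, hb1]
    have := kerH_norm_sq 0 h0
    simp at this
    rcases this with h | h
    · exact h
    · have := norm_nonneg (kerH 0 h0); linarith
  have hwn : ∀ i, ‖(w i : ℂ)‖ < 1 := fun i => by
    simpa [abs_of_nonneg (hw0 i)] using hw1 i
  have hgz : ∀ ζ : ℂ, ‖ζ‖ < 1 → fa g ζ =
      ∏ i ∈ Finset.univ.erase j, (ζ - w i) / (1 - w i * ζ) := by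
    intro ζ hζ
    rw [hg, hb2 _ _ hζ, hone _ hζ, mul_one, List.map_map, ← Finset.prod_map_toList]
    rfl
  have hgi : ∀ i, i ≠ j → fa g (w i) = 0 := by
    intro i hi
    rw [hgz _ (hwn i)]
    exact Finset.prod_eq_zero (Finset.mem_erase.2 ⟨hi, Finset.mem_univ i⟩) (by simp)
  have hgj : β ≤ ‖fa g (w j)‖ := by
    rw [hgz _ (hwn j), norm_prod]
    refine (hβ j).trans (le_of_eq (Finset.prod_congr rfl (fun i _ => ?_)))
    rw [← Real.norm_eq_abs, ← Complex.norm_real]; push_cast; rfl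
  have hin : inner ℂ (L c) ((T - R) g) = (starRingEnd ℂ) (c j) * fa g (w j) := by
    rw [_root_.sub_apply, inner_sub_right, horth, sub_zero, hL, sum_inner]
    rw [Finset.sum_eq_single j]
    · rw [inner_smul_left, inner_kerH, hT _ _ (hz j), hφ]
    · intro i _ hi
      rw [inner_smul_left, inner_kerH, hT _ _ (hz i), hφ, hgi i hi, mul_zero]
    · simp
  have hLn : ‖L c‖ ≤ n * ‖c j‖ * (Real.sqrt t)⁻¹ := by
    rw [hL]
    have hk : ∀ i, ‖c i • kerH (z i) (hz i)‖ ≤ ‖c j‖ * (Real.sqrt t)⁻¹ := by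
      intro i
      rw [norm_smul]
      have hkn : ‖kerH (z i) (hz i)‖ ≤ (Real.sqrt t)⁻¹ := by
        rw [← Real.sqrt_inv]
        apply Real.le_sqrt_of_sq_le
        rw [kerH_norm_sq]
        exact inv_anti₀ ht (hzt i)
      exact mul_le_mul (hj i) hkn (norm_nonneg _) (norm_nonneg _)
    calc _ ≤ ∑ i : Fin n, ‖c j‖ * (Real.sqrt t)⁻¹ := norm_sum_le_of_le _ (fun i _ => hk i)
      _ = _ := by simp; ring
  have hmain : ‖c j‖ * β ≤ n * ‖c j‖ * (Real.sqrt t)⁻¹ * ‖T - R‖ := by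
    calc ‖c j‖ * β ≤ ‖inner ℂ (L c) ((T - R) g)‖ := by
          rw [hin, norm_mul]; simp only [RCLike.norm_conj]
          exact mul_le_mul_of_nonneg_left hgj (norm_nonneg _)
      _ ≤ ‖L c‖ * ‖(T - R) g‖ := norm_inner_le_norm _ _
      _ ≤ (n * ‖c j‖ * (Real.sqrt t)⁻¹) * (‖T - R‖ * ‖g‖) := by
          gcongr
          exact ContinuousLinearMap.le_opNorm _ _
      _ = _ := by rw [hgn, mul_one]
  have hst : 0 < Real.sqrt t := Real.sqrt_pos.2 ht
  have hn0 : (0 : ℝ) < n := by exact_mod_cast hn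
  rw [div_le_iff₀ hn0]
  have h2 : β ≤ n * (Real.sqrt t)⁻¹ * ‖T - R‖ := by
    refine le_of_mul_le_mul_left ?_ hcj
    calc _ ≤ _ := hmain
      _ = _ := by ring
  calc β * Real.sqrt t ≤ n * (Real.sqrt t)⁻¹ * ‖T - R‖ * Real.sqrt t := by gcongr
    _ = _ := by field_simp

def conjU (U : ℝ → ℝ) (r θ : ℝ) : ℝ :=
  (1 / (2 * Real.pi)) * ∫ x in (-Real.pi)..Real.pi,
    U x * (2 * r * Real.sin (θ - x) / (1 - 2 * r * Real.cos (θ - x) + r ^ 2))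

lemma denom_pos (r θ : ℝ) (hr0 : 0 ≤ r) (hr : r < 1) : 0 < 1 - 2 * r * Real.cos θ + r ^ 2 := by
  nlinarith [Real.cos_le_one θ, Real.neg_one_le_cos θ, mul_nonneg hr0 (sub_nonneg.2 (Real.cos_le_one θ)), sq_pos_of_pos (sub_pos.2 hr)]

lemma kernel_eq (r θ x : ℝ) (hr0 : 0 ≤ r) (hr : r < 1) :
    2 * (Complex.exp (x * I) / (Complex.exp (x * I) - r * Complex.exp (θ * I))) - 1
      = (((1 - r ^ 2) / (1 - 2 * r * Real.cos (θ - x) + r ^ 2) : ℝ) : ℂ)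
        + ((2 * r * Real.sin (θ - x) / (1 - 2 * r * Real.cos (θ - x) + r ^ 2) : ℝ) : ℂ) * I := by
  have hD := denom_pos r (θ - x) hr0 hr
  set D := 1 - 2 * r * Real.cos (θ - x) + r ^ 2 with hDd
  have hDc : (D : ℂ) ≠ 0 := by exact_mod_cast hD.ne'
  have e1 : Complex.exp (θ * I) = Complex.exp (x * I) * Complex.exp ((θ - x : ℝ) * I) := by
    rw [← Complex.exp_add]; congr 1; push_cast; ring
  have hz : Complex.exp ((θ - x : ℝ) * I) = (Real.cos (θ - x) : ℂ) + Real.sin (θ - x) * I := by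
    rw [Complex.exp_mul_I]; push_cast; rfl
  set C := Real.cos (θ - x)
  set S := Real.sin (θ - x)
  have hCS : C ^ 2 + S ^ 2 = 1 := by rw [add_comm]; exact Real.sin_sq_add_cos_sq _
  have hCSc : (C : ℂ) ^ 2 + (S : ℂ) ^ 2 = 1 := by exact_mod_cast hCS
  have hx : Complex.exp (x * I) ≠ 0 := Complex.exp_ne_zero _
  have hDe : (D : ℂ) = (1 - r * (C + S * I)) * (1 - r * (C - S * I)) := by
    rw [hDd]; push_cast
    linear_combination (-(r : ℂ) ^ 2) * hCSc + (r : ℂ) ^ 2 * (S : ℂ) ^ 2 * I_sq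
  have h1 : (1 : ℂ) - r * (C + S * I) ≠ 0 := by
    intro h; rw [h, zero_mul] at hDe; exact hDc hDe
  have e2 : Complex.exp (x * I) / (Complex.exp (x * I) - r * Complex.exp (θ * I))
      = 1 / (1 - r * (C + S * I)) := by
    rw [e1, hz, show Complex.exp (x * I) - r * (Complex.exp (x * I) * (C + S * I))
      = Complex.exp (x * I) * (1 - r * (C + S * I)) by ring]
    field_simp
  have e3 : (1 : ℂ) / (1 - r * (C + S * I)) = (1 - r * (C - S * I)) / D := by
    rw [div_eq_div_iff h1 hDc, hDe]; ring
  rw [e2, e3]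
  push_cast
  rw [show 2 * ((1 - (r : ℂ) * (C - S * I)) / D) - 1 = (2 * (1 - (r : ℂ) * (C - S * I)) - D) / D by
    field_simp]
  rw [div_mul_eq_mul_div, ← add_div]
  congr 1
  rw [hDd]; push_cast; ring

def herG (U : ℝ → ℝ) (w : ℂ) : ℂ :=
  2 * ((2 * Real.pi * I : ℂ)⁻¹ • ∮ z in C(0, 1), (z - w)⁻¹ • ((U z.arg : ℝ) : ℂ))
    - (1 / (2 * Real.pi)) * ∫ x in (-Real.pi)..Real.pi, ((U x : ℝ) : ℂ)

lemma U_arg (U : ℝ → ℝ) (hp : Function.Periodic U (2 * Real.pi)) (θ : ℝ) :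
    U (circleMap 0 1 θ).arg = U θ := by
  have : circleMap 0 1 θ = Complex.exp (θ * I) := by simp [circleMap]
  rw [this, Complex.arg_exp_mul_I, toIocMod]
  exact hp.sub_zsmul_eq _

lemma herG_diff (U : ℝ → ℝ) (hc : Continuous U) (hp : Function.Periodic U (2 * Real.pi)) :
    DifferentiableOn ℂ (herG U) (Metric.ball 0 1) := by
  have hci : CircleIntegrable (fun z : ℂ => ((U z.arg : ℝ) : ℂ)) 0 ((1 : NNReal) : ℝ) := by
    unfold CircleIntegrable
    simp only [NNReal.coe_one, U_arg U hp]
    apply Continuous.intervalIntegrable; fun_prop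
  have h := (hasFPowerSeriesOn_cauchy_integral hci one_pos).differentiableOn
  unfold herG
  refine (DifferentiableOn.const_mul ?_ _).sub_const _
  have hball : Metric.eball (0 : ℂ) ((1 : NNReal) : ENNReal) = Metric.ball 0 1 := by
    rw [Metric.eball_coe]; simp
  rw [hball] at h
  simpa using h

lemma herG_eq (U : ℝ → ℝ) (hc : Continuous U) (hp : Function.Periodic U (2 * Real.pi))
    (r θ : ℝ) (hr0 : 0 ≤ r) (hr : r < 1) :
    herG U (r * Complex.exp (θ * I)) = (poisson U r θ : ℂ) + (conjU U r θ : ℂ) * I := by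
  have hne : ∀ x : ℝ, Complex.exp (x * I) - r * Complex.exp (θ * I) ≠ 0 := by
    intro x h
    have := congrArg norm (sub_eq_zero.1 h)
    simp [abs_of_nonneg hr0] at this
    linarith
  have h1 : (2 * Real.pi * I : ℂ)⁻¹ • ∮ z in C(0, 1), (z - r * Complex.exp (θ * I))⁻¹ • ((U z.arg : ℝ) : ℂ)
      = (1 / (2 * Real.pi)) * ∫ x in (-Real.pi)..Real.pi,
        (Complex.exp (x * I) / (Complex.exp (x * I) - r * Complex.exp (θ * I))) * U x := by
    rw [circleIntegral]
    have e : ∀ x : ℝ, deriv (circleMap 0 1) x • (circleMap 0 1 x - r * Complex.exp (θ * I))⁻¹ •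
        ((U (circleMap 0 1 x).arg : ℝ) : ℂ)
        = I * ((Complex.exp (x * I) / (Complex.exp (x * I) - r * Complex.exp (θ * I))) * U x) := by
      intro x
      rw [U_arg U hp]
      simp [circleMap, div_eq_mul_inv]; ring
    simp only [e]
    rw [intervalIntegral.integral_const_mul]
    have hper : Function.Periodic (fun x : ℝ => (Complex.exp (x * I) /
        (Complex.exp (x * I) - r * Complex.exp (θ * I))) * (U x : ℂ)) (2 * Real.pi) := by
      intro x
      simp only [hp x]
      have : Complex.exp (((x + 2 * Real.pi : ℝ) : ℂ) * I) = Complex.exp (x * I) := by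
        push_cast; rw [add_mul, Complex.exp_add, Complex.exp_two_pi_mul_I, mul_one]
      rw [this]
    have h2 := hper.intervalIntegral_add_eq 0 (-Real.pi)
    rw [zero_add, show -Real.pi + 2 * Real.pi = Real.pi by ring] at h2
    rw [h2, smul_eq_mul, mul_inv, ← mul_assoc]
    congr 1
    rw [mul_assoc, inv_mul_cancel₀ I_ne_zero]; simp
  have hint1 : IntervalIntegrable (fun x : ℝ => (Complex.exp (x * I) /
        (Complex.exp (x * I) - r * Complex.exp (θ * I))) * (U x : ℂ)) volume (-Real.pi) Real.pi := by
    apply Continuous.intervalIntegrable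
    refine Continuous.mul (Continuous.div (by fun_prop) (by fun_prop) hne) (by fun_prop)
  have hint2 : IntervalIntegrable (fun x : ℝ => (U x : ℂ)) volume (-Real.pi) Real.pi := by
    apply Continuous.intervalIntegrable; fun_prop
  have hD : ∀ x, 1 - 2 * r * Real.cos (θ - x) + r ^ 2 ≠ 0 := fun x => (denom_pos r _ hr0 hr).ne'
  rw [herG, h1]
  have h3 : 2 * ((1 / (2 * Real.pi)) * ∫ x in (-Real.pi)..Real.pi,
        (Complex.exp (x * I) / (Complex.exp (x * I) - r * Complex.exp (θ * I))) * U x)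
      - (1 / (2 * Real.pi)) * ∫ x in (-Real.pi)..Real.pi, ((U x : ℝ) : ℂ)
      = (1 / (2 * Real.pi)) * ∫ x in (-Real.pi)..Real.pi,
        (2 * (Complex.exp (x * I) / (Complex.exp (x * I) - r * Complex.exp (θ * I))) - 1) * U x := by
    have : ∀ x : ℝ, (2 * (Complex.exp (x * I) / (Complex.exp (x * I) - r * Complex.exp (θ * I))) - 1) * (U x : ℂ)
        = 2 * ((Complex.exp (x * I) / (Complex.exp (x * I) - r * Complex.exp (θ * I))) * U x) - U x := by
      intro x; ring
    simp only [this]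
    rw [intervalIntegral.integral_sub (hint1.const_mul 2) hint2, intervalIntegral.integral_const_mul]
    ring
  rw [h3]
  have h4 : ∀ x : ℝ, (2 * (Complex.exp (x * I) / (Complex.exp (x * I) - r * Complex.exp (θ * I))) - 1) * (U x : ℂ)
      = (((1 - r ^ 2) * (U x / (1 - 2 * r * Real.cos (θ - x) + r ^ 2)) : ℝ) : ℂ)
       + ((U x * (2 * r * Real.sin (θ - x) / (1 - 2 * r * Real.cos (θ - x) + r ^ 2)) : ℝ) : ℂ) * I := by
    intro x
    rw [kernel_eq r θ x hr0 hr]; push_cast; ring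
  simp only [h4]
  have i1 : IntervalIntegrable (fun x : ℝ => (((1 - r ^ 2) * (U x / (1 - 2 * r * Real.cos (θ - x) + r ^ 2)) : ℝ) : ℂ)) volume (-Real.pi) Real.pi := by
    apply Continuous.intervalIntegrable
    refine Complex.continuous_ofReal.comp (continuous_const.mul (Continuous.div hc (by fun_prop) hD))
  have i2 : IntervalIntegrable (fun x : ℝ => ((U x * (2 * r * Real.sin (θ - x) / (1 - 2 * r * Real.cos (θ - x) + r ^ 2)) : ℝ) : ℂ) * I) volume (-Real.pi) Real.pi := by
    apply Continuous.intervalIntegrable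
    refine (Complex.continuous_ofReal.comp (hc.mul (Continuous.div (by fun_prop) (by fun_prop) hD))).mul continuous_const
  rw [intervalIntegral.integral_add i1 i2, intervalIntegral.integral_mul_const,
    intervalIntegral.integral_ofReal, intervalIntegral.integral_ofReal, poisson, conjU,
    intervalIntegral.integral_const_mul]
  push_cast
  ring

lemma F_im (U : ℝ → ℝ) (hc : Continuous U) (hp : Function.Periodic U (2 * Real.pi))
    (F : ℂ → ℂ) (hF : DifferentiableOn ℂ F (Metric.ball 0 1))
    (hFre : ∀ r θ : ℝ, 0 ≤ r → r < 1 →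
      (F ((r : ℂ) * Complex.exp (θ * Complex.I))).re = poisson U r θ)
    (hFim : (F 0).im = 0) (r θ : ℝ) (hr0 : 0 ≤ r) (hr : r < 1) :
    (F ((r : ℂ) * Complex.exp (θ * Complex.I))).im = conjU U r θ := by
  have hA : AnalyticOnNhd ℂ (fun z => F z - herG U z) (Metric.ball 0 1) :=
    (hF.sub (herG_diff U hc hp)).analyticOnNhd Metric.isOpen_ball
  have hre : ∀ z ∈ Metric.ball (0 : ℂ) 1, (F z - herG U z).re = 0 := by
    intro z hz
    have hz1 : ‖z‖ < 1 := by simpa using hz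
    have e : z = ((‖z‖ : ℝ) : ℂ) * Complex.exp (z.arg * I) := (Complex.norm_mul_exp_arg_mul_I z).symm
    rw [e, Complex.sub_re, hFre _ _ (norm_nonneg z) hz1, herG_eq U hc hp _ _ (norm_nonneg z) hz1]
    simp
  obtain ⟨c, hcc⟩ := hA.eq_const_of_re_eq_const hre Metric.isOpen_ball
    ⟨⟨0, by simp⟩, (convex_ball (0 : ℂ) 1).isPreconnected⟩
  have hz0 : (F 0 - herG U 0).im = 0 := by
    have := herG_eq U hc hp 0 0 le_rfl one_pos
    simp at this
    rw [Complex.sub_im, hFim, this]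
    simp [conjU]
  have hmem : (r : ℂ) * Complex.exp (θ * I) ∈ Metric.ball (0 : ℂ) 1 := by
    simp [abs_of_nonneg hr0, hr]
  have h1 := hcc _ hmem
  have h2 := hcc 0 (by simp)
  have h3 : (F ((r : ℂ) * Complex.exp (θ * I)) - herG U ((r : ℂ) * Complex.exp (θ * I))).im = 0 := by
    rw [← hz0]; exact congrArg Complex.im (h1.trans h2.symm)
  rw [Complex.sub_im, herG_eq U hc hp _ _ hr0 hr] at h3
  simp at h3
  linarith

structure GoodU (α : ℝ) (U : ℝ → ℝ) : Prop where
  a0 : 0 < α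
  a1 : α < 1
  cont : Continuous U
  even : ∀ t, U (-t) = U t
  per : Function.Periodic U (2 * Real.pi)
  zero : U 0 = 0
  mono : MonotoneOn U (Set.Icc 0 Real.pi)
  pos : ∀ t, 0 < t → t ≤ Real.pi → 0 < U t
  pow : ∀ a b, 0 < a → a ≤ b → b ≤ Real.pi / 2 → U b ≤ U a * (b / a) ^ α

lemma goodU_of (α : ℝ) (hα₀ : 0 < α) (hα₁ : α < 1)
    (U U' : ℝ → ℝ) (hU_mem : ClassU U)
    (hderiv : ∀ t ∈ Set.Ioc (0 : ℝ) (Real.pi / 2), HasDerivAt U (U' t) t)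
    (hbound : ∀ t ∈ Set.Ioc (0 : ℝ) (Real.pi / 2), t * U' t ≤ α * U t) : GoodU α U := by
  obtain ⟨h1, h2, h3, h4, h5, h6, -⟩ := hU_mem
  refine ⟨hα₀, hα₁, h1, h2, h3, h4, h5, h6, ?_⟩
  intro a b ha hab hb
  have hd : ∀ t ∈ Set.Ioc (0 : ℝ) (Real.pi / 2), HasDerivAt (fun t => U t * t ^ (-α))
      (U' t * t ^ (-α) + U t * (-α * t ^ (-α - 1))) t := by
    intro t ht
    exact (hderiv t ht).mul (Real.hasDerivAt_rpow_const (Or.inl ht.1.ne'))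
  have hanti : AntitoneOn (fun t => U t * t ^ (-α)) (Set.Ioc 0 (Real.pi / 2)) := by
    refine antitoneOn_of_deriv_nonpos (convex_Ioc _ _) ?_ ?_ ?_
    · intro t ht; exact (hd t ht).continuousAt.continuousWithinAt
    · intro t ht
      have ht' := interior_subset ht
      exact (hd t ht').differentiableAt.differentiableWithinAt
    · intro t ht
      have ht' := interior_subset ht
      rw [(hd t ht').deriv]
      have h0 : 0 < t := ht'.1
      have e : t ^ (-α) = t * t ^ (-α - 1) := by
        conv_rhs => rw [← Real.rpow_one_add' h0.le (by linarith)]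
        congr 1; ring
      rw [e]
      have hp : 0 < t ^ (-α - 1) := Real.rpow_pos_of_pos h0 _
      have := hbound t ht'
      nlinarith
  have hb0 : 0 < b := ha.trans_le hab
  have h := hanti ⟨ha, hab.trans hb⟩ ⟨hb0, hb⟩ hab
  simp only at h
  rw [Real.rpow_neg ha.le, Real.rpow_neg hb0.le] at h
  rw [Real.div_rpow hb0.le ha.le]
  have hpa := Real.rpow_pos_of_pos ha α
  have hpb := Real.rpow_pos_of_pos hb0 α
  calc U b = (U b * (b ^ α)⁻¹) * b ^ α := by field_simp
    _ ≤ (U a * (a ^ α)⁻¹) * b ^ α := by gcongr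
    _ = _ := by ring

namespace GoodU
variable {α : ℝ} {U : ℝ → ℝ}

lemma nn (h : GoodU α U) (t : ℝ) (h0 : 0 ≤ t) (h1 : t ≤ Real.pi) : 0 ≤ U t := by
  rcases h0.eq_or_lt with e | e
  · rw [← e, h.zero]
  · exact (h.pos t e h1).le

lemma mono' (h : GoodU α U) {a b : ℝ} (ha : 0 ≤ a) (hab : a ≤ b) (hb : b ≤ Real.pi) : U a ≤ U b :=
  h.mono ⟨ha, hab.trans hb⟩ ⟨ha.trans hab, hb⟩ hab

lemma abs_eq (h : GoodU α U) (t : ℝ) : U |t| = U t := by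
  rcases abs_choice t with e | e <;> rw [e]
  exact h.even t

lemma repr (h : GoodU α U) (x : ℝ) : ∃ y, 0 ≤ y ∧ y ≤ Real.pi ∧ U x = U y := by
  have hp : (0 : ℝ) < 2 * Real.pi := by have := Real.pi_pos; positivity
  have h1 := toIocMod_mem_Ioc hp (-Real.pi) x
  refine ⟨|toIocMod hp (-Real.pi) x|, abs_nonneg _, ?_, ?_⟩
  · rw [abs_le]; constructor <;> linarith [h1.1, h1.2]
  · rw [h.abs_eq, toIocMod]
    exact (h.per.sub_zsmul_eq _).symm

lemma nonneg (h : GoodU α U) (x : ℝ) : 0 ≤ U x := by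
  obtain ⟨y, h0, h1, e⟩ := h.repr x
  rw [e]; exact h.nn y h0 h1

lemma le_pi (h : GoodU α U) (x : ℝ) : U x ≤ U Real.pi := by
  obtain ⟨y, h0, h1, e⟩ := h.repr x
  rw [e]; exact h.mono' h0 h1 le_rfl

lemma lin (h : GoodU α U) {a b : ℝ} (ha : 0 ≤ a) (hab : a ≤ b) (hb0 : 0 < b)
    (hb : b ≤ Real.pi / 2) : U b * a ≤ U a * b := by
  rcases ha.eq_or_lt with e | e
  · rw [← e, h.zero]; simp
  · have h1 := h.pow a b e hab hb
    have h2 : (b / a) ^ α ≤ b / a := by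
      have h3 : 1 ≤ b / a := (one_le_div e).2 hab
      calc (b / a) ^ α ≤ (b / a) ^ (1 : ℝ) := Real.rpow_le_rpow_of_exponent_le h3 h.a1.le
        _ = _ := Real.rpow_one _
    have h4 : U b ≤ U a * (b / a) := h1.trans (mul_le_mul_of_nonneg_left h2 (h.nonneg a))
    calc U b * a ≤ U a * (b / a) * a := by gcongr
      _ = _ := by field_simp

lemma lower (h : GoodU α U) : ∃ c > 0, ∀ t, 0 < t → t ≤ Real.pi / 2 → c * t ^ α ≤ U t := by
  have hpi := Real.pi_pos
  refine ⟨U (Real.pi / 2) / (Real.pi / 2) ^ α, div_pos (h.pos _ (by positivity) (by linarith))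
    (by positivity), ?_⟩
  intro t ht0 ht
  have := h.pow t (Real.pi / 2) ht0 ht le_rfl
  rw [Real.div_rpow (by positivity) ht0.le] at this
  have hp := Real.rpow_pos_of_pos ht0 α
  have hp2 : 0 < (Real.pi / 2) ^ α := by positivity
  rw [div_mul_eq_mul_div, div_le_iff₀ hp2]
  calc _ ≤ U t * ((Real.pi / 2) ^ α / t ^ α) * t ^ α := by gcongr
    _ = _ := by field_simp

lemma poisson_even (h : GoodU α U) (r θ : ℝ) : poisson U r (-θ) = poisson U r θ := by
  unfold poisson
  congr 1
  have := intervalIntegral.integral_comp_neg (a := -Real.pi) (b := Real.pi)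
    (fun x => U x / (1 - 2 * r * Real.cos (-θ - x) + r ^ 2))
  rw [neg_neg] at this
  rw [← this]
  congr 1; funext x
  rw [h.even, show -θ - -x = -(θ - x) by ring, Real.cos_neg]

lemma poisson_lower_aux (h : GoodU α U) (r θ a b m : ℝ) (hr0 : 0 ≤ r) (hr : r < 1)
    (ha : 0 ≤ a) (hb : b ≤ Real.pi) (hab : b - a = (1 - r) / 2) (h1 : a ≤ θ) (h2 : θ ≤ b)
    (hm0 : 0 ≤ m) (hm : ∀ x, a ≤ x → x ≤ b → m ≤ U x) : m / 16 ≤ poisson U r θ := by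
  have hpi := Real.pi_pos
  have hpi2 : Real.pi < 3.2 := by linarith [Real.pi_lt_d2]
  have hs : 0 < 1 - r := by linarith
  have hD : ∀ x, 0 < 1 - 2 * r * Real.cos (θ - x) + r ^ 2 := fun x => denom_pos r _ hr0 hr
  have hcont : Continuous (fun x => U x / (1 - 2 * r * Real.cos (θ - x) + r ^ 2)) :=
    Continuous.div h.cont (by fun_prop) (fun x => (hD x).ne')
  have i1 : ∫ x in a..b, U x / (1 - 2 * r * Real.cos (θ - x) + r ^ 2)
      ≤ ∫ x in (-Real.pi)..Real.pi, U x / (1 - 2 * r * Real.cos (θ - x) + r ^ 2) := by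
    refine intervalIntegral.integral_mono_interval (by linarith) (by linarith) hb ?_
      (hcont.intervalIntegrable _ _)
    filter_upwards with x
    exact div_nonneg (h.nonneg x) (hD x).le
  have i2 : ∫ x in a..b, m / (5 / 4 * (1 - r) ^ 2)
      ≤ ∫ x in a..b, U x / (1 - 2 * r * Real.cos (θ - x) + r ^ 2) := by
    refine intervalIntegral.integral_mono_on (by linarith) (by simp) (hcont.intervalIntegrable _ _) ?_
    intro x hx
    have hU := hm x hx.1 hx.2
    refine div_le_div₀ (h.nonneg x) hU (hD x) ?_
    have hc := Real.one_sub_sq_div_two_le_cos (x := θ - x)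
    have hxx : (θ - x) ^ 2 ≤ ((1 - r) / 2) ^ 2 := by
      apply sq_le_sq'
      · linarith [hx.1, hx.2]
      · linarith [hx.1, hx.2]
    nlinarith
  rw [intervalIntegral.integral_const, hab, smul_eq_mul] at i2
  unfold poisson
  have e : (1 - r) / 2 * (m / (5 / 4 * (1 - r) ^ 2)) = (2 / 5) * m / (1 - r) := by
    field_simp; ring
  rw [e] at i2
  have h3 : (1 - r) / 6.4 ≤ (1 - r ^ 2) / (2 * Real.pi) := by
    apply div_le_div₀ <;> nlinarith
  calc m / 16 = (1 - r) / 6.4 * ((2 / 5) * m / (1 - r)) := by field_simp; ring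
    _ ≤ _ := by
      apply mul_le_mul h3 (i2.trans i1) (by positivity)
      apply div_nonneg <;> nlinarith

lemma poisson_lower (h : GoodU α U) (r θ : ℝ) (hr0 : 0 ≤ r) (hr : r < 1) (hθ : |θ| ≤ Real.pi) :
    U (min |θ| (Real.pi / 2)) / 16 ≤ poisson U r θ := by
  have hpi := Real.pi_pos
  have hpi2 := Real.pi_gt_three
  have e : poisson U r θ = poisson U r |θ| := by
    rcases abs_choice θ with e | e <;> rw [e]
    exact (h.poisson_even r θ).symm
  rw [e]
  have h0 := abs_nonneg θ
  set x := |θ|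
  have hm0 : 0 ≤ min x (Real.pi / 2) := le_min h0 (by positivity)
  by_cases hx : x ≤ Real.pi - 1 / 2
  · refine h.poisson_lower_aux r x x (x + (1 - r) / 2) _ hr0 hr h0 (by linarith) (by ring) le_rfl
      (by linarith) (h.nonneg _) ?_
    intro y hy1 hy2
    exact h.mono' hm0 ((min_le_left _ _).trans hy1) (by linarith)
  · push Not at hx
    refine h.poisson_lower_aux r x (x - (1 - r) / 2) x _ hr0 hr (by linarith) (by linarith) (by ring)
      (by linarith) le_rfl (h.nonneg _) ?_
    intro y hy1 hy2
    exact h.mono' hm0 ((min_le_right _ _).trans (by linarith)) (by linarith)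

lemma even_integral (f : ℝ → ℝ) (hf : Continuous f) (he : ∀ x, f (-x) = f x) (a : ℝ) :
    ∫ x in (-a)..a, f x = 2 * ∫ x in (0 : ℝ)..a, f x := by
  rw [← intervalIntegral.integral_add_adjacent_intervals (hf.intervalIntegrable (-a) 0)
    (hf.intervalIntegrable 0 a)]
  have := intervalIntegral.integral_comp_neg (a := 0) (b := a) f
  simp only [he, neg_zero] at this
  rw [← this]; ring

lemma rpow_int (h : GoodU α U) (s b : ℝ) (hs : 0 < s) (hb : s ≤ b) :
    ∫ x in s..b, x ^ (α - 2) ≤ s ^ (α - 1) / (1 - α) := by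
  have h1 := h.a1
  have h0 := h.a0
  rw [integral_rpow (Or.inr ⟨by linarith, fun hh => by
    rw [uIcc_of_le hb] at hh; linarith [hh.1]⟩)]
  rw [show α - 2 + 1 = -(1 - α) by ring, div_neg, ← neg_div, show α - 1 = -(1 - α) by ring]
  apply div_le_div_of_nonneg_right _ (by linarith)
  have := Real.rpow_pos_of_pos (hs.trans_le hb) (-(1 - α))
  linarith

lemma poisson_upper (h : GoodU α U) : ∃ C > 0, ∀ s, 0 < s → s ≤ 1 / 2 →
    poisson U (1 - s) 0 ≤ C * U s := by
  have hpi := Real.pi_pos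
  have hpi3 := Real.pi_gt_three
  have h1 := h.a1
  have hUp := h.pos (Real.pi / 2) (by positivity) (by linarith)
  have hUp' := h.pos Real.pi (by positivity) le_rfl
  set C1 := U Real.pi / U (Real.pi / 2) with hC1
  have hC1' : 1 ≤ C1 := (one_le_div hUp).2 (h.mono' (by positivity) (by linarith) le_rfl)
  refine ⟨10 * (1 + C1 / (1 - α)), by have : 0 < 1 - α := by linarith
                                      positivity, ?_⟩
  intro s hs hs2
  have hUs := h.pos s hs (by linarith)
  have hpow : ∀ x, s ≤ x → x ≤ Real.pi → U x ≤ C1 * U s * (x / s) ^ α := by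
    intro x hx1 hx2
    have hr : 0 ≤ (x / s) ^ α := by have : 0 < x := hs.trans_le hx1
                                    positivity
    by_cases hx : x ≤ Real.pi / 2
    · have := h.pow s x hs hx1 hx
      nlinarith [mul_nonneg hUs.le hr]
    · push Not at hx
      have h2 := h.pow s (Real.pi / 2) hs (by linarith) le_rfl
      have h3 : (Real.pi / 2 / s) ^ α ≤ (x / s) ^ α := by
        apply Real.rpow_le_rpow (by positivity) _ h.a0.le
        gcongr
      calc U x ≤ U Real.pi := h.le_pi x
        _ = C1 * U (Real.pi / 2) := by rw [hC1]; field_simp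
        _ ≤ C1 * (U s * (x / s) ^ α) := by
          gcongr
          exact h2.trans (by gcongr)
        _ = _ := by ring
  have hr0 : 0 ≤ 1 - s := by linarith
  have hr1 : 1 - s < 1 := by linarith
  have hDpos : ∀ x, 0 < 1 - 2 * (1 - s) * Real.cos (0 - x) + (1 - s) ^ 2 :=
    fun x => denom_pos _ _ hr0 hr1
  have hD : ∀ x, 0 ≤ x → x ≤ Real.pi →
      (s ^ 2 + x ^ 2) / 5 ≤ 1 - 2 * (1 - s) * Real.cos (0 - x) + (1 - s) ^ 2 := by
    intro x hx0 hx1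
    rw [zero_sub, Real.cos_neg]
    have hc := Real.cos_le_one_sub_mul_cos_sq (x := x) (by rw [abs_of_nonneg hx0]; exact hx1)
    have hk : (2 / Real.pi ^ 2) ≥ 1 / 5 := by
      rw [ge_iff_le, div_le_div_iff₀ (by norm_num) (by positivity)]
      nlinarith [Real.pi_lt_d2]
    nlinarith [sq_nonneg x, sq_nonneg s, mul_le_mul_of_nonneg_right hk (sq_nonneg x)]
  have hcont : Continuous (fun x => U x / (1 - 2 * (1 - s) * Real.cos (0 - x) + (1 - s) ^ 2)) :=
    Continuous.div h.cont (by fun_prop) (fun x => (hDpos x).ne')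
  have heven := even_integral _ hcont (fun x => by rw [h.even]; simp) Real.pi
  unfold poisson
  rw [heven, ← intervalIntegral.integral_add_adjacent_intervals (hcont.intervalIntegrable 0 s)
    (hcont.intervalIntegrable s Real.pi)]
  have i1 : ∫ x in (0 : ℝ)..s, U x / (1 - 2 * (1 - s) * Real.cos (0 - x) + (1 - s) ^ 2)
      ≤ ∫ x in (0 : ℝ)..s, 5 * U s / s ^ 2 := by
    refine intervalIntegral.integral_mono_on hs.le (hcont.intervalIntegrable _ _) (by simp) ?_
    intro x hx
    have := hD x hx.1 (by linarith [hx.2])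
    rw [div_le_div_iff₀ (hDpos x) (by positivity)]
    have h2 : U x ≤ U s := h.mono' hx.1 hx.2 (by linarith)
    have h3 : s ^ 2 ≤ 5 * (1 - 2 * (1 - s) * Real.cos (0 - x) + (1 - s) ^ 2) := by
      nlinarith [sq_nonneg x]
    calc U x * s ^ 2 ≤ U s * (5 * (1 - 2 * (1 - s) * Real.cos (0 - x) + (1 - s) ^ 2)) := by
          apply mul_le_mul h2 h3 (by positivity) hUs.le
      _ = _ := by ring
  have i2 : ∫ x in s..Real.pi, U x / (1 - 2 * (1 - s) * Real.cos (0 - x) + (1 - s) ^ 2)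
      ≤ ∫ x in s..Real.pi, (5 * C1 * U s / s ^ α) * x ^ (α - 2) := by
    refine intervalIntegral.integral_mono_on (by linarith) (hcont.intervalIntegrable _ _) ?_ ?_
    · apply IntervalIntegrable.const_mul
      apply intervalIntegral.intervalIntegrable_rpow
      right; intro hh; rw [uIcc_of_le (by linarith)] at hh; linarith [hh.1]
    intro x hx
    have hx0 : 0 < x := hs.trans_le hx.1
    have h2 := hD x hx0.le hx.2
    have h3 := hpow x hx.1 hx.2
    rw [Real.div_rpow hx0.le hs.le] at h3
    have h4 : x ^ 2 / 5 ≤ 1 - 2 * (1 - s) * Real.cos (0 - x) + (1 - s) ^ 2 := by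
      nlinarith [sq_nonneg s]
    have e : x ^ (α - 2) = x ^ α / x ^ 2 := by
      rw [Real.rpow_sub hx0]; norm_cast
    rw [e]
    calc _ ≤ (C1 * U s * (x ^ α / s ^ α)) / (x ^ 2 / 5) :=
          div_le_div₀ (by positivity) h3 (by positivity) h4
      _ = _ := by field_simp
  rw [intervalIntegral.integral_const_mul] at i2
  have i3 := h.rpow_int s Real.pi hs (by linarith)
  have i4 : (5 * C1 * U s / s ^ α) * ∫ x in s..Real.pi, x ^ (α - 2)
      ≤ 5 * C1 * U s / (1 - α) / s := by
    calc _ ≤ (5 * C1 * U s / s ^ α) * (s ^ (α - 1) / (1 - α)) := by gcongr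
      _ = _ := by
        rw [Real.rpow_sub hs, Real.rpow_one]
        have : 0 < s ^ α := by positivity
        field_simp
  rw [intervalIntegral.integral_const, sub_zero, smul_eq_mul] at i1
  have e1 : s * (5 * U s / s ^ 2) = 5 * U s / s := by field_simp
  rw [e1] at i1
  have hA : (1 - (1 - s) ^ 2) / (2 * Real.pi) ≤ s := by
    rw [div_le_iff₀ (by positivity)]; nlinarith
  have hA0 : 0 ≤ (1 - (1 - s) ^ 2) / (2 * Real.pi) := by
    apply div_nonneg _ (by positivity); nlinarith
  calc _ ≤ s * (2 * (5 * U s / s + 5 * C1 * U s / (1 - α) / s)) := by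
        have : 0 < 1 - α := by linarith
        apply mul_le_mul hA _ _ hs.le
        · linarith
        · apply mul_nonneg (by norm_num)
          apply add_nonneg
          · apply intervalIntegral.integral_nonneg hs.le
            intro x _; exact div_nonneg (h.nonneg x) (hDpos x).le
          · apply intervalIntegral.integral_nonneg (by linarith)
            intro x _; exact div_nonneg (h.nonneg x) (hDpos x).le
    _ = _ := by
      have : 1 - α ≠ 0 := by linarith
      field_simp; ring

end GoodU

namespace GoodU
variable {α : ℝ} {U : ℝ → ℝ}

def qk (r y : ℝ) : ℝ := 2 * r * Real.sin y / (1 - 2 * r * Real.cos y + r ^ 2)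

lemma qk_cont (r : ℝ) (hr0 : 0 ≤ r) (hr : r < 1) : Continuous (qk r) := by
  unfold qk
  exact Continuous.div (by fun_prop) (by fun_prop) (fun x => (denom_pos r x hr0 hr).ne')

lemma qk_neg (r y : ℝ) : qk r (-y) = - qk r y := by
  unfold qk; rw [Real.sin_neg, Real.cos_neg]; ring

lemma qk_nonneg (r y : ℝ) (hr0 : 0 ≤ r) (hr : r < 1) (h0 : 0 ≤ y) (h1 : y ≤ Real.pi) :
    0 ≤ qk r y :=
  div_nonneg (mul_nonneg (by positivity) (Real.sin_nonneg_of_nonneg_of_le_pi h0 h1))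
    (denom_pos r y hr0 hr).le

lemma qk_le (r y : ℝ) (hr0 : 0 ≤ r) (hr : r < 1) (h0 : 0 < y) (h1 : y ≤ Real.pi) :
    qk r y ≤ 2 / y := by
  unfold qk
  rw [div_le_div_iff₀ (denom_pos r y hr0 hr) h0]
  set a := y / 2 with ha
  have hy : y = 2 * a := by rw [ha]; ring
  have ha0 : 0 < a := by positivity
  have hs : 0 ≤ Real.sin a := Real.sin_nonneg_of_nonneg_of_le_pi ha0.le (by linarith)
  have hc : 0 ≤ Real.cos a := Real.cos_nonneg_of_neg_pi_div_two_le_of_le (by linarith) (by linarith)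
  have hkey : a * Real.cos a ≤ Real.sin a := by
    rcases (show a ≤ Real.pi / 2 by linarith).eq_or_lt with e | e
    · rw [e]; simp
    · have := Real.le_tan ha0.le e
      have hc' : 0 < Real.cos a := Real.cos_pos_of_mem_Ioo ⟨by linarith, e⟩
      rw [Real.tan_eq_sin_div_cos, le_div_iff₀ hc'] at this
      exact this
  rw [hy, Real.sin_two_mul, Real.cos_two_mul]
  have e2 := Real.sin_sq_add_cos_sq a
  have h3 : 2 * r * (2 * Real.sin a * Real.cos a) * (2 * a) ≤ 8 * r * Real.sin a ^ 2 := by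
    have : 8 * r * Real.sin a * (a * Real.cos a) ≤ 8 * r * Real.sin a * Real.sin a := by gcongr
    nlinarith
  nlinarith [sq_nonneg (1 - r)]

lemma conjU_eq (h : GoodU α U) (r θ : ℝ) (hr0 : 0 ≤ r) (hr : r < 1) :
    conjU U r θ = (1 / (2 * Real.pi)) * ∫ y in (0 : ℝ)..Real.pi,
      (U (θ - y) - U (θ + y)) * qk r y := by
  unfold conjU
  congr 1
  have hq := qk_cont r hr0 hr
  have hU := h.cont
  have e1 : ∫ x in (-Real.pi)..Real.pi, U x * (2 * r * Real.sin (θ - x) /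
      (1 - 2 * r * Real.cos (θ - x) + r ^ 2)) =
      ∫ x in (-Real.pi)..Real.pi, U (θ - (θ - x)) * qk r (θ - x) := by
    congr 1; funext x; simp [qk]
  rw [e1, intervalIntegral.integral_comp_sub_left (fun y => U (θ - y) * qk r y)]
  have hper : Function.Periodic (fun y => U (θ - y) * qk r y) (2 * Real.pi) := by
    intro y
    simp only
    rw [show θ - (y + 2 * Real.pi) = (θ - y) - 2 * Real.pi by ring, h.per.sub_eq]
    unfold qk; rw [Real.sin_add_two_pi, Real.cos_add_two_pi]
  have e2 := hper.intervalIntegral_add_eq (θ - Real.pi) (-Real.pi)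
  rw [show θ - Real.pi + 2 * Real.pi = θ - -Real.pi by ring,
    show -Real.pi + 2 * Real.pi = Real.pi by ring] at e2
  rw [e2]
  have hc : Continuous (fun y => U (θ - y) * qk r y) := by fun_prop
  have hc2 : Continuous (fun y => U (θ + y) * qk r y) := by fun_prop
  rw [← intervalIntegral.integral_add_adjacent_intervals (hc.intervalIntegrable (-Real.pi) 0)
    (hc.intervalIntegrable 0 Real.pi)]
  have e3 := intervalIntegral.integral_comp_neg (a := 0) (b := Real.pi)
    (fun y => U (θ - y) * qk r y)
  rw [neg_zero] at e3
  rw [← e3, ← intervalIntegral.integral_add ((by fun_prop : Continuous _).intervalIntegrable _ _)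
    (hc.intervalIntegrable _ _)]
  congr 1; funext y; rw [qk_neg, sub_neg_eq_add]; ring

lemma conjU_zero (h : GoodU α U) (r : ℝ) (hr0 : 0 ≤ r) (hr : r < 1) : conjU U r 0 = 0 := by
  rw [h.conjU_eq r 0 hr0 hr]
  simp [h.even]

lemma conjU_neg (h : GoodU α U) (r θ : ℝ) (hr0 : 0 ≤ r) (hr : r < 1) :
    conjU U r (-θ) = - conjU U r θ := by
  rw [h.conjU_eq r _ hr0 hr, h.conjU_eq r _ hr0 hr, ← mul_neg, ← intervalIntegral.integral_neg]
  congr 2; funext y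
  rw [show -θ - y = -(θ + y) by ring, show -θ + y = -(θ - y) by ring, h.even, h.even]; ring

lemma reg1 (h : GoodU α U) (r θ : ℝ) (hr0 : 0 ≤ r) (hr : r < 1) (h0 : 0 < θ)
    (h1 : θ ≤ Real.pi / 4) :
    ∫ y in (0 : ℝ)..θ, (U (θ + y) - U (θ - y)) * qk r y ≤ 8 * U θ := by
  have hpi := Real.pi_pos
  have hq := qk_cont r hr0 hr
  have hU := h.cont
  have hc : Continuous (fun y => (U (θ + y) - U (θ - y)) * qk r y) := by fun_prop
  have : ∫ y in (0 : ℝ)..θ, (U (θ + y) - U (θ - y)) * qk r y ≤ ∫ y in (0 : ℝ)..θ, 8 * U θ / θ := by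
    refine intervalIntegral.integral_mono_on h0.le (hc.intervalIntegrable _ _) (by simp) ?_
    intro y hy
    rcases hy.1.eq_or_lt with e | e
    · rw [← e]; simp; exact div_nonneg (mul_nonneg (by norm_num) (h.nonneg _)) h0.le
    have hyθ := hy.2
    have l1 := h.lin (a := θ - y) (b := θ + y) (by linarith) (by linarith) (by linarith) (by linarith)
    have l2 := h.lin (a := θ) (b := θ + y) (by linarith) (by linarith) (by linarith) (by linarith)
    have hUn := h.nonneg (θ + y)
    have hUθ := h.nonneg θ
    have hp : 0 < θ + y := by linarith
    -- U(θ+y)-U(θ-y) ≤ 4 Uθ y/θ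
    have k1 : U (θ + y) - U (θ - y) ≤ U (θ + y) * (2 * y) / (θ + y) := by
      rw [le_div_iff₀ hp]; nlinarith
    have k2 : U (θ + y) / (θ + y) ≤ U θ / θ := by
      rw [div_le_div_iff₀ hp h0]; exact l2
    have k3 : U (θ + y) - U (θ - y) ≤ U θ / θ * (2 * y) := by
      calc _ ≤ _ := k1
        _ = U (θ + y) / (θ + y) * (2 * y) := by ring
        _ ≤ _ := by gcongr
    calc (U (θ + y) - U (θ - y)) * qk r y ≤ (U θ / θ * (2 * y)) * (2 / y) := by
          apply mul_le_mul k3 (qk_le r y hr0 hr e (by linarith))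
            (qk_nonneg r y hr0 hr e.le (by linarith)) (by positivity)
      _ = 4 * U θ / θ := by field_simp; ring
      _ ≤ _ := by gcongr; norm_num
  refine this.trans (le_of_eq ?_)
  rw [intervalIntegral.integral_const, smul_eq_mul]; field_simp; ring

lemma reg2 (h : GoodU α U) (r θ : ℝ) (hr0 : 0 ≤ r) (hr : r < 1) (h0 : 0 < θ)
    (h1 : θ ≤ Real.pi / 4) :
    ∫ y in θ..(Real.pi / 4), (U (θ + y) - U (θ - y)) * qk r y ≤ 4 / (1 - α) * U θ := by
  have hpi := Real.pi_pos
  have hq := qk_cont r hr0 hr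
  have hU := h.cont
  have hα := h.a1
  have hUθ := h.nonneg θ
  have hc : Continuous (fun y => (U (θ + y) - U (θ - y)) * qk r y) := by fun_prop
  have : ∫ y in θ..(Real.pi / 4), (U (θ + y) - U (θ - y)) * qk r y
      ≤ ∫ y in θ..(Real.pi / 4), (4 * U θ * θ / θ ^ α) * y ^ (α - 2) := by
    refine intervalIntegral.integral_mono_on h1 (hc.intervalIntegrable _ _) ?_ ?_
    · apply IntervalIntegrable.const_mul
      apply intervalIntegral.intervalIntegrable_rpow
      right; intro hh; rw [uIcc_of_le (by linarith)] at hh; linarith [hh.1]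
    intro y hy
    have hy1 := hy.1
    have hy2 := hy.2
    have hy0 : 0 < y := by linarith
    have l1 := h.lin (a := y - θ) (b := y + θ) (by linarith) (by linarith) (by linarith) (by linarith)
    have l2 := h.lin (a := y) (b := y + θ) (by linarith) (by linarith) (by linarith) (by linarith)
    have l3 := h.pow θ y h0 hy1 (by linarith)
    rw [Real.div_rpow hy0.le h0.le] at l3
    have hUn := h.nonneg (y + θ)
    have hp : 0 < y + θ := by linarith
    rw [show θ - y = -(y - θ) by ring, h.even, show θ + y = y + θ by ring]
    have k1 : U (y + θ) - U (y - θ) ≤ U (y + θ) * (2 * θ) / (y + θ) := by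
      rw [le_div_iff₀ hp]; nlinarith
    have k2 : U (y + θ) / (y + θ) ≤ U y / y := by
      rw [div_le_div_iff₀ hp hy0]; exact l2
    have k3 : U (y + θ) - U (y - θ) ≤ U θ * (y ^ α / θ ^ α) / y * (2 * θ) := by
      calc _ ≤ _ := k1
        _ = U (y + θ) / (y + θ) * (2 * θ) := by ring
        _ ≤ U y / y * (2 * θ) := by gcongr
        _ ≤ _ := by gcongr
    have e : y ^ (α - 2) = y ^ α / y ^ 2 := by
      rw [Real.rpow_sub hy0]; norm_cast
    rw [e]
    have hya : 0 < y ^ α := by positivity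
    have hta : 0 < θ ^ α := by positivity
    calc (U (y + θ) - U (y - θ)) * qk r y ≤ (U θ * (y ^ α / θ ^ α) / y * (2 * θ)) * (2 / y) := by
          apply mul_le_mul k3 (qk_le r y hr0 hr hy0 (by linarith))
            (qk_nonneg r y hr0 hr hy0.le (by linarith)) (by positivity)
      _ = _ := by field_simp; ring
  refine this.trans ?_
  rw [intervalIntegral.integral_const_mul]
  have i3 := h.rpow_int θ (Real.pi / 4) h0 h1
  have hta : 0 < θ ^ α := by positivity
  calc _ ≤ (4 * U θ * θ / θ ^ α) * (θ ^ (α - 1) / (1 - α)) := by gcongr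
    _ = _ := by
      rw [Real.rpow_sub h0, Real.rpow_one]
      have : 1 - α ≠ 0 := by linarith
      field_simp

lemma diff_nonneg (h : GoodU α U) (θ y : ℝ) (h0 : 0 ≤ θ) (h1 : θ ≤ Real.pi / 4) (hy0 : 0 ≤ y)
    (hy : y ≤ Real.pi) : U (θ - y) ≤ U (θ + y) := by
  have hpi := Real.pi_pos
  rw [← h.abs_eq (θ - y)]
  have ha : |θ - y| ≤ Real.pi := by rw [abs_le]; constructor <;> linarith
  by_cases hh : θ + y ≤ Real.pi
  · exact h.mono' (abs_nonneg _) (by rw [abs_le]; constructor <;> linarith) hh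
  · push Not at hh
    have : U (θ + y) = U (2 * Real.pi - (θ + y)) := by
      rw [← h.even, ← h.per (-(θ + y))]; congr 1; ring
    rw [this]
    exact h.mono' (abs_nonneg _) (by rw [abs_le]; constructor <;> linarith) (by linarith)

lemma reg3 (h : GoodU α U) (r θ : ℝ) (hr0 : 0 ≤ r) (hr : r < 1) (h0 : 0 < θ)
    (h1 : θ ≤ Real.pi / 4) :
    ∫ y in (Real.pi / 4)..Real.pi, (U (θ + y) - U (θ - y)) * qk r y ≤ 8 * U Real.pi * θ := by
  have hpi := Real.pi_pos
  have hpi3 := Real.pi_gt_three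
  have hq := qk_cont r hr0 hr
  have hU := h.cont
  have hc : Continuous (fun y => (U (θ + y) - U (θ - y)) * qk r y) := by fun_prop
  have hc2 : Continuous (fun y => U (θ + y)) := by fun_prop
  have hc3 : Continuous (fun y => U (y - θ)) := by fun_prop
  have : ∫ y in (Real.pi / 4)..Real.pi, (U (θ + y) - U (θ - y)) * qk r y
      ≤ ∫ y in (Real.pi / 4)..Real.pi, (U (θ + y) - U (y - θ)) * 4 := by
    refine intervalIntegral.integral_mono_on (by linarith) (hc.intervalIntegrable _ _)
      ((by fun_prop : Continuous (fun y => (U (θ + y) - U (y - θ)) * 4)).intervalIntegrable _ _) ?_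
    intro y hy
    have hy0 : 0 < y := by linarith [hy.1]
    have := h.diff_nonneg θ y h0.le h1 hy0.le hy.2
    rw [show y - θ = -(θ - y) by ring, h.even]
    apply mul_le_mul_of_nonneg_left _ (by linarith)
    refine (qk_le r y hr0 hr hy0 hy.2).trans ?_
    rw [div_le_iff₀ hy0]; linarith [hy.1]
  refine this.trans ?_
  rw [intervalIntegral.integral_mul_const, intervalIntegral.integral_sub
    (hc2.intervalIntegrable _ _) (hc3.intervalIntegrable _ _)]
  rw [intervalIntegral.integral_comp_add_left (fun y => U y),
    intervalIntegral.integral_comp_sub_right (fun y => U y)]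
  have e1 := intervalIntegral.integral_add_adjacent_intervals
    (hU.intervalIntegrable (μ := volume) (Real.pi / 4 - θ) (Real.pi - θ))
    (hU.intervalIntegrable (Real.pi - θ) (θ + Real.pi))
  have e2 := intervalIntegral.integral_add_adjacent_intervals
    (hU.intervalIntegrable (μ := volume) (Real.pi / 4 - θ) (θ + Real.pi / 4))
    (hU.intervalIntegrable (θ + Real.pi / 4) (θ + Real.pi))
  have n1 : 0 ≤ ∫ x in (Real.pi / 4 - θ)..(θ + Real.pi / 4), U x :=
    intervalIntegral.integral_nonneg (by linarith) (fun x _ => h.nonneg x)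
  have n2 : ∫ x in (Real.pi - θ)..(θ + Real.pi), U x ≤ ∫ x in (Real.pi - θ)..(θ + Real.pi), U Real.pi :=
    intervalIntegral.integral_mono_on (by linarith) (hU.intervalIntegrable _ _) (by simp)
      (fun x _ => h.le_pi x)
  rw [intervalIntegral.integral_const, smul_eq_mul] at n2
  nlinarith

lemma conj_bound (h : GoodU α U) : ∃ C > 0, ∀ r θ, 0 ≤ r → r < 1 → 0 < |θ| → |θ| ≤ Real.pi / 4 →
    |conjU U r θ| ≤ C * U θ := by
  have hpi := Real.pi_pos
  have hpi3 := Real.pi_gt_three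
  have hα := h.a1
  have hUp := h.pos Real.pi (by positivity) le_rfl
  have hUp2 := h.pos (Real.pi / 2) (by positivity) (by linarith)
  set K := 8 * U Real.pi * (Real.pi / 2) / U (Real.pi / 2) with hK
  have hK0 : 0 < K := by positivity
  have h1α : 0 < 1 - α := by linarith
  refine ⟨8 + 4 / (1 - α) + K, by positivity, ?_⟩
  have main : ∀ r θ, 0 ≤ r → r < 1 → 0 < θ → θ ≤ Real.pi / 4 →
      |conjU U r θ| ≤ (8 + 4 / (1 - α) + K) * U θ := by
    intro r θ hr0 hr h0 h1
    have hq := qk_cont r hr0 hr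
    have hU := h.cont
    rw [h.conjU_eq r θ hr0 hr]
    have en : ∫ y in (0 : ℝ)..Real.pi, (U (θ - y) - U (θ + y)) * qk r y
        = - ∫ y in (0 : ℝ)..Real.pi, (U (θ + y) - U (θ - y)) * qk r y := by
      rw [← intervalIntegral.integral_neg]; congr 1; funext y; ring
    have hc : Continuous (fun y => (U (θ + y) - U (θ - y)) * qk r y) := by fun_prop
    have n : 0 ≤ ∫ y in (0 : ℝ)..Real.pi, (U (θ + y) - U (θ - y)) * qk r y := by
      apply intervalIntegral.integral_nonneg hpi.le
      intro y hy
      have := h.diff_nonneg θ y h0.le h1 hy.1 hy.2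
      exact mul_nonneg (by linarith) (qk_nonneg r y hr0 hr hy.1 hy.2)
    rw [en, abs_mul, abs_neg, abs_of_nonneg n, abs_of_pos (by positivity)]
    have s1 := intervalIntegral.integral_add_adjacent_intervals
      (hc.intervalIntegrable (μ := volume) 0 θ) (hc.intervalIntegrable θ (Real.pi / 4))
    have s2 := intervalIntegral.integral_add_adjacent_intervals
      (hc.intervalIntegrable (μ := volume) 0 (Real.pi / 4))
      (hc.intervalIntegrable (Real.pi / 4) Real.pi)
    have r1 := h.reg1 r θ hr0 hr h0 h1
    have r2 := h.reg2 r θ hr0 hr h0 h1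
    have r3 := h.reg3 r θ hr0 hr h0 h1
    have l := h.lin (a := θ) (b := Real.pi / 2) h0.le (by linarith) (by linarith) le_rfl
    have r4 : 8 * U Real.pi * θ ≤ K * U θ := by
      rw [hK, div_mul_eq_mul_div, le_div_iff₀ hUp2]
      calc 8 * U Real.pi * θ * U (Real.pi / 2) = 8 * U Real.pi * (U (Real.pi / 2) * θ) := by ring
        _ ≤ 8 * U Real.pi * (U θ * (Real.pi / 2)) := by gcongr
        _ = _ := by ring
    have hle : 1 / (2 * Real.pi) ≤ 1 := by
      rw [div_le_one (by positivity)]; linarith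
    have htot : ∫ y in (0 : ℝ)..Real.pi, (U (θ + y) - U (θ - y)) * qk r y
      ≤ (8 + 4 / (1 - α) + K) * U θ := by
      rw [← s2, ← s1]; linarith
    calc _ ≤ 1 * ∫ y in (0 : ℝ)..Real.pi, (U (θ + y) - U (θ - y)) * qk r y := by gcongr
      _ ≤ _ := by rw [one_mul]; exact htot
  intro r θ hr0 hr h0 h1
  rcases abs_choice θ with e | e
  · rw [e] at h0 h1; exact main r θ hr0 hr h0 h1
  · rw [e] at h0 h1
    have := main r (-θ) hr0 hr h0 h1
    rwa [h.conjU_neg r θ hr0 hr, abs_neg, h.even] at this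

end GoodU

def bl (w : ℝ) (z : ℂ) : ℂ := (z - w) / (1 - w * z)

lemma bl_id (w : ℝ) (z : ℂ) :
    ‖z - w‖ ^ 2 = ‖1 - w * z‖ ^ 2 - (1 - w ^ 2) * (1 - ‖z‖ ^ 2) := by
  simp only [← Complex.normSq_eq_norm_sq, Complex.normSq_apply]
  simp
  ring

lemma bl_den (w : ℝ) (z : ℂ) (hz : ‖z‖ < 1) (h0 : 0 ≤ w) (h1 : w < 1) : 0 < ‖1 - w * z‖ := by
  rw [norm_pos_iff]
  intro e
  have : ‖(w : ℂ) * z‖ = 1 := by rw [← sub_eq_zero.1 e]; simp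
  rw [norm_mul, Complex.norm_real, Real.norm_of_nonneg h0] at this
  nlinarith [norm_nonneg z]

lemma bl_sq (w : ℝ) (z : ℂ) (hz : ‖z‖ < 1) (h0 : 0 ≤ w) (h1 : w < 1) :
    ‖bl w z‖ ^ 2 = 1 - (1 - w ^ 2) * (1 - ‖z‖ ^ 2) / ‖1 - w * z‖ ^ 2 := by
  have := bl_den w z hz h0 h1
  rw [bl, norm_div, div_pow, bl_id]
  field_simp

lemma bl_le_one (w : ℝ) (z : ℂ) (hz : ‖z‖ < 1) (h0 : 0 ≤ w) (h1 : w < 1) : ‖bl w z‖ ≤ 1 := by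
  have h2 := bl_sq w z hz h0 h1
  have h3 : 0 ≤ (1 - w ^ 2) * (1 - ‖z‖ ^ 2) / ‖1 - w * z‖ ^ 2 := by
    apply div_nonneg (mul_nonneg _ _) (by positivity)
    · nlinarith
    · nlinarith [norm_nonneg z]
  rw [← sq_le_one_iff₀ (norm_nonneg _)]; linarith

lemma one_sub_exp_norm (p : ℂ) (hp : 0 ≤ p.re) : ‖1 - Complex.exp (-p)‖ ^ 2 ≤ p.re ^ 2 + p.im ^ 2 := by
  have e : ‖1 - Complex.exp (-p)‖ ^ 2
      = (1 - Real.exp (-p.re)) ^ 2 + 2 * Real.exp (-p.re) * (1 - Real.cos p.im) := by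
    rw [← Complex.normSq_eq_norm_sq, Complex.normSq_apply]
    simp only [Complex.sub_re, Complex.sub_im, Complex.exp_re, Complex.exp_im, Complex.one_re,
      Complex.one_im, Complex.neg_re, Complex.neg_im, Real.cos_neg, Real.sin_neg]
    have := Real.sin_sq_add_cos_sq p.im
    linear_combination Real.exp (-p.re) ^ 2 * this
  rw [e]
  have h1 : Real.exp (-p.re) ≤ 1 := Real.exp_le_one_iff.2 (by linarith)
  have h2 := Real.add_one_le_exp (-p.re)
  have h3 := Real.one_sub_sq_div_two_le_cos (x := p.im)
  have h4 := Real.exp_pos (-p.re)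
  have h5 := Real.cos_le_one p.im
  have : (1 - Real.exp (-p.re)) ^ 2 ≤ p.re ^ 2 := by
    apply sq_le_sq' <;> linarith
  nlinarith

lemma one_sub_exp_lower (y : ℝ) (h0 : 0 ≤ y) (h1 : y ≤ 2) : y / 3 ≤ 1 - Real.exp (-y) := by
  rw [Real.exp_neg]
  have h2 := Real.add_one_le_exp y
  have h3 : (Real.exp y)⁻¹ ≤ (y + 1)⁻¹ := inv_anti₀ (by linarith) h2
  have h4 : (y + 1)⁻¹ ≤ 1 - y / 3 := by
    rw [inv_le_iff_one_le_mul₀ (by linarith)]; nlinarith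
  linarith

lemma bl_bound (C σ : ℝ) (s : ℂ) (h0 : 0 < s.re) (hs : |s.im| ≤ C * s.re)
    (h1 : σ / 2 ≤ s.re) (h2 : s.re ≤ σ) (h3 : σ ≤ 1) :
    ‖bl (Real.exp (-σ)) (Complex.exp (-s))‖ ^ 2 ≤ 1 - 2 / 9 / (4 + C ^ 2) := by
  have hσ : 0 < σ := by linarith
  have hz : ‖Complex.exp (-s)‖ = Real.exp (-s.re) := by rw [Complex.norm_exp]; simp
  have hz1 : ‖Complex.exp (-s)‖ < 1 := by rw [hz]; exact Real.exp_lt_one_iff.2 (by linarith)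
  have hw1 : Real.exp (-σ) < 1 := Real.exp_lt_one_iff.2 (by linarith)
  have hd := bl_den _ _ hz1 (Real.exp_pos (-σ)).le hw1
  rw [bl_sq _ _ hz1 (Real.exp_pos _).le hw1]
  have e : (1 : ℂ) - (Real.exp (-σ) : ℝ) * Complex.exp (-s) = 1 - Complex.exp (-(σ + s)) := by
    rw [neg_add, Complex.exp_add]; push_cast; rfl
  have hb := one_sub_exp_norm (σ + s) (by simp; linarith)
  rw [← e] at hb
  simp only [Complex.add_re, Complex.add_im, Complex.ofReal_re, Complex.ofReal_im, zero_add] at hb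
  have hy : s.im ^ 2 ≤ C ^ 2 * σ ^ 2 := by
    rw [← sq_abs, ← mul_pow]
    have hC : 0 ≤ C := by
      by_contra hC
      push Not at hC
      nlinarith [abs_nonneg s.im]
    have : |s.im| ≤ C * σ := hs.trans (by gcongr)
    gcongr
  have hb2 : ‖1 - (Real.exp (-σ) : ℝ) * Complex.exp (-s)‖ ^ 2 ≤ (4 + C ^ 2) * σ ^ 2 := by
    nlinarith
  have l1 := one_sub_exp_lower (2 * σ) (by linarith) (by linarith)
  have l2 := one_sub_exp_lower (2 * s.re) (by linarith) (by linarith)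
  have e1 : Real.exp (-σ) ^ 2 = Real.exp (-(2 * σ)) := by rw [← Real.exp_nat_mul]; congr 1; push_cast; ring
  have e2 : ‖Complex.exp (-s)‖ ^ 2 = Real.exp (-(2 * s.re)) := by
    rw [hz, ← Real.exp_nat_mul]; congr 1; push_cast; ring
  rw [e1, e2]
  have hn : 2 / 9 * σ ^ 2 ≤ (1 - Real.exp (-(2 * σ))) * (1 - Real.exp (-(2 * s.re))) := by
    calc 2 / 9 * σ ^ 2 = (2 * σ / 3) * (σ / 3) := by ring
      _ ≤ _ := by
        apply mul_le_mul l1 (by linarith) (by linarith) (by linarith)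
  have : 2 / 9 / (4 + C ^ 2) ≤ (1 - Real.exp (-(2 * σ))) * (1 - Real.exp (-(2 * s.re))) /
      ‖1 - (Real.exp (-σ) : ℝ) * Complex.exp (-s)‖ ^ 2 := by
    calc 2 / 9 / (4 + C ^ 2) = (2 / 9 * σ ^ 2) / ((4 + C ^ 2) * σ ^ 2) := by field_simp
      _ ≤ _ := by
        apply div_le_div₀ _ hn (by positivity) hb2
        exact le_trans (by positivity) hn
  linarith

def base (J : ℕ) : List ℝ := 0 :: (List.range (J + 1)).map (fun j => Real.exp (-((1 / 2 : ℝ) ^ j)))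

lemma base_length (J : ℕ) : (base J).length = J + 2 := by simp [base]

lemma base_mem (J : ℕ) : ∀ w ∈ base J, 0 ≤ w ∧ w < 1 := by
  intro w hw
  simp only [base, List.mem_cons, List.mem_map] at hw
  rcases hw with e | ⟨j, -, e⟩
  · rw [e]; norm_num
  · rw [← e]; exact ⟨(Real.exp_pos _).le, Real.exp_lt_one_iff.2 (by simp)⟩

lemma prod_le_one (l : List ℝ) (hl : ∀ w ∈ l, 0 ≤ w ∧ w < 1) (z : ℂ) (hz : ‖z‖ < 1) :
    ‖(l.map (fun w => bl w z)).prod‖ ≤ 1 := by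
  induction l with
  | nil => simp
  | cons a l ih =>
    rw [List.map_cons, List.prod_cons, norm_mul]
    have ha := hl a (by simp)
    exact mul_le_one₀ (bl_le_one a z hz ha.1 ha.2) (norm_nonneg _)
      (ih (fun w hw => hl w (by simp [hw])))

lemma prod_le_mem (l : List ℝ) (hl : ∀ w ∈ l, 0 ≤ w ∧ w < 1) (z : ℂ) (hz : ‖z‖ < 1) (x : ℝ)
    (hx : x ∈ l) : ‖(l.map (fun w => bl w z)).prod‖ ≤ ‖bl x z‖ := by
  induction l with
  | nil => simp at hx
  | cons a l ih =>
    rw [List.map_cons, List.prod_cons, norm_mul]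
    have ha := hl a (by simp)
    have hl' : ∀ w ∈ l, 0 ≤ w ∧ w < 1 := fun w hw => hl w (by simp [hw])
    rcases List.mem_cons.1 hx with e | e
    · rw [e]
      exact mul_le_of_le_one_right (norm_nonneg _) (prod_le_one l hl' z hz)
    · calc _ ≤ 1 * ‖(l.map (fun w => bl w z)).prod‖ := by
            gcongr; exact bl_le_one a z hz ha.1 ha.2
        _ ≤ _ := by rw [one_mul]; exact ih hl' e

lemma base_one (J : ℕ) (s : ℂ) (c : ℝ) (hc : 0 < c) (h : c ≤ s.re) :
    ‖((base J).map (fun w => bl w (Complex.exp (-s)))).prod‖ ≤ Real.exp (-c) := by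
  have hz : ‖Complex.exp (-s)‖ = Real.exp (-s.re) := by rw [Complex.norm_exp]; simp
  have hz1 : ‖Complex.exp (-s)‖ < 1 := by rw [hz]; exact Real.exp_lt_one_iff.2 (by linarith)
  refine (prod_le_mem _ (base_mem J) _ hz1 0 (by simp [base])).trans ?_
  simp only [bl, Complex.ofReal_zero, sub_zero, zero_mul, div_one]
  rw [hz]; exact Real.exp_le_exp.2 (by linarith)

lemma base_two (J : ℕ) (s : ℂ) (C : ℝ) (h0 : 0 < s.re) (h1 : s.re ≤ 1)
    (hs : |s.im| ≤ C * s.re) (hJ : (1 / 2 : ℝ) ^ (J + 1) < s.re) :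
    ‖((base J).map (fun w => bl w (Complex.exp (-s)))).prod‖ ≤ √(1 - 2 / 9 / (4 + C ^ 2)) := by
  have hz : ‖Complex.exp (-s)‖ = Real.exp (-s.re) := by rw [Complex.norm_exp]; simp
  have hz1 : ‖Complex.exp (-s)‖ < 1 := by rw [hz]; exact Real.exp_lt_one_iff.2 (by linarith)
  obtain ⟨j, hj1, hj2⟩ := exists_nat_pow_near_of_lt_one h0 h1 (y := (1 / 2 : ℝ)) (by norm_num) (by norm_num)
  have hjJ : j < J + 1 := by
    by_contra hh
    push Not at hh
    have := pow_le_pow_of_le_one (a := (1 / 2 : ℝ)) (by norm_num) (by norm_num) hh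
    linarith
  refine (prod_le_mem _ (base_mem J) _ hz1 (Real.exp (-((1 / 2 : ℝ) ^ j))) ?_).trans ?_
  · simp only [base, List.mem_cons, List.mem_map, List.mem_range]
    right; exact ⟨j, hjJ, rfl⟩
  · apply Real.le_sqrt_of_sq_le
    apply bl_bound C _ s h0 hs _ hj2 (pow_le_one₀ (by norm_num) (by norm_num))
    rw [pow_succ] at hj1; linarith

lemma rep_prod (l : List ℝ) (m : ℕ) (f : ℝ → ℂ) :
    (((List.replicate m l).flatten).map f).prod = ((l.map f).prod) ^ m := by
  rw [List.map_flatten, List.prod_flatten]; simp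

namespace GoodU
variable {α : ℝ} {U : ℝ → ℝ}

lemma factor_bound (h : GoodU α U) (F : ℂ → ℂ)
    (hFre : ∀ r θ : ℝ, 0 ≤ r → r < 1 →
      (F ((r : ℂ) * Complex.exp (θ * Complex.I))).re = poisson U r θ)
    (hFi : ∀ r θ : ℝ, 0 ≤ r → r < 1 →
      (F ((r : ℂ) * Complex.exp (θ * Complex.I))).im = conjU U r θ) :
    ∃ ρ, 0 < ρ ∧ ρ < 1 ∧ ∀ (J : ℕ) (t : ℝ), 0 < t → t ≤ Real.pi / 4 →
      (1 / 2 : ℝ) ^ (J + 1) < U t / 16 → ∀ r θ : ℝ, 0 ≤ r → r < 1 → t ≤ |θ| → |θ| ≤ Real.pi →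
      ‖((base J).map (fun w => bl w (Complex.exp (-F ((r : ℂ) * Complex.exp (θ * Complex.I)))))).prod‖
        ≤ ρ := by
  have hpi := Real.pi_pos
  obtain ⟨C, hC, hCb⟩ := h.conj_bound
  have hU4 := h.pos (Real.pi / 4) (by positivity) (by linarith)
  set c0 := min 1 (U (Real.pi / 4) / 16) with hc0
  have hc0p : 0 < c0 := lt_min one_pos (by positivity)
  refine ⟨max (Real.exp (-c0)) (√(1 - 2 / 9 / (4 + (16 * C) ^ 2))), lt_max_of_lt_left (Real.exp_pos _),
    max_lt (Real.exp_lt_one_iff.2 (by linarith)) ?_, ?_⟩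
  · rw [Real.sqrt_lt' one_pos]
    have : 0 < 2 / 9 / (4 + (16 * C) ^ 2) := by positivity
    linarith
  intro J t ht0 ht hJ r θ hr0 hr hθ1 hθ2
  set s := F ((r : ℂ) * Complex.exp (θ * Complex.I)) with hs
  have hre : s.re = poisson U r θ := hFre r θ hr0 hr
  have him : s.im = conjU U r θ := hFi r θ hr0 hr
  have hlow := h.poisson_lower r θ hr0 hr hθ2
  rw [← hre] at hlow
  by_cases h1 : Real.pi / 4 ≤ |θ|
  · refine (base_one J s c0 hc0p ?_).trans (le_max_left _ _)
    refine (min_le_right _ _).trans (le_trans ?_ hlow)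
    have := h.mono' (a := Real.pi / 4) (b := min |θ| (Real.pi / 2)) (by positivity)
      (le_min h1 (by linarith)) ((min_le_left _ _).trans hθ2)
    linarith
  push Not at h1
  by_cases h2 : 1 ≤ s.re
  · exact (base_one J s c0 hc0p ((min_le_left _ _).trans h2)).trans (le_max_left _ _)
  push Not at h2
  rw [min_eq_left (by linarith), h.abs_eq] at hlow
  have hUt : U t ≤ U θ := by
    rw [← h.abs_eq θ]; exact h.mono' ht0.le hθ1 hθ2
  have hUp := h.pos t ht0 (by linarith)
  refine (base_two J s (16 * C) (by linarith) h2.le ?_ (by linarith)).trans (le_max_right _ _)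
  rw [him]
  refine (hCb r θ hr0 hr (by linarith) h1.le).trans ?_
  nlinarith

lemma abs_rpow_integrable (γ : ℝ) (hγ : γ < 1) :
    IntervalIntegrable (fun x : ℝ => |x| ^ (-γ)) volume (-Real.pi) Real.pi := by
  have hpi := Real.pi_pos
  have h1 : IntervalIntegrable (fun x : ℝ => |x| ^ (-γ)) volume 0 Real.pi := by
    refine (intervalIntegral.intervalIntegrable_rpow' (r := -γ) (by linarith)).congr ?_
    intro x hx
    rw [uIoc_of_le hpi.le] at hx
    simp only
    rw [abs_of_pos hx.1]
  have h2 : IntervalIntegrable (fun x : ℝ => |x| ^ (-γ)) volume (-Real.pi) 0 := by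
    rw [IntervalIntegrable.iff_comp_neg]
    simpa using h1.symm
  exact h2.trans h1

lemma part_one_aux (h : GoodU α U) (F : ℂ → ℂ)
    (hFre : ∀ r θ : ℝ, 0 ≤ r → r < 1 →
      (F ((r : ℂ) * Complex.exp (θ * Complex.I))).re = poisson U r θ)
    (hFi : ∀ r θ : ℝ, 0 ≤ r → r < 1 →
      (F ((r : ℂ) * Complex.exp (θ * Complex.I))).im = conjU U r θ)
    (φ : ℂ → ℂ) (hφ : ∀ z, φ z = Complex.exp (-F z))
    (T : H2 →L[ℂ] H2)
    (hT : ∀ (a : H2) (z : ℂ), ‖z‖ < 1 → fa (T a) z = fa a (φ z)) :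
    ∃ ρ K β : ℝ, 0 < ρ ∧ ρ < 1 ∧ 0 ≤ K ∧ 0 < β ∧ ∀ (n m J : ℕ) (t : ℝ), m * (J + 2) ≤ n - 1 →
      0 < t → t ≤ 1 / 2 → (1 / 2 : ℝ) ^ (J + 1) < U t / 16 →
      approxNum T n ≤ ρ ^ m * ‖T‖ + K * t ^ β := by
  have hpi := Real.pi_pos
  have hpi3 := Real.pi_gt_three
  have hα0 := h.a0
  have hα1 := h.a1
  obtain ⟨ρ, hρ0, hρ1, hρ⟩ := h.factor_bound F hFre hFi
  obtain ⟨c', hc', hlow'⟩ := h.lower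
  set c := min c' 1 with hc
  have hc0 : 0 < c := lt_min hc' one_pos
  have hc1 : c ≤ 1 := min_le_right _ _
  have hlow : ∀ t, 0 < t → t ≤ Real.pi / 2 → c * t ^ α ≤ U t := fun t h1 h2 =>
    le_trans (by have : 0 < t ^ α := by positivity
                 gcongr; exact min_le_left _ _) (hlow' t h1 h2)
  set β := (1 - α) / 2 with hβ
  have hβ0 : 0 < β := by rw [hβ]; linarith
  set γ := α + β with hγ
  have hγ1 : γ < 1 := by rw [hγ, hβ]; linarith
  have hint := abs_rpow_integrable γ hγ1
  set K0 := ∫ x in (-Real.pi)..Real.pi, |x| ^ (-γ) with hK0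
  have hK0n : 0 ≤ K0 := intervalIntegral.integral_nonneg (by linarith) (fun x _ => by positivity)
  set K1 := 32 / c * K0 with hK1
  have hK1n : 0 ≤ K1 := by positivity
  refine ⟨ρ, √K1, β / 2, hρ0, hρ1, Real.sqrt_nonneg _, by positivity, ?_⟩
  intro n m J t hN ht0 ht hJ
  set l := (List.replicate m (base J)).flatten with hl
  obtain ⟨b, hb1, hb2, hb3⟩ := exists_blaschke l (by
    intro w hw
    rw [hl, List.mem_flatten] at hw
    obtain ⟨l', hl', hw⟩ := hw
    rw [(List.mem_replicate.1 hl').2] at hw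
    exact base_mem J w hw)
  refine approxNum_le_blaschke T b n l.length ?_ hb1 hb3 _ (by positivity) ?_
  · rw [hl]; simp [base_length]; exact hN
  intro g
  have htp : 0 < t ^ β := by positivity
  have key : ‖T (b g)‖ ^ 2 ≤ (ρ ^ m) ^ 2 * ‖T g‖ ^ 2 + K1 * t ^ β * ‖g‖ ^ 2 := by
    apply norm_le_of_circle
    intro r hr0 hr
    have hpt : ∀ θ ∈ Set.Icc (-Real.pi) Real.pi, θ ≠ 0 →
        ‖fa (T (b g)) (r * Complex.exp (θ * I))‖ ^ 2 ≤
          (ρ ^ m) ^ 2 * ‖fa (T g) (r * Complex.exp (θ * I))‖ ^ 2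
          + (32 / c * t ^ β * ‖g‖ ^ 2) * |θ| ^ (-γ) := by
      intro θ hθ hθ0
      set z : ℂ := r * Complex.exp (θ * I) with hz
      have hzn : ‖z‖ < 1 := by
        rw [hz, norm_mul, Complex.norm_exp_ofReal_mul_I, mul_one, Complex.norm_real,
          Real.norm_of_nonneg hr0]; exact hr
      have habs : |θ| ≤ Real.pi := abs_le.2 hθ
      have hab0 : 0 < |θ| := abs_pos.2 hθ0
      have hpl := h.poisson_lower r θ hr0 hr habs
      have hmin0 : 0 < min |θ| (Real.pi / 2) := lt_min hab0 (by positivity)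
      have hup : 0 < poisson U r θ :=
        lt_of_lt_of_le (by have := h.pos _ hmin0 ((min_le_left _ _).trans habs); positivity) hpl
      have hφn : ‖φ z‖ = Real.exp (-poisson U r θ) := by
        rw [hφ, Complex.norm_exp, Complex.neg_re, hz, hFre r θ hr0 hr]
      have hφ1 : ‖φ z‖ < 1 := by rw [hφn]; exact Real.exp_lt_one_iff.2 (by linarith)
      have hθγ : 0 < |θ| ^ (-γ) := by positivity
      by_cases hcase : t ≤ |θ|
      · have e1 : fa (T (b g)) z = ((base J).map (fun w => bl w (φ z))).prod ^ m * fa (T g) z := by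
          rw [hT _ z hzn, hb2 g _ hφ1, hT _ z hzn]
          congr 1
          exact rep_prod (base J) m (fun w => bl w (φ z))
        have e2 := hρ J t ht0 (by linarith) hJ r θ hr0 hr hcase habs
        rw [← hz, ← hφ] at e2
        rw [e1, norm_mul, norm_pow, mul_pow]
        have : 0 ≤ (32 / c * t ^ β * ‖g‖ ^ 2) * |θ| ^ (-γ) := by positivity
        have : (‖((base J).map (fun w => bl w (φ z))).prod‖ ^ m) ^ 2 * ‖fa (T g) z‖ ^ 2 ≤
          (ρ ^ m) ^ 2 * ‖fa (T g) z‖ ^ 2 := by gcongr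
        linarith
      · push Not at hcase
        have e1 : ‖fa (T (b g)) z‖ ^ 2 ≤ ‖g‖ ^ 2 / (1 - ‖φ z‖ ^ 2) := by
          rw [hT _ z hzn, ← hb1 g]; exact fa_bound _ hφ1 _
        rw [min_eq_left (by linarith)] at hpl
        have hl2 := hlow |θ| hab0 (by linarith)
        set v := c * |θ| ^ α / 16 with hv
        have hθα : 0 < |θ| ^ α := by positivity
        have hθα1 : |θ| ^ α ≤ 1 := Real.rpow_le_one hab0.le (by linarith) hα0.le
        have hv0 : 0 < v := by positivity
        have hv1 : v ≤ 1 := by rw [hv]; nlinarith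
        have hvu : v ≤ poisson U r θ := by rw [hv]; linarith
        have e2 : v / 2 ≤ 1 - ‖φ z‖ ^ 2 := by
          have a1 := one_sub_exp_lower (2 * v) (by linarith) (by linarith)
          have a2 : ‖φ z‖ ^ 2 ≤ Real.exp (-(2 * v)) := by
            rw [hφn, ← Real.exp_nat_mul]; apply Real.exp_le_exp.2; push_cast; linarith
          linarith
        have e3 : 1 ≤ t ^ β * |θ| ^ (-β) := by
          rw [Real.rpow_neg hab0.le, ← div_eq_mul_inv, one_le_div (by positivity)]
          exact Real.rpow_le_rpow hab0.le hcase.le hβ0.le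
        have e4 : |θ| ^ (-γ) = |θ| ^ (-β) * (|θ| ^ α)⁻¹ := by
          rw [← Real.rpow_neg hab0.le, ← Real.rpow_add hab0]; congr 1; rw [hγ]; ring
        have : ‖g‖ ^ 2 / (1 - ‖φ z‖ ^ 2) ≤ (32 / c * t ^ β * ‖g‖ ^ 2) * |θ| ^ (-γ) := by
          calc ‖g‖ ^ 2 / (1 - ‖φ z‖ ^ 2) ≤ ‖g‖ ^ 2 / (v / 2) := by gcongr
            _ = (32 / c * ‖g‖ ^ 2 * (|θ| ^ α)⁻¹) * 1 := by rw [hv]; field_simp; ring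
            _ ≤ (32 / c * ‖g‖ ^ 2 * (|θ| ^ α)⁻¹) * (t ^ β * |θ| ^ (-β)) := by gcongr
            _ = _ := by rw [e4]; ring
        have : 0 ≤ (ρ ^ m) ^ 2 * ‖fa (T g) z‖ ^ 2 := by positivity
        linarith
    have hc1 := fa_circle_continuous (T (b g)) r hr0 hr
    have hc2 := fa_circle_continuous (T g) r hr0 hr
    have i1 : ∫ θ in (-Real.pi)..Real.pi, ‖fa (T (b g)) (r * Complex.exp (θ * I))‖ ^ 2 ≤
        ∫ θ in (-Real.pi)..Real.pi, ((ρ ^ m) ^ 2 * ‖fa (T g) (r * Complex.exp (θ * I))‖ ^ 2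
          + (32 / c * t ^ β * ‖g‖ ^ 2) * |θ| ^ (-γ)) := by
      refine intervalIntegral.integral_mono_ae_restrict (by linarith)
        ((hc1.norm.pow 2).intervalIntegrable _ _)
        ((((hc2.norm.pow 2).const_mul _).intervalIntegrable _ _).add (hint.const_mul _)) ?_
      have hne : ∀ᵐ θ : ℝ ∂(volume.restrict (Set.Icc (-Real.pi) Real.pi)), θ ≠ 0 :=
        ae_restrict_of_ae (by simp [ae_iff])
      filter_upwards [hne, ae_restrict_mem measurableSet_Icc] with θ h1 h2
      exact hpt θ h2 h1
    have hc3 : Continuous (fun θ : ℝ => (ρ ^ m) ^ 2 * ‖fa (T g) (r * Complex.exp (θ * I))‖ ^ 2) :=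
      (hc2.norm.pow 2).const_mul _
    rw [intervalIntegral.integral_add (hc3.intervalIntegrable _ _)
      (hint.const_mul _), intervalIntegral.integral_const_mul,
      intervalIntegral.integral_const_mul, ← hK0] at i1
    have i2 := circle_le_norm (T g) r hr0 hr
    refine i1.trans ?_
    have e5 : (ρ ^ m) ^ 2 * (∫ θ in (-Real.pi)..Real.pi, ‖fa (T g) (r * Complex.exp (θ * I))‖ ^ 2)
      ≤ (ρ ^ m) ^ 2 * (2 * Real.pi * ‖T g‖ ^ 2) := by gcongr
    have e6 : 32 / c * t ^ β * ‖g‖ ^ 2 * K0 = K1 * t ^ β * ‖g‖ ^ 2 := by rw [hK1]; ring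
    rw [e6]
    have e7 : 0 ≤ K1 * t ^ β * ‖g‖ ^ 2 := by positivity
    nlinarith
  have hTg : ‖T g‖ ≤ ‖T‖ * ‖g‖ := T.le_opNorm g
  have e8 : t ^ β = (t ^ (β / 2)) ^ 2 := by
    rw [← Real.rpow_natCast, ← Real.rpow_mul ht0.le]; congr 1; push_cast; ring
  have htp2 : 0 < t ^ (β / 2) := by positivity
  apply (sq_le_sq₀ (norm_nonneg _) (by positivity)).1
  calc ‖T (b g)‖ ^ 2 ≤ (ρ ^ m) ^ 2 * ‖T g‖ ^ 2 + K1 * t ^ β * ‖g‖ ^ 2 := key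
    _ ≤ (ρ ^ m) ^ 2 * (‖T‖ * ‖g‖) ^ 2 + (√K1 * t ^ (β / 2)) ^ 2 * ‖g‖ ^ 2 := by
      rw [mul_pow (√K1), Real.sq_sqrt hK1n, ← e8]; gcongr
    _ ≤ _ := by
      have : 0 ≤ ρ ^ m * ‖T‖ * (√K1 * t ^ (β / 2)) * ‖g‖ ^ 2 := by positivity
      nlinarith

end GoodU

namespace GoodU
variable {α : ℝ} {U : ℝ → ℝ}

lemma omega_eq (h : GoodU α U) (ω : ℝ → ℝ) (hω_top : Tendsto ω atTop atTop)
    (x₂ : ℝ) (hωeq : ∀ x : ℝ, x₂ ≤ x → etaU U (x / ω x) = ω x) :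
    ∀ᶠ x : ℝ in atTop, U (Real.exp (-(x / ω x))) = Real.exp (-ω x) := by
  filter_upwards [eventually_ge_atTop x₂, eventually_gt_atTop 0, hω_top.eventually_gt_atTop 0]
    with x h1 h2 h3
  have e := hωeq x h1
  unfold etaU at e
  have hlt : Real.exp (-(x / ω x)) < 1 := Real.exp_lt_one_iff.2 (by have := div_pos h2 h3; linarith)
  have hp := h.pos _ (Real.exp_pos (-(x / ω x))) (by linarith [Real.pi_gt_three])
  have e' : Real.log (U (Real.exp (-(x / ω x)))) = -ω x := by linarith
  rw [← e', Real.exp_log hp]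

lemma omega_div (h : GoodU α U) (ω : ℝ → ℝ) (hω_top : Tendsto ω atTop atTop)
    (x₂ : ℝ) (hωeq : ∀ x : ℝ, x₂ ≤ x → etaU U (x / ω x) = ω x) :
    Tendsto (fun x => x / ω x) atTop atTop := by
  have hpi := Real.pi_gt_three
  rw [tendsto_atTop]
  intro A
  set B := max A 0
  have hB1 : Real.exp (-B) ≤ 1 := Real.exp_le_one_iff.2 (by simp [B])
  have hpB := h.pos _ (Real.exp_pos (-B)) (by linarith)
  filter_upwards [h.omega_eq ω hω_top x₂ hωeq, eventually_gt_atTop 0, hω_top.eventually_gt_atTop 0,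
    hω_top.eventually_gt_atTop (-Real.log (U (Real.exp (-B))))] with x h1 h2 h3 h4
  by_contra hh
  push Not at hh
  have hlt : x / ω x < B := hh.trans_le (le_max_left _ _)
  have hm := h.mono' (Real.exp_pos (-B)).le (Real.exp_le_exp.2 (neg_le_neg hlt.le))
    (by have := Real.exp_lt_one_iff.2 (show -(x / ω x) < 0 by have := div_pos h2 h3; linarith)
        linarith)
  rw [h1] at hm
  have := Real.exp_lt_exp.2 (show -ω x < Real.log (U (Real.exp (-B))) by linarith)
  rw [Real.exp_log hpB] at this
  linarith

lemma part_one (h : GoodU α U) (ω : ℝ → ℝ) (hω_top : Tendsto ω atTop atTop)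
    (x₂ : ℝ) (hωeq : ∀ x : ℝ, x₂ ≤ x → etaU U (x / ω x) = ω x) (F : ℂ → ℂ)
    (hFre : ∀ r θ : ℝ, 0 ≤ r → r < 1 →
      (F ((r : ℂ) * Complex.exp (θ * Complex.I))).re = poisson U r θ)
    (hFi : ∀ r θ : ℝ, 0 ≤ r → r < 1 →
      (F ((r : ℂ) * Complex.exp (θ * Complex.I))).im = conjU U r θ)
    (φ : ℂ → ℂ) (hφ : ∀ z, φ z = Complex.exp (-F z))
    (T : H2 →L[ℂ] H2)
    (hT : ∀ (a : H2) (z : ℂ), ‖z‖ < 1 → fa (T a) z = fa a (φ z)) :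
    ∃ κ C : ℝ, 0 < κ ∧ 0 < C ∧ ∃ N : ℕ, ∀ n : ℕ, N ≤ n →
      approxNum T n ≤ C * Real.exp (-κ * n / ω n) := by
  obtain ⟨ρ, K, β, hρ0, hρ1, hK, hβ, hmain⟩ := h.part_one_aux F hFre hFi φ hφ T hT
  have hlog : Real.log ρ < 0 := Real.log_neg hρ0 hρ1
  set κ := min (-Real.log ρ / 4) β with hκ
  refine ⟨κ, ρ⁻¹ * ‖T‖ + K + 1, lt_min (by linarith) hβ, by positivity, ?_⟩
  have hev : ∀ᶠ x : ℝ in atTop, U (Real.exp (-(x / ω x))) = Real.exp (-ω x) ∧ 6 ≤ ω x ∧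
      Real.log 2 ≤ x / ω x ∧ 4 ≤ x := by
    filter_upwards [h.omega_eq ω hω_top x₂ hωeq, hω_top.eventually_ge_atTop 6,
      (h.omega_div ω hω_top x₂ hωeq).eventually_ge_atTop (Real.log 2), eventually_ge_atTop 4]
      with x h1 h2 h3 h4
    exact ⟨h1, h2, h3, h4⟩
  obtain ⟨N, hN⟩ := eventually_atTop.1 (tendsto_natCast_atTop_atTop.eventually hev)
  refine ⟨N, fun n hn => ?_⟩
  obtain ⟨h1, h2, h3, h4⟩ := hN n hn
  set W := ω n
  set x : ℝ := n / W with hx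
  have hW : 0 < W := by linarith
  have hx0 : 0 < x := by have := Real.log_pos one_lt_two; linarith
  have hnx : (n : ℝ) = x * W := by rw [hx]; field_simp
  set m := ⌊x / 4⌋₊ with hm
  set J := ⌈2 * W⌉₊ with hJ
  have hJ1 : 2 * W ≤ J := Nat.le_ceil _
  have hJ2 : (J : ℝ) < 2 * W + 1 := Nat.ceil_lt_add_one (by linarith)
  have hm1 : (m : ℝ) ≤ x / 4 := Nat.floor_le (by positivity)
  have hm2 : x / 4 < m + 1 := Nat.lt_floor_add_one _
  have hmain' := hmain n m J (Real.exp (-x)) ?_ (Real.exp_pos _) ?_ ?_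
  · refine hmain'.trans ?_
    have e1 : ρ ^ m ≤ ρ⁻¹ * Real.exp (-κ * x) := by
      rw [← Real.rpow_natCast, Real.rpow_def_of_pos hρ0]
      nth_rewrite 2 [← Real.exp_log hρ0]
      rw [← Real.exp_neg, ← Real.exp_add]
      apply Real.exp_le_exp.2
      have : κ ≤ -Real.log ρ / 4 := min_le_left _ _
      nlinarith
    have e2 : Real.exp (-x) ^ β ≤ Real.exp (-κ * x) := by
      rw [← Real.exp_mul]
      apply Real.exp_le_exp.2
      have : κ ≤ β := min_le_right _ _
      nlinarith
    have e3 : -κ * n / W = -κ * x := by rw [hx]; ring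
    rw [e3]
    have hE := Real.exp_pos (-κ * x)
    calc ρ ^ m * ‖T‖ + K * Real.exp (-x) ^ β
        ≤ (ρ⁻¹ * Real.exp (-κ * x)) * ‖T‖ + K * Real.exp (-κ * x) := by gcongr
      _ ≤ _ := by nlinarith
  · have : (m * (J + 2) : ℝ) ≤ n - 1 := by
      calc (m * (J + 2) : ℝ) ≤ x / 4 * (2 * W + 3) := 
            mul_le_mul hm1 (by linarith) (by positivity) (by positivity)
        _ ≤ n - 1 := by nlinarith
    have h5 : ((m * (J + 2) + 1 : ℕ) : ℝ) ≤ n := by push_cast; linarith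
    have h6 : m * (J + 2) + 1 ≤ n := by exact_mod_cast h5
    omega
  · calc Real.exp (-x) ≤ Real.exp (-Real.log 2) := Real.exp_le_exp.2 (by linarith)
      _ = 1 / 2 := by rw [Real.exp_neg, Real.exp_log (by norm_num)]; norm_num
  · rw [h1]
    have hl2 := Real.log_two_gt_d9
    have e1 : (1 / 2 : ℝ) ^ (J + 1) = Real.exp (-((J + 1) * Real.log 2)) := by
      rw [Real.exp_neg, mul_comm, Real.exp_mul, Real.exp_log (by norm_num)]
      rw [show (J : ℝ) + 1 = ((J + 1 : ℕ) : ℝ) by push_cast; rfl, Real.rpow_natCast, one_div, inv_pow]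
    have e2 : Real.exp (-W) / 16 = Real.exp (-W - 4 * Real.log 2) := by
      rw [Real.exp_sub, show 4 * Real.log 2 = Real.log 2 * (4 : ℕ) by push_cast; ring]
      rw [Real.exp_mul, Real.exp_log (by norm_num)]
      norm_num
    rw [e1, e2]
    apply Real.exp_lt_exp.2
    nlinarith

end GoodU

lemma hasSum_odd_sq : HasSum (fun m : ℕ => 1 / (2 * (m : ℝ) + 1) ^ 2) (Real.pi ^ 2 / 8) := by
  have h := hasSum_zeta_two
  have hs := h.summable
  have he : HasSum (fun k : ℕ => 1 / ((2 * k : ℕ) : ℝ) ^ 2) (1 / 4 * (Real.pi ^ 2 / 6)) := by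
    refine (h.mul_left (1 / 4)).congr_fun ?_
    intro k; push_cast; rw [mul_pow]; ring
  have hinj : Function.Injective (fun k : ℕ => 2 * k + 1) := fun a b hab => by
    simp only at hab; omega
  have ho : Summable (fun k : ℕ => 1 / ((2 * k + 1 : ℕ) : ℝ) ^ 2) := hs.comp_injective hinj
  have := (HasSum.even_add_odd (f := fun n : ℕ => 1 / (n : ℝ) ^ 2) he ho.hasSum).unique h
  have e : ∑' k : ℕ, 1 / ((2 * k + 1 : ℕ) : ℝ) ^ 2 = Real.pi ^ 2 / 8 := by linarith
  have h2 := ho.hasSum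
  rw [e] at h2
  refine h2.congr_fun ?_
  intro k; push_cast; rfl

def dd (i j : ℕ) : ℕ := (i - j) + (j - i)

lemma half_sum (x : ℝ) (hx0 : 0 ≤ x) (hx1 : x < 1) (s : Finset ℕ) (d : ℕ → ℕ)
    (hd : Set.InjOn d s) : ∑ i ∈ s, x ^ (d i + 1) ≤ x / (1 - x) := by
  have hg : HasSum (fun k : ℕ => x ^ (k + 1)) (x / (1 - x)) := by
    refine ((hasSum_geometric_of_lt_one hx0 hx1).mul_left x).congr_fun ?_
    intro k; ring
  rw [← Finset.sum_image (f := fun k => x ^ (k + 1)) hd]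
  exact sum_le_hasSum _ (fun i _ => by positivity) hg

lemma dist_sum (x : ℝ) (hx0 : 0 ≤ x) (hx1 : x < 1) (n : ℕ) (j : Fin n) :
    ∑ i ∈ Finset.univ.erase j, x ^ (dd i j) ≤ 2 * (x / (1 - x)) := by
  have e : ∑ i ∈ Finset.univ.erase j, x ^ (dd i j)
      = ∑ i ∈ (Finset.range n).erase (j : ℕ), x ^ (dd i j) := by
    refine Finset.sum_bij (fun i _ => (i : ℕ)) ?_ ?_ ?_ ?_
    · intro a ha; simp only [Finset.mem_erase, Finset.mem_range] at *
      exact ⟨fun h => ha.1 (Fin.ext h), a.2⟩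
    · intro a _ b _ h; exact Fin.ext h
    · intro b hb; simp only [Finset.mem_erase, Finset.mem_range] at hb
      refine ⟨⟨b, hb.2⟩, ?_, rfl⟩
      simp only [Finset.mem_erase, Finset.mem_univ, and_true]
      intro h; exact hb.1 (by rw [← h])
    · intro a _; rfl
  rw [e, ← Finset.sum_filter_add_sum_filter_not _ (fun i => i < (j : ℕ))]
  have a1 : ∑ i ∈ ((Finset.range n).erase (j : ℕ)).filter (fun i => i < (j : ℕ)), x ^ (dd i j)
      ≤ x / (1 - x) := by
    refine le_trans (le_of_eq ?_) (half_sum x hx0 hx1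
      (((Finset.range n).erase (j : ℕ)).filter (fun i => i < (j : ℕ))) (fun i => j - i - 1) ?_)
    · apply Finset.sum_congr rfl
      intro i hi
      simp only [Finset.mem_filter, Finset.mem_erase] at hi
      congr 1; simp only [dd]; omega
    · intro a ha b hb hab
      simp only [Finset.coe_filter, Set.mem_ofPred_eq, Finset.mem_erase] at ha hb hab
      omega
  have a2 : ∑ i ∈ ((Finset.range n).erase (j : ℕ)).filter (fun i => ¬ i < (j : ℕ)), x ^ (dd i j)
      ≤ x / (1 - x) := by
    refine le_trans (le_of_eq ?_) (half_sum x hx0 hx1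
      (((Finset.range n).erase (j : ℕ)).filter (fun i => ¬ i < (j : ℕ))) (fun i => i - j - 1) ?_)
    · apply Finset.sum_congr rfl
      intro i hi
      simp only [Finset.mem_filter, Finset.mem_erase] at hi
      congr 1; simp only [dd]; omega
    · intro a ha b hb hab
      simp only [Finset.coe_filter, Set.mem_ofPred_eq, Finset.mem_erase] at ha hb hab
      omega
  linarith

lemma log_sum (δ : ℝ) (hδ : 0 < δ) (n : ℕ) (j : Fin n) :
    ∑ i ∈ Finset.univ.erase j, (Real.log (1 + Real.exp (-δ) ^ (dd i j))
      - Real.log (1 - Real.exp (-δ) ^ (dd i j))) ≤ Real.pi ^ 2 / (2 * δ) := by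
  set q := Real.exp (-δ) with hq
  have hq0 : 0 < q := Real.exp_pos _
  have hq1 : q < 1 := Real.exp_lt_one_iff.2 (by linarith)
  have h1 : HasSum (fun m : ℕ => ∑ i ∈ Finset.univ.erase j,
      2 * (1 / (2 * (m : ℝ) + 1)) * (q ^ (dd i j)) ^ (2 * m + 1))
      (∑ i ∈ Finset.univ.erase j, (Real.log (1 + q ^ (dd i j)) - Real.log (1 - q ^ (dd i j)))) := by
    apply hasSum_sum
    intro i hi
    apply Real.hasSum_log_sub_log_of_abs_lt_one
    rw [abs_of_nonneg (by positivity)]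
    apply pow_lt_one₀ hq0.le hq1
    have := Finset.ne_of_mem_erase hi
    have h2 : (i : ℕ) ≠ j := fun h => this (Fin.ext h)
    simp only [dd]; omega
  have h2 := hasSum_odd_sq.mul_left (4 / δ)
  rw [show 4 / δ * (Real.pi ^ 2 / 8) = Real.pi ^ 2 / (2 * δ) by field_simp; norm_num] at h2
  refine hasSum_le ?_ h1 h2
  intro m
  set a : ℝ := 2 * (m : ℝ) + 1 with ha
  have ha0 : 0 < a := by positivity
  set x := q ^ (2 * m + 1) with hx
  have hx0 : 0 < x := by positivity
  have hx1 : x < 1 := pow_lt_one₀ hq0.le hq1 (by omega)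
  have e : ∑ i ∈ Finset.univ.erase j, 2 * (1 / a) * (q ^ (dd i j)) ^ (2 * m + 1)
      = 2 * (1 / a) * ∑ i ∈ Finset.univ.erase j, x ^ (dd i j) := by
    rw [Finset.mul_sum]
    apply Finset.sum_congr rfl
    intro i _
    rw [hx, ← pow_mul, ← pow_mul, mul_comm (dd i j)]
  rw [e]
  have h3 := dist_sum x hx0.le hx1 n j
  have h4 : x / (1 - x) ≤ 1 / (δ * a) := by
    rw [div_le_div_iff₀ (by linarith) (by positivity)]
    have ex : x = Real.exp (-(δ * a)) := by
      rw [hx, hq, ← Real.exp_nat_mul]; congr 1; rw [ha]; push_cast; ring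
    have h5 := Real.add_one_le_exp (δ * a)
    have h6 : x * Real.exp (δ * a) = 1 := by rw [ex, ← Real.exp_add]; simp
    nlinarith
  calc 2 * (1 / a) * ∑ i ∈ Finset.univ.erase j, x ^ (dd i j)
      ≤ 2 * (1 / a) * (2 * (1 / (δ * a))) := by
        gcongr; linarith
    _ = _ := by field_simp; norm_num

lemma prod_lower (δ p0 : ℝ) (hδ : 0 < δ) (hp0 : 0 < p0) (n : ℕ) (w : Fin n → ℝ)
    (hw : ∀ i : Fin n, w i = (1 - p0 * Real.exp (-δ) ^ (i : ℕ)) / (1 + p0 * Real.exp (-δ) ^ (i : ℕ)))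
    (j : Fin n) :
    Real.exp (-(Real.pi ^ 2 / (2 * δ))) ≤
      ∏ i ∈ Finset.univ.erase j, |(w j - w i) / (1 - w i * w j)| := by
  set q := Real.exp (-δ) with hq
  have hq0 : 0 < q := Real.exp_pos _
  have hq1 : q < 1 := Real.exp_lt_one_iff.2 (by linarith)
  have key : ∀ i ∈ Finset.univ.erase j, |(w j - w i) / (1 - w i * w j)|
      = Real.exp (-(Real.log (1 + q ^ (dd i j)) - Real.log (1 - q ^ (dd i j)))) := by
    intro i hi
    have hne := Finset.ne_of_mem_erase hi
    have h2 : (i : ℕ) ≠ j := fun h => hne (Fin.ext h)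
    have hd : dd i j ≠ 0 := by simp only [dd]; omega
    have hx1 : q ^ (dd i j) < 1 := pow_lt_one₀ hq0.le hq1 hd
    have hx0 : 0 < q ^ (dd i j) := by positivity
    have e1 : (w j - w i) / (1 - w i * w j)
        = (q ^ (i : ℕ) - q ^ (j : ℕ)) / (q ^ (i : ℕ) + q ^ (j : ℕ)) := by
      rw [hw i, hw j]
      have hi0 : 0 < q ^ (i : ℕ) := by positivity
      have hj0 : 0 < q ^ (j : ℕ) := by positivity
      generalize q ^ (i : ℕ) = a at *
      generalize q ^ (j : ℕ) = b at *
      have n1 : 1 + p0 * a ≠ 0 := by positivity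
      have n2 : 1 + p0 * b ≠ 0 := by positivity
      have n3 : a + b ≠ 0 := by positivity
      have e2 : (1 - p0 * b) / (1 + p0 * b) - (1 - p0 * a) / (1 + p0 * a)
        = 2 * p0 * (a - b) / ((1 + p0 * a) * (1 + p0 * b)) := by field_simp; ring
      have e3 : 1 - (1 - p0 * a) / (1 + p0 * a) * ((1 - p0 * b) / (1 + p0 * b))
        = 2 * p0 * (a + b) / ((1 + p0 * a) * (1 + p0 * b)) := by field_simp; ring
      rw [e2, e3]; field_simp
    have e4 : Real.exp (-(Real.log (1 + q ^ (dd i j)) - Real.log (1 - q ^ (dd i j))))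
        = (1 - q ^ (dd i j)) / (1 + q ^ (dd i j)) := by
      rw [neg_sub, Real.exp_sub, Real.exp_log (by linarith), Real.exp_log (by linarith)]
    rw [e1, e4]
    rcases lt_or_gt_of_ne h2 with hlt | hgt
    · have ed : dd i j = j - i := by simp only [dd]; omega
      have ej : q ^ (j : ℕ) = q ^ (i : ℕ) * q ^ (dd i j) := by
        rw [← pow_add, ed]; congr 1; omega
      rw [ej]
      have hi0 : 0 < q ^ (i : ℕ) := by positivity
      have : (q ^ (i : ℕ) - q ^ (i : ℕ) * q ^ (dd i j)) / (q ^ (i : ℕ) + q ^ (i : ℕ) * q ^ (dd i j))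
        = (1 - q ^ (dd i j)) / (1 + q ^ (dd i j)) := by field_simp
      rw [this, abs_of_pos (div_pos (by linarith) (by linarith))]
    · have ed : dd i j = i - j := by simp only [dd]; omega
      have ej : q ^ (i : ℕ) = q ^ (j : ℕ) * q ^ (dd i j) := by
        rw [← pow_add, ed]; congr 1; omega
      rw [ej]
      have hi0 : 0 < q ^ (j : ℕ) := by positivity
      have : (q ^ (j : ℕ) * q ^ (dd i j) - q ^ (j : ℕ)) / (q ^ (j : ℕ) * q ^ (dd i j) + q ^ (j : ℕ))
        = -((1 - q ^ (dd i j)) / (1 + q ^ (dd i j))) := by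
          have : 1 + q ^ (dd i j) ≠ 0 := by positivity
          have : q ^ (dd i j) + 1 ≠ 0 := by positivity
          field_simp; ring
      rw [this, abs_neg, abs_of_pos (div_pos (by linarith) (by linarith))]
  rw [Finset.prod_congr rfl key, ← Real.exp_sum]
  apply Real.exp_le_exp.2
  rw [Finset.sum_neg_distrib]
  have := log_sum δ hδ n j
  linarith

namespace GoodU
variable {α : ℝ} {U : ℝ → ℝ}

lemma part_two_aux (h : GoodU α U) (F : ℂ → ℂ) (hF : DifferentiableOn ℂ F (Metric.ball 0 1))
    (hFre : ∀ r θ : ℝ, 0 ≤ r → r < 1 →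
      (F ((r : ℂ) * Complex.exp (θ * Complex.I))).re = poisson U r θ)
    (hFi : ∀ r θ : ℝ, 0 ≤ r → r < 1 →
      (F ((r : ℂ) * Complex.exp (θ * Complex.I))).im = conjU U r θ)
    (φ : ℂ → ℂ) (hφ : ∀ z, φ z = Complex.exp (-F z))
    (T : H2 →L[ℂ] H2)
    (hT : ∀ (a : H2) (z : ℂ), ‖z‖ < 1 → fa (T a) z = fa a (φ z)) :
    ∃ A > 0, ∀ (n : ℕ) (t δ : ℝ), 1 ≤ n → 0 < t → t ≤ 1 / 2 → 0 < δ →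
      A * U t ≤ Real.exp (-(δ * n)) →
      Real.exp (-(Real.pi ^ 2 / (2 * δ))) * √t / n ≤ approxNum T n := by
  obtain ⟨C, hC, hCb⟩ := h.poisson_upper
  have hpi3 := Real.pi_gt_three
  have hφr : ∀ r : ℝ, 0 ≤ r → r < 1 → φ (r : ℂ) = (Real.exp (-poisson U r 0) : ℝ) := by
    intro r hr0 hr
    have h1 := hFre r 0 hr0 hr
    have h2 := hFi r 0 hr0 hr
    rw [h.conjU_zero r hr0 hr] at h2
    simp only [Complex.ofReal_zero, zero_mul, Complex.exp_zero, mul_one] at h1 h2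
    have e : F (r : ℂ) = (poisson U r 0 : ℝ) := Complex.ext (by simp [h1]) (by simp [h2])
    rw [hφ, e]; push_cast; rfl
  have hu0 : 0 < poisson U 0 0 := by
    have e : poisson U 0 0 = poisson U 0 1 := by simp [poisson]
    rw [e]
    have h1 := h.poisson_lower 0 1 le_rfl one_pos (by simp; linarith)
    have h2 := h.pos (min |1| (Real.pi / 2)) (lt_min (by simp) (by linarith))
      ((min_le_right _ _).trans (by linarith))
    linarith
  set f0 := Real.exp (-poisson U 0 0) with hf0
  have hf00 : 0 < f0 := Real.exp_pos _
  have hf01 : f0 < 1 := Real.exp_lt_one_iff.2 (by linarith)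
  set p0 := (1 - f0) / (1 + f0) with hp0
  have hp00 : 0 < p0 := div_pos (by linarith) (by linarith)
  have hp01 : p0 < 1 := by rw [hp0, div_lt_one (by linarith)]; linarith
  refine ⟨C / p0, by positivity, ?_⟩
  intro n t δ hn ht0 ht hδ hAt
  set q := Real.exp (-δ) with hq
  have hq0 : 0 < q := Real.exp_pos _
  have hq1 : q < 1 := Real.exp_lt_one_iff.2 (by linarith)
  set w : Fin n → ℝ := fun i => (1 - p0 * q ^ (i : ℕ)) / (1 + p0 * q ^ (i : ℕ)) with hw
  have hpi : ∀ i : Fin n, 0 < p0 * q ^ (i : ℕ) ∧ p0 * q ^ (i : ℕ) ≤ p0 := by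
    intro i
    exact ⟨by positivity, mul_le_of_le_one_right hp00.le (pow_le_one₀ hq0.le hq1.le)⟩
  set g : ℝ → ℝ := fun r => (φ (r : ℂ)).re with hg
  have hgr : ∀ r : ℝ, 0 ≤ r → r < 1 → g r = Real.exp (-poisson U r 0) := by
    intro r h1 h2; simp only [hg]; rw [hφr r h1 h2, Complex.ofReal_re]
  have hcont : ContinuousOn g (Set.Icc 0 (1 - t)) := by
    have hc : ContinuousOn (fun r : ℝ => F (r : ℂ)) (Set.Icc 0 (1 - t)) := by
      refine hF.continuousOn.comp Complex.continuous_ofReal.continuousOn ?_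
      intro r hr
      rw [mem_ball_zero_iff, Complex.norm_real, Real.norm_of_nonneg hr.1]
      linarith [hr.2]
    have : g = fun r : ℝ => (Complex.exp (-F (r : ℂ))).re := by
      funext r; simp only [hg, hφ]
    rw [this]
    exact Complex.continuous_re.comp_continuousOn (Complex.continuous_exp.comp_continuousOn hc.neg)
  have hsub := intermediate_value_Icc (by linarith : (0 : ℝ) ≤ 1 - t) hcont
  have hmem : ∀ i, w i ∈ Set.Icc (g 0) (g (1 - t)) := by
    intro i
    obtain ⟨k1, k2⟩ := hpi i
    constructor
    · rw [hgr 0 le_rfl one_pos, ← hf0]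
      have e : f0 = (1 - p0) / (1 + p0) := by rw [hp0]; field_simp; ring
      rw [e]
      simp only [hw]
      rw [div_le_div_iff₀ (by linarith) (by linarith)]
      nlinarith
    · rw [hgr (1 - t) (by linarith) (by linarith)]
      have h1 := hCb t ht0 ht
      have h2 := Real.add_one_le_exp (-poisson U (1 - t) 0)
      have h3 : q ^ n ≤ q ^ (i : ℕ) := pow_le_pow_of_le_one hq0.le hq1.le i.2.le
      have h4 : q ^ n = Real.exp (-(δ * n)) := by
        rw [hq, ← Real.exp_nat_mul]; congr 1; ring
      have h5 : C * U t ≤ p0 * q ^ (i : ℕ) := by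
        calc C * U t = p0 * (C / p0 * U t) := by field_simp
          _ ≤ p0 * q ^ (i : ℕ) := by
            apply mul_le_mul_of_nonneg_left _ hp00.le
            rw [← h4] at hAt; linarith
      have h6 : w i ≤ 1 - p0 * q ^ (i : ℕ) := by
        simp only [hw]
        exact div_le_self (by linarith) (by linarith)
      linarith
  choose z hz1 hz2 using fun i => hsub (hmem i)
  refine le_approxNum T n hn φ hT (fun i => (z i : ℂ)) w ?_ t ht0 ?_ ?_ ?_ ?_ _ ?_
  · intro i
    rw [Complex.norm_real, Real.norm_of_nonneg (hz1 i).1]; linarith [(hz1 i).2]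
  · intro i
    rw [Complex.norm_real, Real.norm_of_nonneg (hz1 i).1]
    nlinarith [(hz1 i).1, (hz1 i).2]
  · intro i
    obtain ⟨k1, k2⟩ := hpi i
    exact div_nonneg (by linarith) (by linarith)
  · intro i
    obtain ⟨k1, k2⟩ := hpi i
    simp only [hw]
    rw [div_lt_one (by linarith)]; linarith
  · intro i
    have hlt : z i < 1 := by linarith [(hz1 i).2]
    rw [← hz2 i, hgr _ (hz1 i).1 hlt, hφr _ (hz1 i).1 hlt]
  · exact prod_lower δ p0 hδ hp00 n w (fun i => rfl)

lemma part_two (h : GoodU α U) (ω : ℝ → ℝ) (hω_top : Tendsto ω atTop atTop)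
    (x₂ : ℝ) (hωeq : ∀ x : ℝ, x₂ ≤ x → etaU U (x / ω x) = ω x) (F : ℂ → ℂ)
    (hF : DifferentiableOn ℂ F (Metric.ball 0 1))
    (hFre : ∀ r θ : ℝ, 0 ≤ r → r < 1 →
      (F ((r : ℂ) * Complex.exp (θ * Complex.I))).re = poisson U r θ)
    (hFi : ∀ r θ : ℝ, 0 ≤ r → r < 1 →
      (F ((r : ℂ) * Complex.exp (θ * Complex.I))).im = conjU U r θ)
    (φ : ℂ → ℂ) (hφ : ∀ z, φ z = Complex.exp (-F z))
    (T : H2 →L[ℂ] H2)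
    (hT : ∀ (a : H2) (z : ℂ), ‖z‖ < 1 → fa (T a) z = fa a (φ z)) :
    ∀ ε : ℝ, 0 < ε → ∃ cε : ℝ, 0 < cε ∧ ∃ N : ℕ, ∀ n : ℕ, N ≤ n →
      cε * Real.exp (-((Real.pi ^ 2 + 1) / 2 + ε) * n / ω n) ≤ approxNum T n := by
  intro ε hε
  obtain ⟨A, hA, hmain⟩ := h.part_two_aux F hF hFre hFi φ hφ T hT
  obtain ⟨c, hc, hlow⟩ := h.lower
  have hpi := Real.pi_pos
  have hpi3 := Real.pi_gt_three
  have hα := h.a1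
  refine ⟨1, one_pos, ?_⟩
  set B := max (Real.log A) 0 with hB
  have hB0 : 0 ≤ B := le_max_right _ _
  have hxdiv := h.omega_div ω hω_top x₂ hωeq
  have hlit : ∀ᶠ x : ℝ in atTop, 2 * x ^ 2 ≤ Real.exp (ε / 2 * x) := by
    have := (isLittleO_pow_exp_pos_mul_atTop (k := 2) (b := ε / 2) (by positivity)).bound
      (c := 1 / 2) (by norm_num)
    filter_upwards [this] with x hx
    rw [Real.norm_of_nonneg (by positivity), Real.norm_of_nonneg (by positivity)] at hx
    linarith
  have hev : ∀ᶠ x : ℝ in atTop, U (Real.exp (-(x / ω x))) = Real.exp (-ω x) ∧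
      B + B * Real.pi ^ 2 / ε + 1 ≤ ω x ∧ Real.log 2 ≤ x / ω x ∧ -Real.log c ≤ x / ω x ∧ 1 ≤ x ∧
      2 * (x / ω x) ^ 2 ≤ Real.exp (ε / 2 * (x / ω x)) := by
    filter_upwards [h.omega_eq ω hω_top x₂ hωeq, hω_top.eventually_ge_atTop _,
      hxdiv.eventually_ge_atTop (Real.log 2), hxdiv.eventually_ge_atTop (-Real.log c),
      eventually_ge_atTop 1, hxdiv.eventually hlit]
      with x h1 h2 h3 h4 h5 h6
    exact ⟨h1, h2, h3, h4, h5, h6⟩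
  obtain ⟨N, hN⟩ := eventually_atTop.1 (tendsto_natCast_atTop_atTop.eventually hev)
  refine ⟨N, fun n hn => ?_⟩
  obtain ⟨h1, h2, h3, h4, h5, h6⟩ := hN n hn
  set W := ω n
  set x : ℝ := n / W with hx
  have hBp : 0 ≤ B * Real.pi ^ 2 / ε := by positivity
  have hW : 0 < W := by linarith
  have hWB : 0 < W - B := by linarith
  have hx0 : 0 < x := by have := Real.log_pos one_lt_two; linarith
  have hnx : (n : ℝ) = x * W := by rw [hx]; field_simp
  have hn0 : (0 : ℝ) < n := by linarith
  set t := Real.exp (-x) with ht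
  have ht0 : 0 < t := Real.exp_pos _
  have ht2 : t ≤ 1 / 2 := by
    calc Real.exp (-x) ≤ Real.exp (-Real.log 2) := Real.exp_le_exp.2 (by linarith)
      _ = 1 / 2 := by rw [Real.exp_neg, Real.exp_log (by norm_num)]; norm_num
  set δ := (W - B) / n with hδ
  have hδ0 : 0 < δ := by positivity
  have hm := hmain n t δ (by exact_mod_cast h5) ht0 ht2 hδ0 ?_
  · refine le_trans ?_ hm
    have e1 : √t = Real.exp (-x / 2) := by
      rw [ht, Real.exp_half]
    have e2 : Real.pi ^ 2 / (2 * δ) ≤ Real.pi ^ 2 / 2 * x + ε / 2 * x := by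
      have : Real.pi ^ 2 / (2 * δ) = Real.pi ^ 2 / 2 * x * (W / (W - B)) := by
        rw [hδ, hnx]; field_simp
      rw [this]
      have k : W / (W - B) ≤ 1 + ε / Real.pi ^ 2 := by
        rw [div_le_iff₀ hWB]
        have k1 : B * Real.pi ^ 2 / ε ≤ W - B := by linarith
        rw [div_le_iff₀ hε] at k1
        have k2 : B ≤ ε / Real.pi ^ 2 * (W - B) := by
          rw [div_mul_eq_mul_div, le_div_iff₀ (by positivity)]; linarith
        linarith
      calc Real.pi ^ 2 / 2 * x * (W / (W - B)) ≤ Real.pi ^ 2 / 2 * x * (1 + ε / Real.pi ^ 2) := by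
            gcongr
        _ = _ := by field_simp
    have e3 : W ≤ 2 * x := by
      have k := hlow t ht0 (by linarith)
      rw [h1] at k
      have k2 : c * t ^ α = Real.exp (Real.log c - x * α) := by
        rw [Real.exp_sub, Real.exp_log hc, ht, ← Real.exp_mul, neg_mul, Real.exp_neg]; rfl
      rw [k2] at k
      have := Real.exp_le_exp.1 k
      nlinarith
    have e4 : (n : ℝ) ≤ Real.exp (ε / 2 * x) := by
      refine le_trans ?_ h6
      rw [hnx]; nlinarith
    have e5 : Real.exp (-(ε / 2 * x)) ≤ 1 / n := by
      rw [Real.exp_neg, one_div]; exact inv_anti₀ hn0 e4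
    calc 1 * Real.exp (-((Real.pi ^ 2 + 1) / 2 + ε) * n / W)
        = Real.exp (-(Real.pi ^ 2 / 2 * x + ε / 2 * x)) * Real.exp (-x / 2)
            * Real.exp (-(ε / 2 * x)) := by
          rw [← Real.exp_add, ← Real.exp_add, one_mul]; congr 1; rw [hx]; ring
      _ ≤ Real.exp (-(Real.pi ^ 2 / (2 * δ))) * √t * (1 / n) := by
          rw [e1]; gcongr
      _ = _ := by ring
  · rw [h1]
    have : δ * n = W - B := by rw [hδ]; field_simp
    rw [this, neg_sub, Real.exp_sub, Real.exp_neg, div_eq_mul_inv]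
    have : A ≤ Real.exp B := by
      rw [← Real.log_le_iff_le_exp hA]; exact le_max_left _ _
    gcongr

end GoodU

theorem stmt7 (α : ℝ) (hα₀ : 0 < α) (hα₁ : α < 1)
    (U U' : ℝ → ℝ) (hU_mem : ClassU U)
    (hderiv : ∀ t ∈ Set.Ioc (0 : ℝ) (Real.pi / 2), HasDerivAt U (U' t) t)
    (hbound : ∀ t ∈ Set.Ioc (0 : ℝ) (Real.pi / 2), t * U' t ≤ α * U t)
    (ω : ℝ → ℝ) (hω_mono : Monotone ω) (hω_top : Tendsto ω atTop atTop)
    (x₂ : ℝ) (hωeq : ∀ x : ℝ, x₂ ≤ x → etaU U (x / ω x) = ω x)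
    (F : ℂ → ℂ) (hF : DifferentiableOn ℂ F (Metric.ball 0 1))
    (hFre : ∀ r θ : ℝ, 0 ≤ r → r < 1 →
      (F ((r : ℂ) * Complex.exp (θ * Complex.I))).re = poisson U r θ)
    (hFim : (F 0).im = 0)
    (φ : ℂ → ℂ) (hφ : ∀ z, φ z = Complex.exp (-F z))
    (T : H2 →L[ℂ] H2)
    (hT : ∀ (a : H2) (z : ℂ), ‖z‖ < 1 → fa (T a) z = fa a (φ z)) :
    (∃ κ C : ℝ, 0 < κ ∧ 0 < C ∧ ∃ N : ℕ, ∀ n : ℕ, N ≤ n →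
      approxNum T n ≤ C * Real.exp (-κ * n / ω n)) ∧
    (∀ ε : ℝ, 0 < ε → ∃ cε : ℝ, 0 < cε ∧ ∃ N : ℕ, ∀ n : ℕ, N ≤ n →
      cε * Real.exp (-((Real.pi ^ 2 + 1) / 2 + ε) * n / ω n) ≤ approxNum T n) := by
  have hG := goodU_of α hα₀ hα₁ U U' hU_mem hderiv hbound
  have hFi : ∀ r θ : ℝ, 0 ≤ r → r < 1 →
      (F ((r : ℂ) * Complex.exp (θ * Complex.I))).im = conjU U r θ := fun r θ hr0 hr =>
    F_im U hG.cont hG.per F hF hFre hFim r θ hr0 hr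
  exact ⟨hG.part_one ω hω_top x₂ hωeq F hFre hFi φ hφ T hT,
    hG.part_two ω hω_top x₂ hωeq F hF hFre hFi φ hφ T hT⟩

end
end

section
/- Let U ∈ 𝒰 be such that the restriction of U to (0,π] is twice continuously differentiable with U'(π) = 0, U(t)/t = o(log h_U(t)) as t → 0⁺, and there is C₀ > 0 with t·U'(t) ≤ C₀·U(t) and t²·|U''(t)| ≤ C₀·U(t) for all 0 < t ≤ π/2. Let u(re^{iθ}) = ((1 − r²)/(2π)) ∫_{−π}^{π} U(x)/(1 − 2r cos(θ − x) + r²) dx be the Poisson extension of U. Then there exist constants c, C > 0 and θ₀ > 0 such that for all 0 < θ ≤ θ₀ and all r with 1 − θ/4 ≤ r < 1: c·h_U(θ) ≤ −(∂u/∂r)(re^{iθ}) ≤ C·h_U(θ) and |(∂u/∂θ)(re^{iθ})| ≤ C·h_U(θ), where ∂u/∂r denotes the derivative of r ↦ u(re^{iθ}) and ∂u/∂θ the derivative of θ ↦ u(re^{iθ}). -/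
open MeasureTheory Filter Set

noncomputable section

def Dk (r φ : ℝ) : ℝ := 1 - 2 * r * Real.cos φ + r ^ 2
def Kk (r φ : ℝ) : ℝ := 2 * ((1 + r ^ 2) * Real.cos φ - 2 * r) / Dk r φ ^ 2
def Lk (r φ : ℝ) : ℝ := -((1 - r ^ 2) * (2 * r * Real.sin φ)) / Dk r φ ^ 2

lemma Dk_ge (r φ : ℝ) (h0 : 0 ≤ r) : (1 - r) ^ 2 ≤ Dk r φ := by
  unfold Dk
  nlinarith [Real.cos_le_one φ]

lemma Dk_pos (r φ : ℝ) (h0 : 0 ≤ r) (h1 : r < 1) : 0 < Dk r φ := by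
  have := Dk_ge r φ h0
  have : 0 < (1 - r) ^ 2 := by apply pow_pos; linarith
  linarith

lemma Dk_cont (r : ℝ) : Continuous (Dk r) := by unfold Dk; fun_prop

lemma Kk_cont (r : ℝ) (h0 : 0 ≤ r) (h1 : r < 1) : Continuous (Kk r) := by
  unfold Kk
  have := Dk_cont r
  exact Continuous.div (by fun_prop) (by fun_prop) (fun x => pow_ne_zero _ (Dk_pos r x h0 h1).ne')

lemma Lk_cont (r : ℝ) (h0 : 0 ≤ r) (h1 : r < 1) : Continuous (Lk r) := by
  unfold Lk
  have := Dk_cont r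
  exact Continuous.div (by fun_prop) (by fun_prop) (fun x => pow_ne_zero _ (Dk_pos r x h0 h1).ne')

lemma abs_div_Dk_le (r φ a c d : ℝ) (h0 : 0 ≤ r) (hd : 0 < d) (hdr : d ≤ 1 - r) (ha : |a| ≤ c) :
    |a / Dk r φ ^ 2| ≤ c / d ^ 4 := by
  have h1 : d ^ 2 ≤ Dk r φ := (by gcongr : d ^ 2 ≤ (1 - r) ^ 2).trans (Dk_ge r φ h0)
  have h2 : d ^ 4 ≤ Dk r φ ^ 2 := by
    calc d ^ 4 = (d ^ 2) ^ 2 := by ring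
      _ ≤ _ := by gcongr
  rw [abs_div, abs_of_nonneg (sq_nonneg (Dk r φ))]
  have hc : 0 ≤ c := (abs_nonneg a).trans ha
  gcongr

lemma Kk_bd (r φ d : ℝ) (h0 : 0 ≤ r) (hd : 0 < d) (hdr : d ≤ 1 - r) :
    |Kk r φ| ≤ 8 / d ^ 4 := by
  apply abs_div_Dk_le _ _ _ _ _ h0 hd hdr
  have h1 := Real.cos_le_one φ
  have h2 := Real.neg_one_le_cos φ
  rw [abs_le]; constructor <;> nlinarith

lemma Lk_bd (r φ d : ℝ) (h0 : 0 ≤ r) (hd : 0 < d) (hdr : d ≤ 1 - r) :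
    |Lk r φ| ≤ 2 / d ^ 4 := by
  apply abs_div_Dk_le _ _ _ _ _ h0 hd hdr
  have h3 : 0 ≤ (1 - r^2) := by nlinarith
  rw [abs_neg, abs_mul, abs_mul, abs_of_nonneg h3, abs_of_nonneg (by linarith : 0 ≤ 2 * r)]
  have h4 := Real.abs_sin_le_one φ
  calc (1 - r^2) * (2 * r * |Real.sin φ|) ≤ 1 * (2 * 1 * 1) := by
        gcongr
        · nlinarith
        · linarith
    _ = 2 := by norm_num

lemma P_deriv_r (r φ : ℝ) (h0 : 0 ≤ r) (h1 : r < 1) :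
    HasDerivAt (fun s => (1 - s ^ 2) / Dk s φ) (Kk r φ) r := by
  have hD := (Dk_pos r φ h0 h1).ne'
  have e1 : HasDerivAt (fun s : ℝ => 1 - s ^ 2) (-(2 * r)) r := by
    simpa using ((hasDerivAt_id r).pow 2).const_sub 1
  have e2 : HasDerivAt (fun s : ℝ => Dk s φ) (-(2 * Real.cos φ) + 2 * r) r := by
    unfold Dk
    have := ((((hasDerivAt_id r).const_mul 2).mul_const (Real.cos φ)).const_sub 1).add
      ((hasDerivAt_id r).pow 2)
    refine this.congr_deriv ?_
    simp
  refine (e1.div e2 hD).congr_deriv ?_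
  unfold Kk
  congr 1
  unfold Dk
  ring

lemma P_deriv_t (r φ : ℝ) (h0 : 0 ≤ r) (h1 : r < 1) :
    HasDerivAt (fun s => (1 - r ^ 2) / Dk r s) (Lk r φ) φ := by
  have hD := (Dk_pos r φ h0 h1).ne'
  have e2 : HasDerivAt (fun s : ℝ => Dk r s) (2 * r * Real.sin φ) φ := by
    unfold Dk
    have := ((((Real.hasDerivAt_cos φ).const_mul (2 * r))).const_sub 1).add_const (r ^ 2)
    refine this.congr_deriv ?_
    ring
  refine ((hasDerivAt_const φ (1 - r ^ 2)).div e2 hD).congr_deriv ?_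
  unfold Lk
  congr 1
  ring

lemma Q_deriv (r φ : ℝ) (h0 : 0 ≤ r) (h1 : r < 1) :
    HasDerivAt (fun s => 2 * Real.sin s / Dk r s) (Kk r φ) φ := by
  have hD := (Dk_pos r φ h0 h1).ne'
  have e2 : HasDerivAt (fun s : ℝ => Dk r s) (2 * r * Real.sin φ) φ := by
    unfold Dk
    have := ((((Real.hasDerivAt_cos φ).const_mul (2 * r))).const_sub 1).add_const (r ^ 2)
    refine this.congr_deriv ?_
    ring
  refine (((Real.hasDerivAt_sin φ).const_mul 2).div e2 hD).congr_deriv ?_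
  unfold Kk
  congr 1
  unfold Dk
  have := Real.sin_sq_add_cos_sq φ
  linear_combination (-4 * r) * this

lemma Kk_int (r : ℝ) (h0 : 0 ≤ r) (h1 : r < 1) : ∫ φ in (0:ℝ)..Real.pi, Kk r φ = 0 := by
  rw [intervalIntegral.integral_eq_sub_of_hasDerivAt (fun x _ => Q_deriv r x h0 h1)
    ((Kk_cont r h0 h1).intervalIntegrable _ _)]
  simp

lemma poisson_eq (U : ℝ → ℝ) (r θ : ℝ) : poisson U r θ =
    (1 / (2 * Real.pi)) * ∫ x in (-Real.pi)..Real.pi, U x * ((1 - r ^ 2) / Dk r (θ - x)) := by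
  unfold poisson
  rw [← intervalIntegral.integral_const_mul, ← intervalIntegral.integral_const_mul]
  congr 1; ext x; unfold Dk; ring

lemma poisson_int_cont (U : ℝ → ℝ) (hc : Continuous U) (r θ : ℝ) (h0 : 0 ≤ r) (h1 : r < 1) :
    Continuous (fun x => U x * ((1 - r ^ 2) / Dk r (θ - x))) := by
  have := Dk_cont r
  exact hc.mul (Continuous.div (by fun_prop) (by fun_prop) (fun x => (Dk_pos r _ h0 h1).ne'))

lemma poisson_dr (U : ℝ → ℝ) (hc : Continuous U) (r θ : ℝ) (h0 : 0 < r) (h1 : r < 1) :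
    deriv (fun s => poisson U s θ) r =
    (1 / (2 * Real.pi)) * ∫ x in (-Real.pi)..Real.pi, U x * Kk r (θ - x) := by
  apply HasDerivAt.deriv
  simp_rw [poisson_eq]
  apply HasDerivAt.const_mul
  have hs : Ioo 0 ((1 + r) / 2) ∈ nhds r := Ioo_mem_nhds h0 (by linarith)
  refine (intervalIntegral.hasDerivAt_integral_of_dominated_loc_of_deriv_le
    (F' := fun s x => U x * Kk s (θ - x))
    (bound := fun x => |U x| * (8 / ((1 - r) / 2) ^ 4)) hs ?_ ?_ ?_ ?_ ?_ ?_).2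
  · filter_upwards [hs] with s hs
    exact (poisson_int_cont U hc s θ hs.1.le (by linarith [hs.2])).aestronglyMeasurable
  · exact (poisson_int_cont U hc r θ h0.le h1).intervalIntegrable _ _
  · exact (hc.mul ((Kk_cont r h0.le h1).comp (by fun_prop))).aestronglyMeasurable
  · refine Eventually.of_forall fun x _ s hs => ?_
    rw [Real.norm_eq_abs, abs_mul]
    gcongr
    exact Kk_bd s _ _ hs.1.le (by linarith) (by linarith [hs.2])
  · exact (by fun_prop : Continuous fun x => |U x| * (8 / ((1 - r) / 2) ^ 4)).intervalIntegrable _ _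
  · refine Eventually.of_forall fun x _ s hs => ?_
    exact (P_deriv_r s (θ - x) hs.1.le (by linarith [hs.2])).const_mul _

lemma poisson_dt (U : ℝ → ℝ) (hc : Continuous U) (r θ : ℝ) (h0 : 0 < r) (h1 : r < 1) :
    deriv (fun s => poisson U r s) θ =
    (1 / (2 * Real.pi)) * ∫ x in (-Real.pi)..Real.pi, U x * Lk r (θ - x) := by
  apply HasDerivAt.deriv
  simp_rw [poisson_eq]
  apply HasDerivAt.const_mul
  refine (intervalIntegral.hasDerivAt_integral_of_dominated_loc_of_deriv_le
    (F' := fun s x => U x * Lk r (s - x))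
    (bound := fun x => |U x| * (2 / (1 - r) ^ 4)) univ_mem ?_ ?_ ?_ ?_ ?_ ?_).2
  · filter_upwards with s
    exact (poisson_int_cont U hc r s h0.le h1).aestronglyMeasurable
  · exact (poisson_int_cont U hc r θ h0.le h1).intervalIntegrable _ _
  · exact (hc.mul ((Lk_cont r h0.le h1).comp (by fun_prop))).aestronglyMeasurable
  · refine Eventually.of_forall fun x _ s hs => ?_
    rw [Real.norm_eq_abs, abs_mul]
    gcongr
    exact Lk_bd r _ _ h0.le (by linarith) le_rfl
  · exact (by fun_prop : Continuous fun x => |U x| * (2 / (1 - r) ^ 4)).intervalIntegrable _ _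
  · refine Eventually.of_forall fun x _ s hs => ?_
    exact ((P_deriv_t r (s - x) h0.le h1).comp_sub_const s x).const_mul _

lemma symm_int (U k : ℝ → ℝ) (hc : Continuous U) (hk : Continuous k)
    (hp : Function.Periodic U (2 * Real.pi)) (hkp : Function.Periodic k (2 * Real.pi)) (θ : ℝ) :
    ∫ x in (-Real.pi)..Real.pi, U x * k (θ - x) =
    ∫ φ in (0:ℝ)..Real.pi, (U (θ - φ) * k φ + U (θ + φ) * k (-φ)) := by
  have hfc : Continuous (fun y => U (θ - y) * k y) := by fun_prop
  have e1 : ∫ x in (-Real.pi)..Real.pi, U x * k (θ - x) =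
      ∫ y in (θ - Real.pi)..(θ + Real.pi), U (θ - y) * k y := by
    have := intervalIntegral.integral_comp_sub_left (a := -Real.pi) (b := Real.pi)
      (fun y => U (θ - y) * k y) θ
    simpa using this
  have hfp : Function.Periodic (fun y => U (θ - y) * k y) (2 * Real.pi) := by
    intro y
    simp only
    rw [hkp y, ← hp (θ - (y + 2 * Real.pi))]
    congr 2; ring
  have e2 := hfp.intervalIntegral_add_eq (θ - Real.pi) (-Real.pi)
  rw [show θ - Real.pi + 2 * Real.pi = θ + Real.pi by ring,
    show -Real.pi + 2 * Real.pi = Real.pi by ring] at e2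
  rw [e1, e2, ← intervalIntegral.integral_add_adjacent_intervals
    (hfc.intervalIntegrable (-Real.pi) 0) (hfc.intervalIntegrable 0 Real.pi)]
  have e3 : ∫ x in (-Real.pi)..0, U (θ - x) * k x = ∫ x in (0:ℝ)..Real.pi, U (θ + x) * k (-x) := by
    have := intervalIntegral.integral_comp_neg (a := 0) (b := Real.pi)
      (fun y => U (θ - y) * k y)
    simp only [sub_neg_eq_add, neg_zero] at this
    exact this.symm
  rw [e3, add_comm, ← intervalIntegral.integral_add (hfc.intervalIntegrable _ _)]
  exact (by fun_prop : Continuous fun x => U (θ + x) * k (-x)).intervalIntegrable _ _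

lemma dr_formula (U : ℝ → ℝ) (hc : Continuous U) (hp : Function.Periodic U (2 * Real.pi))
    (r θ : ℝ) (h0 : 0 < r) (h1 : r < 1) :
    -(deriv (fun s => poisson U s θ) r) = (1 / (2 * Real.pi)) *
      ∫ φ in (0:ℝ)..Real.pi, (U (θ + φ) + U (θ - φ) - 2 * U θ) * (-Kk r φ) := by
  have hK := Kk_cont r h0.le h1
  rw [poisson_dr U hc r θ h0 h1, symm_int U (Kk r) hc hK hp
    (fun x => by simp [Kk, Dk, Real.cos_add_two_pi]), ← mul_neg]
  congr 1
  have : ∫ φ in (0:ℝ)..Real.pi, (U (θ + φ) + U (θ - φ) - 2 * U θ) * (-Kk r φ) =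
     ∫ φ in (0:ℝ)..Real.pi, (2 * U θ * Kk r φ - (U (θ - φ) * Kk r φ + U (θ + φ) * Kk r (-φ))) := by
    congr 1; ext φ
    have : Kk r (-φ) = Kk r φ := by simp [Kk, Dk]
    rw [this]; ring
  rw [this, intervalIntegral.integral_sub, intervalIntegral.integral_const_mul, Kk_int r h0.le h1]
  · ring
  · exact (by fun_prop : Continuous fun φ => 2 * U θ * Kk r φ).intervalIntegrable _ _
  · exact (by fun_prop : Continuous fun φ => U (θ - φ) * Kk r φ + U (θ + φ) * Kk r (-φ)).intervalIntegrable _ _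

lemma dt_formula (U : ℝ → ℝ) (hc : Continuous U) (hp : Function.Periodic U (2 * Real.pi))
    (r θ : ℝ) (h0 : 0 < r) (h1 : r < 1) :
    deriv (fun s => poisson U r s) θ = (1 / (2 * Real.pi)) *
      ∫ φ in (0:ℝ)..Real.pi, (U (θ + φ) - U (θ - φ)) * (-Lk r φ) := by
  have hK := Lk_cont r h0.le h1
  rw [poisson_dt U hc r θ h0 h1, symm_int U (Lk r) hc hK hp
    (fun x => by simp [Lk, Dk, Real.cos_add_two_pi])]
  congr 2
  ext φ
  have : Lk r (-φ) = -Lk r φ := by simp [Lk, Dk, neg_div]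
  rw [this]; ring

lemma s_lower (φ : ℝ) (h0 : 0 ≤ φ) (h1 : φ ≤ Real.pi) : φ ^ 2 * (100 / 987) ≤ Real.sin (φ / 2) ^ 2 := by
  have hpi := Real.pi_pos
  have h := Real.mul_le_sin (x := φ / 2) (by linarith) (by linarith)
  have e : 2 / Real.pi * (φ / 2) = φ / Real.pi := by field_simp
  rw [e] at h
  have h2 : (φ / Real.pi) ^ 2 ≤ Real.sin (φ / 2) ^ 2 := by gcongr
  refine le_trans ?_ h2
  rw [div_pow, div_eq_mul_one_div (φ ^ 2)]
  have h3 := Real.pi_lt_d4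
  have h4 : Real.pi ^ 2 ≤ 987 / 100 := by nlinarith
  refine mul_le_mul_of_nonneg_left ?_ (sq_nonneg _)
  rw [div_le_div_iff₀ (by norm_num) (by positivity)]
  linarith

lemma s_upper (φ : ℝ) (h0 : 0 ≤ φ) (h1 : φ ≤ Real.pi) : Real.sin (φ / 2) ^ 2 ≤ φ ^ 2 / 4 := by
  have h := Real.sin_le (x := φ / 2) (by linarith)
  have h3 := Real.sin_nonneg_of_nonneg_of_le_pi (x := φ / 2) (by linarith) (by linarith [Real.pi_pos])
  nlinarith

lemma cos_s (φ : ℝ) : Real.cos φ = 1 - 2 * Real.sin (φ / 2) ^ 2 := by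
  have := Real.cos_two_mul (φ / 2)
  have h2 := Real.sin_sq_add_cos_sq (φ / 2)
  rw [show 2 * (φ / 2) = φ by ring] at this
  linarith

lemma Dk_lower (r φ : ℝ) (hr : 3 / 4 ≤ r) (h0 : 0 ≤ φ) (h1 : φ ≤ Real.pi) :
    (1 - r) ^ 2 + φ ^ 2 / 4 ≤ Dk r φ := by
  unfold Dk
  rw [cos_s]
  have := s_lower φ h0 h1
  nlinarith

lemma Kk_abs (r φ : ℝ) (hr : 3 / 4 ≤ r) (hr1 : r < 1) (h0 : 0 ≤ φ) (h1 : φ ≤ Real.pi) :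
    |Kk r φ| * φ ^ 2 ≤ 11 := by
  have hD := Dk_pos r φ (by linarith) hr1
  have hl := Dk_lower r φ hr h0 h1
  have hn : |2 * ((1 + r ^ 2) * Real.cos φ - 2 * r)| ≤ (8 / 3) * Dk r φ := by
    unfold Dk
    rw [cos_s, abs_le]
    have : 0 ≤ Real.sin (φ / 2) ^ 2 := sq_nonneg _
    have h6 : 0 ≤ 8 / 3 * r - 1 - r ^ 2 := by nlinarith
    constructor <;> nlinarith [sq_nonneg (1 - r), mul_nonneg this h6]
  unfold Kk
  rw [abs_div, abs_of_nonneg (sq_nonneg (Dk r φ)), div_mul_eq_mul_div, div_le_iff₀ (by positivity)]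
  have h3 : φ ^ 2 ≤ 4 * Dk r φ := by nlinarith [sq_nonneg (1 - r)]
  calc _ ≤ (8 / 3) * Dk r φ * (4 * Dk r φ) := by gcongr
    _ ≤ _ := by nlinarith [sq_nonneg (Dk r φ)]

lemma Kk_neg (r φ : ℝ) (hr : 3 / 4 ≤ r) (hr1 : r < 1) (h0 : 0 < φ) (h1 : φ ≤ Real.pi)
    (hd : 1 - r ≤ φ / 2) : 2 / 25 / φ ^ 2 ≤ -Kk r φ := by
  have hD := Dk_pos r φ (by linarith) hr1
  have hl := s_lower φ h0.le h1
  have hu := s_upper φ h0.le h1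
  have hd2 : (1 - r) ^ 2 ≤ φ ^ 2 / 4 := by nlinarith
  have hn : φ ^ 2 / 8 ≤ -(2 * ((1 + r ^ 2) * Real.cos φ - 2 * r)) := by
    rw [cos_s]
    have : 25 / 16 * (φ ^ 2 * (100 / 987)) ≤ (1 + r ^ 2) * Real.sin (φ / 2) ^ 2 := by
      gcongr
      nlinarith
    nlinarith [sq_nonneg φ]
  have hDu : Dk r φ ≤ 5 / 4 * φ ^ 2 := by
    unfold Dk; rw [cos_s]
    nlinarith [sq_nonneg (Real.sin (φ / 2))]
  unfold Kk
  rw [← neg_div, div_div, div_le_div_iff₀ (by positivity) (by positivity)]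
  calc 2 * Dk r φ ^ 2 ≤ 2 * (5 / 4 * φ ^ 2) ^ 2 := by gcongr
    _ = φ ^ 2 / 8 * (25 * φ ^ 2) := by ring
    _ ≤ _ := by gcongr

lemma Lk_neg (r φ : ℝ) (hr : 3 / 4 ≤ r) (hr1 : r < 1) (h0 : 0 ≤ φ) (h1 : φ ≤ Real.pi) :
    0 ≤ -Lk r φ := by
  unfold Lk
  rw [← neg_div, neg_neg]
  have := Real.sin_nonneg_of_nonneg_of_le_pi h0 h1
  have : 0 ≤ 1 - r ^ 2 := by nlinarith
  positivity

lemma Lk_up (r φ : ℝ) (hr : 3 / 4 ≤ r) (hr1 : r < 1) (h0 : 0 ≤ φ) (h1 : φ ≤ Real.pi) :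
    -Lk r φ ≤ 4 * ((1 - r) * φ) / Dk r φ ^ 2 := by
  unfold Lk
  rw [← neg_div, neg_neg]
  have := Real.sin_nonneg_of_nonneg_of_le_pi h0 h1
  have h3 : 0 ≤ 1 - r ^ 2 := by nlinarith
  have h4 := Real.sin_le h0
  refine div_le_div_of_nonneg_right ?_ (by positivity)
  calc (1 - r ^ 2) * (2 * r * Real.sin φ) ≤ (2 * (1 - r)) * (2 * 1 * φ) := by
        gcongr
        nlinarith
    _ = _ := by ring

lemma Lk_far (r φ : ℝ) (hr : 3 / 4 ≤ r) (hr1 : r < 1) (h0 : 0 < φ) (h1 : φ ≤ Real.pi) :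
    -Lk r φ ≤ 16 / φ ^ 2 := by
  refine (Lk_up r φ hr hr1 h0.le h1).trans ?_
  have hD := Dk_pos r φ (by linarith) hr1
  have hl := Dk_lower r φ hr h0.le h1
  rw [div_le_div_iff₀ (by positivity) (by positivity)]
  have h3 : φ ^ 2 ≤ 4 * Dk r φ := by nlinarith [sq_nonneg (1 - r)]
  have h4 : (1 - r) * φ ≤ Dk r φ := by nlinarith [sq_nonneg ((1 - r) - φ / 2)]
  calc _ ≤ 4 * Dk r φ * (4 * Dk r φ) := by gcongr
    _ = _ := by ring

lemma Lk_near (r φ : ℝ) (hr : 3 / 4 ≤ r) (hr1 : r < 1) (h0 : 0 ≤ φ) (h1 : φ ≤ Real.pi) :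
    φ * -Lk r φ ≤ 128 * ((1 - r) / (1 - r + φ) ^ 2) := by
  have hD := Dk_pos r φ (by linarith) hr1
  have hl := Dk_lower r φ hr h0 h1
  have hp : 0 < 1 - r + φ := by linarith
  have h3 : φ ^ 2 ≤ 4 * Dk r φ := by nlinarith [sq_nonneg (1 - r)]
  have h5 : (1 - r + φ) ^ 2 ≤ 8 * Dk r φ := by
    nlinarith [sq_nonneg ((1 - r) - φ / 2), sq_nonneg (1 - r), sq_nonneg φ]
  have h6 : 0 ≤ 1 - r := by linarith
  calc φ * -Lk r φ ≤ φ * (4 * ((1 - r) * φ) / Dk r φ ^ 2) := by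
        gcongr; exact Lk_up r φ hr hr1 h0 h1
    _ = 4 * (1 - r) * φ ^ 2 / Dk r φ ^ 2 := by ring
    _ ≤ _ := by
      rw [← mul_div_assoc, div_le_div_iff₀ (by positivity) (by positivity)]
      calc 4 * (1 - r) * φ ^ 2 * (1 - r + φ) ^ 2 ≤ 4 * (1 - r) * (4 * Dk r φ) * (8 * Dk r φ) := by
            gcongr
        _ = _ := by ring

lemma U_max (U : ℝ → ℝ) (he : ∀ t, U (-t) = U t) (hp : Function.Periodic U (2 * Real.pi))
    (hm : MonotoneOn U (Set.Icc 0 Real.pi)) (y : ℝ) : U 0 ≤ U y ∧ U y ≤ U Real.pi := by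
  obtain ⟨z, hz, hyz⟩ := hp.exists_mem_Ico (by positivity) y (-Real.pi)
  have hpi := Real.pi_pos
  have habs : U z = U |z| := by
    rcases abs_cases z with h | h <;> rw [h.1]
    exact (he z).symm
  have h1 : |z| ≤ Real.pi := abs_le.2 ⟨hz.1, by linarith [hz.2]⟩
  rw [hyz, habs]
  exact ⟨hm ⟨le_rfl, hpi.le⟩ ⟨abs_nonneg _, h1⟩ (abs_nonneg _),
    hm ⟨abs_nonneg _, h1⟩ ⟨hpi.le, le_rfl⟩ h1⟩

lemma U_le_min (U : ℝ → ℝ) (he : ∀ t, U (-t) = U t) (hp : Function.Periodic U (2 * Real.pi))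
    (hm : MonotoneOn U (Set.Icc 0 Real.pi)) (y a : ℝ) (hy : |y| ≤ a) :
    U y ≤ U (min a Real.pi) := by
  rcases le_total a Real.pi with h | h
  · rw [min_eq_left h]
    have habs : U y = U |y| := by
      rcases abs_cases y with h | h <;> rw [h.1]
      exact (he y).symm
    rw [habs]
    exact hm ⟨abs_nonneg _, hy.trans h⟩ ⟨(abs_nonneg _).trans hy, h⟩ hy
  · rw [min_eq_right h]
    exact (U_max U he hp hm y).2

lemma ii_div_sq (f : ℝ → ℝ) (hf : Continuous f) (a b : ℝ) (ha : 0 < a) (hb : 0 < b) :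
    IntervalIntegrable (fun x => f x / x ^ 2) volume a b := by
  apply ContinuousOn.intervalIntegrable
  apply ContinuousOn.div (by fun_prop) (by fun_prop)
  intro x hx
  have : 0 < x := lt_of_lt_of_le (lt_min ha hb) hx.1
  positivity

lemma inv_sq_int (a b : ℝ) (ha : 0 < a) (hb : a ≤ b) :
    ∫ x in a..b, 1 / x ^ 2 ≤ 1 / a := by
  have : ∫ x in a..b, 1 / x ^ 2 = (-(1 / b)) - (-(1 / a)) := by
    refine intervalIntegral.integral_eq_sub_of_hasDerivAt (f := fun x => -(1 / x)) ?_
      (ii_div_sq (fun _ => 1) (by fun_prop) a b ha (by linarith))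
    intro x hx
    rw [uIcc_of_le hb] at hx
    have hx0 : x ≠ 0 := by linarith [hx.1]
    have := (hasDerivAt_inv hx0).neg
    simp only [one_div]
    refine this.congr_deriv ?_
    ring
  rw [this]
  have : 0 < 1 / b := by have := ha.trans_le hb; positivity
  linarith

lemma hU_split (U : ℝ → ℝ) (hc : Continuous U) (a b : ℝ) (ha : 0 < a) (hb : 0 < b) :
    hU U a = (∫ x in a..b, U x / x ^ 2) + hU U b :=
  (intervalIntegral.integral_add_adjacent_intervals (ii_div_sq U hc _ _ ha hb)
    (ii_div_sq U hc _ _ hb Real.pi_pos)).symm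

lemma hU_anti (U : ℝ → ℝ) (hc : Continuous U) (h0 : ∀ y, 0 ≤ U y) (a b : ℝ) (ha : 0 < a)
    (hb : a ≤ b) : hU U b ≤ hU U a := by
  rw [hU_split U hc a b ha (by linarith)]
  have : 0 ≤ ∫ x in a..b, U x / x ^ 2 :=
    intervalIntegral.integral_nonneg hb (fun x _ => div_nonneg (h0 x) (sq_nonneg _))
  linarith

lemma hU_diff (U : ℝ → ℝ) (hc : Continuous U) (h0 : ∀ y, 0 ≤ U y)
    (hm : MonotoneOn U (Set.Icc 0 Real.pi)) (θ : ℝ) (ha : 0 < θ) (hb : θ ≤ 1) :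
    hU U θ ≤ hU U (3 * θ / 2) + U (3 * θ / 2) / θ := by
  rw [hU_split U hc θ (3 * θ / 2) ha (by linarith)]
  have hpi := Real.pi_gt_three
  have := intervalIntegral.norm_integral_le_of_norm_le_const (a := θ) (b := 3 * θ / 2)
    (f := fun x => U x / x ^ 2) (C := U (3 * θ / 2) / θ ^ 2) (by
      intro x hx
      rw [uIoc_of_le (by linarith)] at hx
      rw [Real.norm_eq_abs, abs_of_nonneg (div_nonneg (h0 x) (sq_nonneg _))]
      have h1 : U x ≤ U (3 * θ / 2) :=
        hm ⟨by linarith [hx.1], by linarith [hx.2]⟩ ⟨by linarith, by linarith⟩ hx.2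
      have h2 : θ ≤ x := hx.1.le
      have := h0 (3 * θ / 2)
      gcongr)
  rw [Real.norm_eq_abs, abs_of_nonneg (by linarith : 0 ≤ 3 * θ / 2 - θ)] at this
  have h3 := (le_abs_self _).trans this
  have h4 : U (3 * θ / 2) / θ ^ 2 * (3 * θ / 2 - θ) = U (3 * θ / 2) / θ / 2 := by
    field_simp; ring
  have h5 : 0 ≤ U (3 * θ / 2) / θ := div_nonneg (h0 _) ha.le
  linarith

lemma far_int (U : ℝ → ℝ) (hc : Continuous U) (h0 : ∀ y, 0 ≤ U y) (θ : ℝ) (ha : 0 < θ)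
    (hb : θ ≤ 1) (hmax : ∀ y, U y ≤ U Real.pi) :
    ∫ φ in (θ / 2)..Real.pi, U (min (3 * φ) Real.pi) / φ ^ 2 ≤
      3 * hU U θ + 3 * U Real.pi := by
  have hpi := Real.pi_gt_three
  have hc' : Continuous (fun φ => U (min (3 * φ) Real.pi)) := by fun_prop
  have hle : θ / 2 ≤ Real.pi / 3 := by linarith
  rw [← intervalIntegral.integral_add_adjacent_intervals
    (ii_div_sq _ hc' (θ / 2) (Real.pi / 3) (by linarith) (by linarith))
    (ii_div_sq _ hc' (Real.pi / 3) Real.pi (by linarith) (by linarith))]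
  have e1 : ∫ φ in (θ / 2)..(Real.pi / 3), U (min (3 * φ) Real.pi) / φ ^ 2 =
      3 * hU U (3 * θ / 2) := by
    have : ∫ φ in (θ / 2)..(Real.pi / 3), U (min (3 * φ) Real.pi) / φ ^ 2 =
      ∫ φ in (θ / 2)..(Real.pi / 3), 9 * (U (3 * φ) / (3 * φ) ^ 2) := by
      apply intervalIntegral.integral_congr
      intro x hx
      rw [uIcc_of_le hle] at hx
      have hx0 : 0 < x := by linarith [hx.1]
      simp only
      rw [min_eq_left (by linarith [hx.2])]
      field_simp
      ring
    rw [this, intervalIntegral.integral_const_mul,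
      intervalIntegral.integral_comp_mul_left (fun x => U x / x ^ 2) (by norm_num : (3:ℝ) ≠ 0)]
    unfold hU
    rw [show 3 * (Real.pi / 3) = Real.pi by ring, show 3 * (θ / 2) = 3 * θ / 2 by ring, smul_eq_mul]
    ring
  have e2 := hU_anti U hc h0 θ (3 * θ / 2) ha (by linarith)
  have e3 := intervalIntegral.norm_integral_le_of_norm_le_const (a := Real.pi / 3) (b := Real.pi)
    (f := fun φ => U (min (3 * φ) Real.pi) / φ ^ 2) (C := U Real.pi / 1 ^ 2) (by
      intro x hx
      rw [uIoc_of_le (by linarith)] at hx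
      rw [Real.norm_eq_abs, abs_of_nonneg (div_nonneg (h0 _) (sq_nonneg _))]
      have h1 := hmax (min (3 * x) Real.pi)
      have h2 : 1 ≤ x := by linarith [hx.1]
      have := h0 Real.pi
      gcongr)
  rw [Real.norm_eq_abs, abs_of_nonneg (by linarith : 0 ≤ Real.pi - Real.pi / 3)] at e3
  have h3 := (le_abs_self _).trans e3
  have h4 : U Real.pi / 1 ^ 2 * (Real.pi - Real.pi / 3) ≤ 3 * U Real.pi := by
    have := Real.pi_lt_d2
    have := h0 Real.pi
    nlinarith
  linarith

lemma far_bd (U : ℝ → ℝ) (hc : Continuous U) (h0 : ∀ y, 0 ≤ U y) (θ : ℝ) (ha : 0 < θ)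
    (hb : θ ≤ 1) (hmax : ∀ y, U y ≤ U Real.pi) (f : ℝ → ℝ) (hf : Continuous f) (A : ℝ) (hA : 0 ≤ A)
    (hfA : ∀ φ, θ / 2 ≤ φ → φ ≤ Real.pi → |f φ| ≤ A * (U (min (3 * φ) Real.pi) / φ ^ 2)) :
    |∫ φ in (θ / 2)..Real.pi, f φ| ≤ A * (3 * hU U θ + 3 * U Real.pi) := by
  have hpi := Real.pi_gt_three
  have hc' : Continuous (fun φ => U (min (3 * φ) Real.pi)) := by fun_prop
  refine (intervalIntegral.abs_integral_le_integral_abs (by linarith)).trans ?_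
  calc ∫ φ in (θ / 2)..Real.pi, |f φ| ≤
      ∫ φ in (θ / 2)..Real.pi, A * (U (min (3 * φ) Real.pi) / φ ^ 2) := by
        apply intervalIntegral.integral_mono_on (by linarith) (hf.abs.intervalIntegrable _ _)
        · exact (ii_div_sq _ hc' _ _ (by linarith) (by linarith)).const_mul A
        · intro x hx; exact hfA x hx.1 hx.2
    _ ≤ _ := by
      rw [intervalIntegral.integral_const_mul]
      gcongr
      exact far_int U hc h0 θ ha hb hmax

lemma second_diff (U U' U'' : ℝ → ℝ) (θ φ M : ℝ) (hφ : 0 ≤ φ) (hφ2 : φ ≤ θ / 2) (hM : 0 ≤ M)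
    (h1 : ∀ t ∈ Icc (θ / 2) (3 * θ / 2), HasDerivAt U (U' t) t)
    (h2 : ∀ t ∈ Icc (θ / 2) (3 * θ / 2), HasDerivAt U' (U'' t) t)
    (hb : ∀ t ∈ Icc (θ / 2) (3 * θ / 2), |U'' t| ≤ M) :
    |U (θ + φ) + U (θ - φ) - 2 * U θ| ≤ 2 * M * φ ^ 2 := by
  have hg : ∀ x ∈ Icc 0 φ, HasDerivWithinAt (fun x => U (θ + x) + U (θ - x))
      (U' (θ + x) - U' (θ - x)) (Icc 0 φ) x := by
    intro x hx
    have a1 := (h1 (θ + x) ⟨by linarith [hx.1], by linarith [hx.2]⟩).comp_const_add θ x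
    have a2 := (h1 (θ - x) ⟨by linarith [hx.2], by linarith [hx.1]⟩).comp_const_sub θ x
    exact ((a1.add a2).congr_deriv (by ring)).hasDerivWithinAt
  have hgb : ∀ x ∈ Icc 0 φ, ‖U' (θ + x) - U' (θ - x)‖ ≤ 2 * M * φ := by
    intro x hx
    have := (convex_Icc (θ / 2) (3 * θ / 2)).norm_image_sub_le_of_norm_hasDerivWithin_le
      (f := U') (f' := U'') (C := M) (x := θ - x) (y := θ + x)
      (fun t ht => (h2 t ht).hasDerivWithinAt) (fun t ht => by simpa using hb t ht)
      ⟨by linarith [hx.2], by linarith [hx.1]⟩ ⟨by linarith [hx.1], by linarith [hx.2]⟩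
    refine this.trans ?_
    rw [Real.norm_eq_abs, abs_of_nonneg (by linarith [hx.1])]
    nlinarith [hx.2]
  have := (convex_Icc 0 φ).norm_image_sub_le_of_norm_hasDerivWithin_le hg hgb
    (x := 0) (y := φ) ⟨le_rfl, hφ⟩ ⟨hφ, le_rfl⟩
  rw [Real.norm_eq_abs, Real.norm_eq_abs] at this
  simp only [add_zero, sub_zero, abs_of_nonneg hφ] at this
  calc _ = |U (θ + φ) + U (θ - φ) - (U θ + U θ)| := by congr 1; ring
    _ ≤ _ := this
    _ = _ := by ring

lemma first_diff (U U' : ℝ → ℝ) (θ φ M : ℝ) (hφ : 0 ≤ φ) (hφ2 : φ ≤ θ / 2)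
    (h1 : ∀ t ∈ Icc (θ / 2) (3 * θ / 2), HasDerivAt U (U' t) t)
    (hb : ∀ t ∈ Icc (θ / 2) (3 * θ / 2), U' t ≤ M) :
    U (θ + φ) - U (θ - φ) ≤ 2 * M * φ := by
  have hsub : Icc (θ - φ) (θ + φ) ⊆ Icc (θ / 2) (3 * θ / 2) :=
    Icc_subset_Icc (by linarith) (by linarith)
  have := (convex_Icc (θ - φ) (θ + φ)).image_sub_le_mul_sub_of_deriv_le (f := U) (C := M)
    (fun t ht => (h1 t (hsub ht)).continuousAt.continuousWithinAt)
    (fun t ht => (h1 t (hsub (interior_subset ht))).differentiableAt.differentiableWithinAt)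
    (fun t ht => by
      rw [(h1 t (hsub (interior_subset ht))).deriv]; exact hb t (hsub (interior_subset ht)))
    (θ - φ) ⟨le_rfl, by linarith⟩ (θ + φ) ⟨by linarith, le_rfl⟩ (by linarith)
  linarith

lemma delta_int (d b : ℝ) (hd : 0 < d) (hb : 0 ≤ b) :
    ∫ x in (0:ℝ)..b, d / (d + x) ^ 2 ≤ 1 ∧
    IntervalIntegrable (fun x => d / (d + x) ^ 2) volume 0 b := by
  have hI : IntervalIntegrable (fun x => d / (d + x) ^ 2) volume 0 b := by
    apply ContinuousOn.intervalIntegrable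
    apply ContinuousOn.div (by fun_prop) (by fun_prop)
    intro x hx
    rw [uIcc_of_le hb] at hx
    have : 0 < d + x := by linarith [hx.1]
    positivity
  refine ⟨?_, hI⟩
  have : ∫ x in (0:ℝ)..b, d / (d + x) ^ 2 = (-(d * (d + b)⁻¹)) - (-(d * (d + 0)⁻¹)) := by
    refine intervalIntegral.integral_eq_sub_of_hasDerivAt (f := fun x => -(d * (d + x)⁻¹)) ?_ hI
    intro x hx
    rw [uIcc_of_le hb] at hx
    have hx0 : d + x ≠ 0 := by linarith [hx.1]
    have := (((hasDerivAt_inv hx0).comp_const_add d x).const_mul d).neg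
    refine this.congr_deriv ?_
    ring
  rw [this]
  have h2 : d * (d + 0)⁻¹ = 1 := by rw [add_zero]; exact mul_inv_cancel₀ hd.ne'
  have : 0 < d * (d + b)⁻¹ := by positivity
  linarith

lemma small_lem (U : ℝ → ℝ) (hinf : Tendsto (fun t => hU U t) (nhdsWithin 0 (Set.Ioi 0)) atTop)
    (hl : Tendsto (fun t => (U t / t) / Real.log (hU U t))
      (nhdsWithin 0 (Set.Ioi 0)) (nhds 0)) (ε : ℝ) (hε : 0 < ε) :
    ∃ t₀ > 0, ∀ t, 0 < t → t < t₀ → 1 ≤ hU U t ∧ U t ≤ ε * (t * hU U t) := by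
  have h1 := hinf.eventually (eventually_ge_atTop 2)
  have h2 := hl.eventually (gt_mem_nhds hε)
  have h3 := h1.and h2
  rw [eventually_nhdsWithin_iff, Metric.eventually_nhds_iff] at h3
  obtain ⟨t₀, ht0, h⟩ := h3
  refine ⟨t₀, ht0, fun t ht ht1 => ?_⟩
  obtain ⟨ha, hb⟩ := h (y := t) (by rw [Real.dist_eq, sub_zero, abs_of_pos ht]; exact ht1) ht
  have hlog : 0 < Real.log (hU U t) := Real.log_pos (by linarith)
  refine ⟨by linarith, ?_⟩
  rw [div_lt_iff₀ hlog, div_lt_iff₀ ht] at hb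
  have := Real.log_le_sub_one_of_pos (by linarith : 0 < hU U t)
  have h5 : ε * Real.log (hU U t) * t ≤ ε * hU U t * t := by gcongr; linarith
  linarith

lemma far_lower (U : ℝ → ℝ) (hc : Continuous U) (h0 : ∀ y, 0 ≤ U y) (r θ : ℝ) (ha : 0 < θ)
    (hb : θ ≤ 1) (hr : 1 - θ / 4 ≤ r) (hr1 : r < 1) :
    2 / 25 * hU U (3 * θ / 2) - 44 * (U θ / θ) ≤
    ∫ φ in (θ / 2)..Real.pi, (U (θ + φ) + U (θ - φ) - 2 * U θ) * (-Kk r φ) := by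
  have hpi := Real.pi_gt_three
  have hK := Kk_cont r (by linarith) hr1
  have i1 : IntervalIntegrable (fun φ => U (θ + φ) / (θ + φ) ^ 2) volume (θ / 2) Real.pi := by
    apply ContinuousOn.intervalIntegrable
    apply ContinuousOn.div (by fun_prop) (by fun_prop)
    intro x hx
    rw [uIcc_of_le (by linarith)] at hx
    have : 0 < θ + x := by linarith [hx.1]
    positivity
  have i2 : IntervalIntegrable (fun x : ℝ => 1 / x ^ 2) volume (θ / 2) Real.pi :=
    ii_div_sq (fun _ => 1) (by fun_prop) _ _ (by linarith) (by linarith)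
  have key : ∫ φ in (θ / 2)..Real.pi,
      (2 / 25 * (U (θ + φ) / (θ + φ) ^ 2) - 22 * U θ * (1 / φ ^ 2)) ≤
      ∫ φ in (θ / 2)..Real.pi, (U (θ + φ) + U (θ - φ) - 2 * U θ) * (-Kk r φ) := by
    apply intervalIntegral.integral_mono_on (by linarith)
    · exact (i1.const_mul _).sub (i2.const_mul _)
    · exact (by fun_prop : Continuous fun φ =>
        (U (θ + φ) + U (θ - φ) - 2 * U θ) * (-Kk r φ)).intervalIntegrable _ _
    · intro x hx
      have hx0 : 0 < x := by linarith [hx.1]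
      have k1 := Kk_neg r x (by linarith) hr1 hx0 hx.2 (by linarith [hx.1])
      have k2 := Kk_abs r x (by linarith) hr1 hx0.le hx.2
      have k3 : -Kk r x ≤ 11 * (1 / x ^ 2) := by
        rw [mul_one_div, le_div_iff₀ (by positivity)]
        refine le_trans ?_ k2
        gcongr
        exact neg_le_abs _
      have k0 : 0 ≤ -Kk r x := le_trans (by positivity) k1
      have a1 : 2 / 25 * (U (θ + x) / (θ + x) ^ 2) ≤ U (θ + x) * (-Kk r x) := by
        calc 2 / 25 * (U (θ + x) / (θ + x) ^ 2) ≤ 2 / 25 * (U (θ + x) / x ^ 2) := by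
              have := h0 (θ + x)
              gcongr
              linarith
          _ = U (θ + x) * (2 / 25 / x ^ 2) := by ring
          _ ≤ _ := mul_le_mul_of_nonneg_left k1 (h0 _)
      have a2 : 0 ≤ U (θ - x) * (-Kk r x) := mul_nonneg (h0 _) k0
      have a3 := mul_le_mul_of_nonneg_left k3 (h0 θ)
      nlinarith
  refine le_trans ?_ key
  rw [intervalIntegral.integral_sub (i1.const_mul _) (i2.const_mul _),
    intervalIntegral.integral_const_mul, intervalIntegral.integral_const_mul]
  have e1 := inv_sq_int (θ / 2) Real.pi (by linarith) (by linarith)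
  have e2 : ∫ φ in (θ / 2)..Real.pi, U (θ + φ) / (θ + φ) ^ 2 =
      ∫ x in (3 * θ / 2)..(θ + Real.pi), U x / x ^ 2 := by
    rw [intervalIntegral.integral_comp_add_left (fun x => U x / x ^ 2) θ]
    congr 1; ring
  have e3 : hU U (3 * θ / 2) ≤ ∫ x in (3 * θ / 2)..(θ + Real.pi), U x / x ^ 2 := by
    rw [← intervalIntegral.integral_add_adjacent_intervals
      (ii_div_sq U hc (3 * θ / 2) Real.pi (by linarith) (by linarith))
      (ii_div_sq U hc Real.pi (θ + Real.pi) (by linarith) (by linarith))]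
    have : 0 ≤ ∫ x in Real.pi..(θ + Real.pi), U x / x ^ 2 :=
      intervalIntegral.integral_nonneg (by linarith) (fun x _ => div_nonneg (h0 x) (sq_nonneg _))
    unfold hU
    linarith
  rw [e2]
  have e4 : 22 * U θ * (∫ x in (θ / 2)..Real.pi, 1 / x ^ 2) ≤ 22 * U θ * (1 / (θ / 2)) := by
    have := h0 θ
    gcongr
  have e5 : 22 * U θ * (1 / (θ / 2)) = 44 * (U θ / θ) := by field_simp; ring
  linarith

lemma nearK (U U' U'' : ℝ → ℝ) (r θ M : ℝ) (hM : 0 ≤ M) (ha : 0 < θ)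
    (hb : θ ≤ 1) (hr : 1 - θ / 4 ≤ r) (hr1 : r < 1)
    (h1 : ∀ t ∈ Icc (θ / 2) (3 * θ / 2), HasDerivAt U (U' t) t)
    (h2 : ∀ t ∈ Icc (θ / 2) (3 * θ / 2), HasDerivAt U' (U'' t) t)
    (hbd : ∀ t ∈ Icc (θ / 2) (3 * θ / 2), |U'' t| ≤ M) :
    |∫ φ in (0:ℝ)..(θ / 2), (U (θ + φ) + U (θ - φ) - 2 * U θ) * (-Kk r φ)| ≤ 11 * M * θ := by
  have hpi := Real.pi_gt_three
  have := intervalIntegral.norm_integral_le_of_norm_le_const (a := 0) (b := θ / 2)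
    (f := fun φ => (U (θ + φ) + U (θ - φ) - 2 * U θ) * (-Kk r φ)) (C := 2 * M * 11) (by
      intro x hx
      rw [uIoc_of_le (by linarith)] at hx
      have k2 := Kk_abs r x (by linarith) hr1 hx.1.le (by linarith [hx.2])
      have k1 := second_diff U U' U'' θ x M hx.1.le hx.2 hM h1 h2 hbd
      rw [Real.norm_eq_abs, abs_mul, abs_neg]
      calc _ ≤ 2 * M * x ^ 2 * |Kk r x| := by gcongr
        _ = 2 * M * (|Kk r x| * x ^ 2) := by ring
        _ ≤ _ := by gcongr)
  rw [Real.norm_eq_abs, sub_zero, abs_of_nonneg (by linarith : 0 ≤ θ / 2)] at this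
  refine this.trans (le_of_eq (by ring))

lemma nearL (U U' : ℝ → ℝ) (hc : Continuous U) (r θ M : ℝ) (hM : 0 ≤ M) (ha : 0 < θ)
    (hb : θ ≤ 1) (hr : 1 - θ / 4 ≤ r) (hr1 : r < 1)
    (hm : MonotoneOn U (Set.Icc 0 Real.pi))
    (h1 : ∀ t ∈ Icc (θ / 2) (3 * θ / 2), HasDerivAt U (U' t) t)
    (hbd : ∀ t ∈ Icc (θ / 2) (3 * θ / 2), U' t ≤ M) :
    |∫ φ in (0:ℝ)..(θ / 2), (U (θ + φ) - U (θ - φ)) * (-Lk r φ)| ≤ 256 * M := by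
  have hpi := Real.pi_gt_three
  have hL := Lk_cont r (by linarith) hr1
  obtain ⟨d1, d2⟩ := delta_int (1 - r) (θ / 2) (by linarith) (by linarith)
  refine (intervalIntegral.abs_integral_le_integral_abs (by linarith)).trans ?_
  calc _ ≤ ∫ φ in (0:ℝ)..(θ / 2), 256 * M * ((1 - r) / (1 - r + φ) ^ 2) := by
        apply intervalIntegral.integral_mono_on (by linarith)
        · exact (by fun_prop : Continuous fun φ =>
            |(U (θ + φ) - U (θ - φ)) * (-Lk r φ)|).intervalIntegrable _ _
        · exact d2.const_mul _
        · intro x hx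
          have k1 := first_diff U U' θ x M hx.1 hx.2 h1 hbd
          have k2 := Lk_near r x (by linarith) hr1 hx.1 (by linarith [hx.2])
          have k3 := Lk_neg r x (by linarith) hr1 hx.1 (by linarith [hx.2])
          have k4 : U (θ - x) ≤ U (θ + x) := hm ⟨by linarith [hx.2], by linarith [hx.1]⟩
            ⟨by linarith [hx.1], by linarith [hx.2]⟩ (by linarith [hx.1])
          rw [abs_of_nonneg (mul_nonneg (by linarith) k3)]
          calc _ ≤ 2 * M * x * (-Lk r x) := by gcongr
            _ = 2 * M * (x * -Lk r x) := by ring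
            _ ≤ 2 * M * (128 * ((1 - r) / (1 - r + x) ^ 2)) := by gcongr
            _ = _ := by ring
    _ ≤ _ := by
      rw [intervalIntegral.integral_const_mul]
      nlinarith

lemma fin_arith (A B AL BL C₀ W H h3 a u : ℝ) (hC₀ : 0 < C₀) (hW0 : 0 ≤ W) (hu : 0 ≤ u)
    (hh1 : 1 ≤ H) (hdiff : H ≤ h3 + W)
    (hWs : (44 * C₀ + 45) * W ≤ H * (3 / 200)) (hUW : a ≤ W)
    (nK : |A| ≤ 44 * C₀ * W) (nL : |AL| ≤ 256 * (2 * C₀ * W))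
    (fl : 2 / 25 * h3 - 44 * a ≤ B) (fK : |B| ≤ 44 * (3 * H + 3 * u))
    (fL : |BL| ≤ 44 * (3 * H + 3 * u)) :
    3 / 1000 * H ≤ 1 / (2 * Real.pi) * (A + B) ∧
    1 / (2 * Real.pi) * (A + B) ≤ (512 * C₀ + 44 * (3 + 3 * u) + 1) * H ∧
    |1 / (2 * Real.pi) * (AL + BL)| ≤ (512 * C₀ + 44 * (3 + 3 * u) + 1) * H := by
  have hpi := Real.pi_gt_three
  have hCW : 0 ≤ C₀ * W := by positivity
  have hWH : W ≤ H := by linarith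
  have hCWH : C₀ * W ≤ C₀ * H := by gcongr
  have hUH : u ≤ u * H := by nlinarith
  have hp2 : 0 < 2 * Real.pi := by linarith
  have hpd := Real.pi_lt_d2
  have hX1 : 6 / 100 * H ≤ A + B := by
    have := (abs_le.1 nK).1
    linarith
  have hX2 : A + B ≤ (512 * C₀ + 44 * (3 + 3 * u) + 1) * H := by
    have := (abs_le.1 nK).2
    have := (abs_le.1 fK).2
    linarith
  have hX3 : |AL + BL| ≤ (512 * C₀ + 44 * (3 + 3 * u) + 1) * H := by
    have := abs_add_le AL BL
    linarith
  have hq : 1 / (2 * Real.pi) ≤ 1 := by rw [div_le_one hp2]; linarith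
  have hq0 : 0 < 1 / (2 * Real.pi) := by positivity
  refine ⟨?_, ?_, ?_⟩
  · rw [one_div_mul_eq_div, le_div_iff₀ hp2]
    nlinarith
  · have : 0 ≤ A + B := by linarith
    calc _ ≤ 1 * (A + B) := by gcongr
      _ ≤ _ := by linarith
  · rw [abs_mul, abs_of_pos hq0]
    calc _ ≤ 1 * |AL + BL| := by gcongr
      _ ≤ _ := by linarith

theorem stmt12 (U U' U'' : ℝ → ℝ) (hU_mem : ClassU U)
    (hderiv1 : ∀ t ∈ Set.Ioc (0 : ℝ) Real.pi, HasDerivAt U (U' t) t)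
    (hderiv2 : ∀ t ∈ Set.Ioc (0 : ℝ) Real.pi, HasDerivAt U' (U'' t) t)
    (hcont2 : ContinuousOn U'' (Set.Ioc 0 Real.pi))
    (hU'pi : U' Real.pi = 0)
    (hlittleo : Tendsto (fun t => (U t / t) / Real.log (hU U t))
      (nhdsWithin 0 (Set.Ioi 0)) (nhds 0))
    (C₀ : ℝ) (hC₀ : 0 < C₀)
    (hbound : ∀ t : ℝ, 0 < t → t ≤ Real.pi / 2 →
      t * U' t ≤ C₀ * U t ∧ t ^ 2 * |U'' t| ≤ C₀ * U t) :
    ∃ c C θ₀ : ℝ, 0 < c ∧ 0 < C ∧ 0 < θ₀ ∧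
      ∀ θ : ℝ, 0 < θ → θ ≤ θ₀ → ∀ r : ℝ, 1 - θ / 4 ≤ r → r < 1 →
        c * hU U θ ≤ -(deriv (fun s => poisson U s θ) r) ∧
        -(deriv (fun s => poisson U s θ) r) ≤ C * hU U θ ∧
        |deriv (fun s => poisson U r s) θ| ≤ C * hU U θ := by
  obtain ⟨hc, he, hp, hz, hm, hpos, hinf⟩ := hU_mem
  have hpi := Real.pi_gt_three
  have h0 : ∀ y, 0 ≤ U y := fun y => by rw [← hz]; exact (U_max U he hp hm y).1
  have hmax : ∀ y, U y ≤ U Real.pi := fun y => (U_max U he hp hm y).2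
  have hUpi := h0 Real.pi
  obtain ⟨t₀, ht0, hsm⟩ := small_lem U hinf hlittleo (1 / (100 * (44 * C₀ + 45))) (by positivity)
  refine ⟨3 / 1000, 512 * C₀ + 44 * (3 + 3 * U Real.pi) + 1, min 1 (t₀ / 2), by norm_num, by positivity,
    by positivity, ?_⟩
  intro θ hθ hθ0 r hr hr1
  have hθ1 : θ ≤ 1 := hθ0.trans (min_le_left _ _)
  have hθt : θ ≤ t₀ / 2 := hθ0.trans (min_le_right _ _)
  have hr34 : 3 / 4 ≤ r := by linarith
  have hr0 : 0 < r := by linarith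
  have hK := Kk_cont r hr0.le hr1
  have hL := Lk_cont r hr0.le hr1
  set W := U (3 * θ / 2) / θ with hW
  have hW0 : 0 ≤ W := div_nonneg (h0 _) hθ.le
  have hh1 := (hsm θ hθ (by linarith)).1
  set H := hU U θ with hH
  have hanti := hU_anti U hc h0 θ (3 * θ / 2) hθ (by linarith)
  have hdiff := hU_diff U hc h0 hm θ hθ hθ1
  -- smallness of W
  have hWs : (44 * C₀ + 45) * W ≤ H * (3 / 200) := by
    have h := (hsm (3 * θ / 2) (by linarith) (by linarith)).2
    have h2 : W ≤ 1 / (100 * (44 * C₀ + 45)) * (3 / 2 * H) := by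
      rw [hW, div_le_iff₀ hθ]
      calc _ ≤ _ := h
        _ ≤ 1 / (100 * (44 * C₀ + 45)) * (3 * θ / 2 * H) := by gcongr
        _ = _ := by ring
    calc _ ≤ (44 * C₀ + 45) * (1 / (100 * (44 * C₀ + 45)) * (3 / 2 * H)) := by gcongr
      _ = _ := by field_simp; ring
  have hUW : U θ / θ ≤ W := by
    rw [hW]; gcongr
    exact hm ⟨hθ.le, by linarith⟩ ⟨by linarith, by linarith⟩ (by linarith)
  -- derivative bounds
  have hmem : ∀ t ∈ Icc (θ / 2) (3 * θ / 2), t ∈ Ioc 0 Real.pi := fun t ht =>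
    ⟨by linarith [ht.1], by linarith [ht.2]⟩
  have hd1 : ∀ t ∈ Icc (θ / 2) (3 * θ / 2), HasDerivAt U (U' t) t := fun t ht =>
    hderiv1 t (hmem t ht)
  have hd2 : ∀ t ∈ Icc (θ / 2) (3 * θ / 2), HasDerivAt U' (U'' t) t := fun t ht =>
    hderiv2 t (hmem t ht)
  have hUt : ∀ t ∈ Icc (θ / 2) (3 * θ / 2), U t ≤ W * θ := fun t ht => by
    rw [hW, div_mul_cancel₀ _ hθ.ne']
    exact hm ⟨by linarith [ht.1], by linarith [ht.2]⟩ ⟨by linarith, by linarith⟩ ht.2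
  have hb1 : ∀ t ∈ Icc (θ / 2) (3 * θ / 2), U' t ≤ 2 * C₀ * W := fun t ht => by
    have hb := (hbound t (by linarith [ht.1]) (by linarith [ht.2])).1
    have ht0 : 0 < t := by linarith [ht.1]
    have : t * U' t ≤ t * (2 * C₀ * W) := by
      calc _ ≤ C₀ * U t := hb
        _ ≤ C₀ * (W * θ) := by gcongr; exact hUt t ht
        _ ≤ C₀ * (W * (2 * t)) := by gcongr; linarith [ht.1]
        _ = _ := by ring
    exact le_of_mul_le_mul_left this ht0
  have hb2 : ∀ t ∈ Icc (θ / 2) (3 * θ / 2), |U'' t| ≤ 4 * C₀ * W / θ := fun t ht => by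
    have hb := (hbound t (by linarith [ht.1]) (by linarith [ht.2])).2
    have h3 : (θ / 2) ^ 2 * |U'' t| ≤ C₀ * (W * θ) := by
      calc _ ≤ t ^ 2 * |U'' t| := by gcongr; exact ht.1
        _ ≤ C₀ * U t := hb
        _ ≤ C₀ * (W * θ) := by gcongr; exact hUt t ht
    rw [le_div_iff₀ hθ]
    have : θ * (|U'' t| * θ) ≤ θ * (4 * C₀ * W) := by nlinarith
    exact le_of_mul_le_mul_left this hθ
  have nK := nearK U U' U'' r θ (4 * C₀ * W / θ) (by positivity) hθ hθ1 hr hr1 hd1 hd2 hb2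
  rw [show 11 * (4 * C₀ * W / θ) * θ = 44 * C₀ * W by field_simp; ring] at nK
  have nL := nearL U U' hc r θ (2 * C₀ * W) (by positivity) hθ hθ1 hr hr1 hm hd1 hb1
  have fl := far_lower U hc h0 r θ hθ hθ1 hr hr1
  have gKc : Continuous fun φ => (U (θ + φ) + U (θ - φ) - 2 * U θ) * (-Kk r φ) := by fun_prop
  have gLc : Continuous fun φ => (U (θ + φ) - U (θ - φ)) * (-Lk r φ) := by fun_prop
  have hmin : ∀ φ, θ / 2 ≤ φ → U (θ + φ) ≤ U (min (3 * φ) Real.pi) ∧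
      U (θ - φ) ≤ U (min (3 * φ) Real.pi) ∧ U θ ≤ U (min (3 * φ) Real.pi) := fun φ hφ =>
    ⟨U_le_min U he hp hm _ _ (abs_le.2 ⟨by linarith, by linarith⟩),
      U_le_min U he hp hm _ _ (abs_le.2 ⟨by linarith, by linarith⟩),
      U_le_min U he hp hm _ _ (abs_le.2 ⟨by linarith, by linarith⟩)⟩
  have fK := far_bd U hc h0 θ hθ hθ1 hmax _ gKc 44 (by norm_num) (by
    intro φ h1 h2
    have hφ : 0 < φ := by linarith
    obtain ⟨m1, m2, m3⟩ := hmin φ h1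
    have k := Kk_abs r φ hr34 hr1 hφ.le h2
    have k' : |Kk r φ| ≤ 11 / φ ^ 2 := by rwa [le_div_iff₀ (by positivity)]
    have g : |U (θ + φ) + U (θ - φ) - 2 * U θ| ≤ 4 * U (min (3 * φ) Real.pi) := by
      have := h0 (θ + φ); have := h0 (θ - φ); have := h0 θ
      rw [abs_le]; constructor <;> linarith
    rw [abs_mul, abs_neg]
    calc _ ≤ 4 * U (min (3 * φ) Real.pi) * (11 / φ ^ 2) := by
          have := h0 (min (3 * φ) Real.pi)
          gcongr
      _ = _ := by ring)
  have fL := far_bd U hc h0 θ hθ hθ1 hmax _ gLc 44 (by norm_num) (by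
    intro φ h1 h2
    have hφ : 0 < φ := by linarith
    obtain ⟨m1, m2, m3⟩ := hmin φ h1
    have k := Lk_far r φ hr34 hr1 hφ h2
    have k0 := Lk_neg r φ hr34 hr1 hφ.le h2
    have g : |U (θ + φ) - U (θ - φ)| ≤ 2 * U (min (3 * φ) Real.pi) := by
      have := h0 (θ + φ); have := h0 (θ - φ)
      rw [abs_le]; constructor <;> linarith
    have hnn := h0 (min (3 * φ) Real.pi)
    rw [abs_mul, abs_of_nonneg k0]
    calc _ ≤ 2 * U (min (3 * φ) Real.pi) * (16 / φ ^ 2) := by gcongr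
      _ = 32 * (U (min (3 * φ) Real.pi) / φ ^ 2) := by ring
      _ ≤ _ := by gcongr; norm_num)
  rw [dr_formula U hc hp r θ hr0 hr1, dt_formula U hc hp r θ hr0 hr1,
    ← intervalIntegral.integral_add_adjacent_intervals (gKc.intervalIntegrable 0 (θ / 2))
      (gKc.intervalIntegrable (θ / 2) Real.pi),
    ← intervalIntegral.integral_add_adjacent_intervals (gLc.intervalIntegrable 0 (θ / 2))
      (gLc.intervalIntegrable (θ / 2) Real.pi)]
  exact fin_arith _ _ _ _ C₀ W H _ _ (U Real.pi) hC₀ hW0 hUpi hh1 hdiff hWs hUW nK nL fl fK fL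

end
end
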